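/- Let a ≥ 1 and ℓ ≥ 1 be integers, and let k ≥ 2 be a power of 2 with k(a+1) ≤ 2^ℓ − 1. Then every continuous map f : ℝP^{2^ℓ−2−a} → S^{2^ℓ−2} admits a local k-multiplicity: there exists a point x₀ ∈ ℝP^{2^ℓ−2−a} such that every neighborhood of x₀ contains k pairwise distinct points x_1, …, x_k with f(x_1) = ⋯ = f(x_k). -/

import Mathlib

/-- The projectivization of a topological vector space carries the quotient topology
coming from the nonzero vectors. -/
instance projectivizationTopology (K V : Type*) [DivisionRing K] [AddCommGroup V]
    [Module K V] [TopologicalSpace V] : TopologicalSpace (Projectivization K V) :=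
  inferInstanceAs (TopologicalSpace (Quotient (projectivizationSetoid K V)))

/-- A continuous map `f : X → Y` admits a local `k`-multiplicity if there is a point
`x₀` such that every neighborhood of `x₀` contains `k` pairwise distinct points with
equal images under `f`. -/
def AdmitsLocalMultiplicity {X Y : Type*} [TopologicalSpace X] [TopologicalSpace Y]
    (f : X → Y) (k : ℕ) : Prop :=
  ∃ x₀ : X, ∀ U ∈ nhds x₀, ∃ x : Fin k → X,
    Function.Injective x ∧ (∀ i, x i ∈ U) ∧ ∀ i j, f (x i) = f (x j)

/-- The facet of the simplex with vertices `v` opposite to the vertex `j` contains the origin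
in its relative interior. -/
def FacetHit {E : Type*} [AddCommGroup E] [Module ℝ E] {n : ℕ} (v : Fin n → E) (j : Fin n) :
    Prop :=
  ∃ l : Fin n → ℝ, l j = 0 ∧ (∀ i, i ≠ j → 0 < l i) ∧ ∑ i, l i • v i = 0

theorem FacetHit.congr {E : Type*} [AddCommGroup E] [Module ℝ E] {n : ℕ} {v w : Fin n → E}
    {j : Fin n} (h : ∀ i, i ≠ j → v i = w i) (hv : FacetHit v j) : FacetHit w j := by
  obtain ⟨l, h0, hp, hs⟩ := hv
  refine ⟨l, h0, hp, ?_⟩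
  rw [← hs]
  refine Finset.sum_congr rfl fun i _ => ?_
  by_cases hi : i = j
  · simp [hi, h0]
  · rw [h i hi]

theorem FacetHit.map {E F : Type*} [AddCommGroup E] [Module ℝ E] [AddCommGroup F] [Module ℝ F]
    {n : ℕ} {v : Fin n → E} {j : Fin n} (T : E →ₗ[ℝ] F) (hv : FacetHit v j) :
    FacetHit (fun i => T (v i)) j := by
  obtain ⟨l, h0, hp, hs⟩ := hv
  refine ⟨l, h0, hp, ?_⟩
  have := congrArg T hs
  simpa [map_sum] using this

theorem not_facetHit_of_norm_sub_lt {E : Type*} [NormedAddCommGroup E] [NormedSpace ℝ E]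
    {n : ℕ} (hn : 2 ≤ n) {v : Fin n → E} {j : Fin n} (u : E)
    (h : ∀ i, i ≠ j → ‖v i - u‖ < ‖u‖) : ¬ FacetHit v j := by
  rintro ⟨l, h0, hp, hs⟩
  have hnn : ∀ i, 0 ≤ l i := fun i => by
    by_cases hi : i = j
    · simp [hi, h0]
    · exact (hp i hi).le
  have h1 : ∑ i, l i • (v i - u) = -((∑ i, l i) • u) := by
    simp only [smul_sub, Finset.sum_sub_distrib, hs, Finset.sum_smul, zero_sub]
  have h2 : (∑ i, l i) * ‖u‖ ≤ ∑ i, l i * ‖v i - u‖ := by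
    have := norm_sum_le Finset.univ fun i => l i • (v i - u)
    rw [h1, norm_neg, norm_smul, Real.norm_of_nonneg (Finset.sum_nonneg fun i _ => hnn i)] at this
    refine this.trans (le_of_eq (Finset.sum_congr rfl fun i _ => ?_))
    rw [norm_smul, Real.norm_of_nonneg (hnn i)]
  obtain ⟨i, hi⟩ : ∃ i, i ≠ j := by
    have : Nontrivial (Fin n) := Fin.nontrivial_iff_two_le.2 hn
    exact exists_ne j
  have h3 : ∑ i, l i * ‖v i - u‖ < ∑ i, l i * ‖u‖ := by
    refine Finset.sum_lt_sum (fun i _ => ?_) ⟨i, Finset.mem_univ _, ?_⟩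
    · by_cases hi : i = j
      · simp [hi, h0]
      · exact mul_le_mul_of_nonneg_left (h i hi).le (hnn i)
    · exact mul_lt_mul_of_pos_left (h i hi) (hp i hi)
  rw [← Finset.sum_mul] at h3
  linarith

/-- In general position a simplex of dimension `d + 1` mapped linearly to a `d`-dimensional
space has an even number of facets hitting the origin. -/
theorem sum_facetHit_eq_zero {E : Type*} [AddCommGroup E] [Module ℝ E] [FiniteDimensional ℝ E]
    {d : ℕ} (hd : Module.finrank ℝ E = d) (v : Fin (d + 2) → E)
    (hv : ∀ e : Fin d → Fin (d + 2), Function.Injective e → LinearIndependent ℝ (v ∘ e))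
    [DecidablePred (FacetHit v)] :
    ∑ j, (if FacetHit v j then (1 : ZMod 2) else 0) = 0 := by
  -- a linear relation with two vanishing coefficients is trivial
  have key : ∀ l : Fin (d + 2) → ℝ, ∑ i, l i • v i = 0 → ∀ j j', j ≠ j' → l j = 0 → l j' = 0 →
      l = 0 := by
    intro l hl j j' hjj h0 h0'
    have hc : ((Finset.univ.erase j).erase j').card = d := by
      rw [Finset.card_erase_of_mem (by simp [hjj.symm]), Finset.card_erase_of_mem (by simp)]
      simp
    let e := (((Finset.univ.erase j).erase j').orderEmbOfFin hc)
    have he := hv e e.injective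
    rw [Fintype.linearIndependent_iff] at he
    have hsum : ∑ i : Fin d, l (e i) • (v ∘ e) i = 0 := by
      rw [← hl]
      have himg : Finset.univ.map e.toEmbedding = (Finset.univ.erase j).erase j' := by
        simp [e]
      have h1 : ∑ i ∈ (Finset.univ.erase j).erase j', l i • v i = ∑ i, l i • v i := by
        refine Finset.sum_subset (Finset.subset_univ _) fun i _ hi => ?_
        by_cases hij : i = j
        · simp [hij, h0]
        · have : i = j' := by
            by_contra hne
            exact hi (by simp [hij, hne])
          simp [this, h0']
      rw [← h1, ← himg, Finset.sum_map]
      rfl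
    have hz := he (fun i => l (e i)) hsum
    funext i
    by_cases hij : i = j
    · simp [hij, h0]
    by_cases hij' : i = j'
    · simp [hij', h0']
    · have hmem : i ∈ (Finset.univ.erase j).erase j' := by simp [hij, hij']
      have : i ∈ Set.range e := by
        rw [Finset.range_orderEmbOfFin]; exact_mod_cast hmem
      obtain ⟨a, rfl⟩ := this
      exact hz a
  rw [Finset.sum_ite]
  simp only [Finset.sum_const, nsmul_eq_mul, mul_one]
  rcases (Finset.univ.filter (FacetHit v)).eq_empty_or_nonempty with h | ⟨j, hj⟩
  · simp [h]
  obtain ⟨l, hl0, hlp, hls⟩ := (Finset.mem_filter.1 hj).2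
  -- a second relation
  obtain ⟨μ, hμs, hμj⟩ : ∃ μ : Fin (d + 2) → ℝ, ∑ i, μ i • v i = 0 ∧ 0 < μ j := by
    let T : (Fin (d + 2) → ℝ) →ₗ[ℝ] E := Fintype.linearCombination ℝ v
    have hT : ∀ μ, T μ = ∑ i, μ i • v i := fun μ => by
      simp [T, Fintype.linearCombination_apply]
    have hker : 2 ≤ Module.finrank ℝ (LinearMap.ker T) := by
      have h1 := T.finrank_range_add_finrank_ker
      have h2 : Module.finrank ℝ (LinearMap.range T) ≤ d :=
        (Submodule.finrank_le _).trans hd.le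
      simp at h1
      omega
    by_contra hcon
    push Not at hcon
    have hzero : ∀ μ : Fin (d + 2) → ℝ, ∑ i, μ i • v i = 0 → μ j = 0 := by
      intro μ hμ
      refine le_antisymm (hcon μ hμ) ?_
      have := hcon (-μ) (by simp [hμ])
      simpa using this
    obtain ⟨i, hi⟩ : ∃ i, i ≠ j := exists_ne j
    have hle : LinearMap.ker T ≤ Submodule.span ℝ {l} := by
      intro μ hμ
      have hμ' : ∑ i, μ i • v i = 0 := by rw [← hT]; exact hμ
      rw [Submodule.mem_span_singleton]
      refine ⟨μ i / l i, ?_⟩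
      have := key (fun a => μ a - μ i / l i * l a) (by
        simp only [sub_smul, mul_smul, Finset.sum_sub_distrib, ← Finset.smul_sum, hls, hμ']
        simp) i j hi (by
          have := (hlp i hi).ne'
          field_simp; simp) (by simp [hzero μ hμ', hl0])
      funext a
      have := congrFun this a
      simp at this ⊢
      linarith
    have := (Submodule.finrank_mono hle).trans (finrank_span_singleton (K := ℝ) (v := l) (by
      rintro rfl
      have := hlp i hi
      simp at this)).le
    omega
  have hne : (Finset.univ.erase j).Nonempty := by
    obtain ⟨i, hi⟩ : ∃ i, i ≠ j := exists_ne j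
    exact ⟨i, by simp [hi]⟩
  obtain ⟨j', hj', hmax⟩ := Finset.exists_max_image (Finset.univ.erase j)
    (fun i => -μ i / l i) hne
  have hjj' : j' ≠ j := (Finset.mem_erase.1 hj').1
  let ν : Fin (d + 2) → ℝ := fun i => μ i + (-μ j' / l j') * l i
  have hνs : ∑ i, ν i • v i = 0 := by
    simp only [ν, add_smul, mul_smul, Finset.sum_add_distrib, ← Finset.smul_sum, hls, hμs]
    simp
  have hνj' : ν j' = 0 := by
    have := (hlp j' hjj').ne'
    simp only [ν]; field_simp; simp
  have hνj : 0 < ν j := by simp [ν, hl0, hμj]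
  have hνp : ∀ i, i ≠ j' → 0 < ν i := by
    intro i hi
    by_cases hij : i = j
    · rw [hij]; exact hνj
    have h1 : 0 ≤ ν i := by
      have h2 := hmax i (by simp [hij])
      have h3 := hlp i hij
      rw [div_le_iff₀ h3] at h2
      simp only [ν]; linarith
    refine lt_of_le_of_ne h1 fun h0 => ?_
    have := key ν hνs i j' hi h0.symm hνj'
    rw [this] at hνj
    simp at hνj
  have hS : Finset.univ.filter (FacetHit v) = {j, j'} := by
    ext a
    simp only [Finset.mem_filter, Finset.mem_univ, true_and, Finset.mem_insert,
      Finset.mem_singleton]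
    constructor
    · rintro ⟨κ, hκ0, hκp, hκs⟩
      by_contra hcon
      push Not at hcon
      obtain ⟨haj, haj'⟩ := hcon
      -- `κ = x l + y ν`
      let y := κ j / ν j
      let x := κ j' / l j'
      have h1 := key (fun i => κ i - x * l i - y * ν i) (by
        simp only [sub_smul, mul_smul, Finset.sum_sub_distrib, ← Finset.smul_sum, hls, hνs, hκs]
        simp) j j' hjj'.symm (by
          have := hνj.ne'
          simp only [hl0, y]; field_simp; simp) (by
          have := (hlp j' hjj').ne'
          simp only [hνj', x]; field_simp; simp)
      have h2 := congrFun h1 a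
      simp only [hκ0, Pi.zero_apply] at h2
      have hx : 0 < x := div_pos (hκp j' (Ne.symm haj')) (hlp j' hjj')
      have hy : 0 < y := div_pos (hκp j (Ne.symm haj)) hνj
      have := mul_pos hx (hlp a haj)
      have := mul_pos hy (hνp a haj')
      linarith
    · rintro (rfl | rfl)
      · exact ⟨l, hl0, hlp, hls⟩
      · exact ⟨ν, hνj', hνp, hνs⟩
  rw [hS, Finset.card_pair hjj'.symm]
  rfl

theorem sum_zmod_two_eq_zero_of_involution {α : Type*} (s : Finset α) (f : α → ZMod 2)
    (g : α → α) (hs : ∀ a ∈ s, g a ∈ s) (hf : ∀ a ∈ s, f (g a) = f a)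
    (hne : ∀ a ∈ s, g a ≠ a) (hg : ∀ a ∈ s, g (g a) = a) : ∑ a ∈ s, f a = 0 := by
  refine Finset.sum_involution (fun a _ => g a) (fun a ha => ?_) (fun a ha _ => hne a ha)
    hs hg
  rw [hf a ha]
  exact CharTwo.add_self_eq_zero _

/-- A sign as an integer. -/
def intSign (b : Bool) : ℤ := if b then 1 else -1

/-- Flags of the subdivided cube `[-2 L, 2 L] ^ κ`: a cell of side `2`, an orthant and an ordering
of the axes. -/
abbrev CubeFlag (κ : Type*) (d L : ℕ) : Type _ :=
  (κ → Fin (2 * L)) × (κ → Bool) × (κ ≃ Fin (d + 1))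

/-- The vertices of the simplex of the barycentric subdivision given by a flag; the last vertex
is the center of the cell. -/
def flagPt {κ : Type*} {d L : ℕ} (F : CubeFlag κ d L) (j : Fin (d + 2)) : κ → ℤ :=
  fun i => 2 * (F.1 i : ℤ) + 1 - 2 * L +
    if (j : ℕ) ≤ (F.2.2 i : ℕ) then intSign (F.2.1 i) else 0

/-- The facet of the flag opposite to the center of the cell lies on the boundary. -/
def CubeFlag.Outward {κ : Type*} {d L : ℕ} (F : CubeFlag κ d L) : Prop :=
  (F.2.1 (F.2.2.symm (Fin.last d)) = true ∧ (F.1 (F.2.2.symm (Fin.last d)) : ℕ) + 1 = 2 * L) ∨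
  (F.2.1 (F.2.2.symm (Fin.last d)) = false ∧ (F.1 (F.2.2.symm (Fin.last d)) : ℕ) = 0)

section

variable {κ : Type*} [Fintype κ] [DecidableEq κ] {E : Type*} [AddCommGroup E] [Module ℝ E]
  {d L : ℕ}

open scoped Classical in
theorem sum_facetHit_zero (φ : (κ → ℤ) → E) :
    ∑ F : CubeFlag κ d L, (if FacetHit (fun j => φ (flagPt F j)) 0 then (1 : ZMod 2) else 0)
      = 0 := by
  refine sum_zmod_two_eq_zero_of_involution _ _
    (fun F => (F.1, Function.update F.2.1 (F.2.2.symm 0) (!F.2.1 (F.2.2.symm 0)), F.2.2))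
    (fun _ _ => Finset.mem_univ _) (fun F _ => ?_) (fun F _ h => ?_) (fun F _ => ?_)
  · have : ∀ j : Fin (d + 2), j ≠ 0 → flagPt (F.1, Function.update F.2.1 (F.2.2.symm 0)
        (!F.2.1 (F.2.2.symm 0)), F.2.2) j = flagPt F j := by
      intro j hj
      funext i
      simp only [flagPt]
      by_cases hi : i = F.2.2.symm 0
      · subst hi
        have : ¬ (j : ℕ) ≤ 0 := by
          intro h
          exact hj (Fin.ext (by simpa using h))
        simp [hj]
      · rw [Function.update_of_ne hi]
    refine if_congr ⟨fun h => h.congr fun i hi => by rw [this i hi],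
      fun h => h.congr fun i hi => by rw [this i hi]⟩ rfl rfl
  · have := congrFun (congrArg (fun G : CubeFlag κ d L => G.2.1) h) (F.2.2.symm 0)
    simp at this
  · simp

open scoped Classical in
theorem sum_facetHit_middle (φ : (κ → ℤ) → E) (j : Fin d) :
    ∑ F : CubeFlag κ d L,
      (if FacetHit (fun j => φ (flagPt F j)) j.castSucc.succ then (1 : ZMod 2) else 0) = 0 := by
  have hjj : j.castSucc ≠ j.succ := by
    intro h
    have := congrArg Fin.val h
    simp at this
  refine sum_zmod_two_eq_zero_of_involution _ _
    (fun F => (F.1, F.2.1, F.2.2.trans (Equiv.swap j.castSucc j.succ)))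
    (fun _ _ => Finset.mem_univ _) (fun F _ => ?_) (fun F _ h => ?_) (fun F _ => ?_)
  · have : ∀ i : Fin (d + 2), i ≠ j.castSucc.succ → flagPt (F.1, F.2.1,
        F.2.2.trans (Equiv.swap j.castSucc j.succ)) i = flagPt F i := by
      intro i hi
      funext a
      have hi' : (i : ℕ) ≠ j + 1 := fun h => hi (Fin.ext (by simpa using h))
      simp only [flagPt, Equiv.trans_apply]
      congr 1
      refine if_congr ?_ rfl rfl
      rw [Equiv.swap_apply_def]
      split_ifs with h1 h2
      · rw [h1]; simp; omega
      · rw [h2]; simp; omega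
      · rfl
    refine if_congr ⟨fun h => h.congr fun i hi => by rw [this i hi],
      fun h => h.congr fun i hi => by rw [this i hi]⟩ rfl rfl
  · have := congrArg (fun G : CubeFlag κ d L => G.2.2 (F.2.2.symm j.castSucc)) h
    simp at this
    exact hjj this.symm
  · refine Prod.ext rfl (Prod.ext rfl ?_)
    ext i
    simp

open scoped Classical in
theorem sum_facetHit_last_inward (φ : (κ → ℤ) → E) :
    ∑ F : CubeFlag κ d L with ¬ F.Outward,
      (if FacetHit (fun j => φ (flagPt F j)) (Fin.last (d + 1)) then (1 : ZMod 2) else 0) = 0 := by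
  let t : CubeFlag κ d L → κ := fun F => F.2.2.symm (Fin.last d)
  let nb : ℕ → Bool → ℕ := fun c b => if b then c + 1 else c - 1
  let mv : Bool → Fin (2 * L) → Fin (2 * L) := fun b c =>
    if h : nb c b < 2 * L then ⟨nb c b, h⟩ else c
  let g : CubeFlag κ d L → CubeFlag κ d L := fun F =>
    (Function.update F.1 (t F) (mv (F.2.1 (t F)) (F.1 (t F))),
      Function.update F.2.1 (t F) (!F.2.1 (t F)), F.2.2)
  have ht : ∀ F, t (g F) = t F := fun F => rfl
  have hs : ∀ F, (g F).2.1 (t F) = !F.2.1 (t F) := fun F => by simp [g]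
  have hc : ∀ F : CubeFlag κ d L, ¬ F.Outward →
      (((g F).1 (t F) : ℕ) : ℤ) = F.1 (t F) + intSign (F.2.1 (t F)) := by
    intro F hF
    have h1 : (g F).1 (t F) = mv (F.2.1 (t F)) (F.1 (t F)) := by simp [g]
    rw [h1]
    have h2 := (F.1 (t F)).2
    unfold CubeFlag.Outward at hF
    push Not at hF
    obtain ⟨hF1, hF2⟩ := hF
    cases hb : F.2.1 (t F)
    · have h3 : (F.1 (t F) : ℕ) ≠ 0 := hF2 hb
      have h4 : nb (F.1 (t F)) false < 2 * L := by simp [nb]; omega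
      simp only [mv, h4, dif_pos, intSign]
      simp [nb]; omega
    · have h3 : (F.1 (t F) : ℕ) + 1 ≠ 2 * L := hF1 hb
      have h4 : nb (F.1 (t F)) true < 2 * L := by simp [nb]; omega
      simp only [mv, h4, dif_pos, intSign]
      simp [nb]
  have ho : ∀ F : CubeFlag κ d L, ¬ F.Outward → ¬ (g F).Outward := by
    intro F hF ho
    have h1 := hc F hF
    have h2 := hs F
    have h3 := (F.1 (t F)).2
    rcases ho with ⟨ho1, ho2⟩ | ⟨ho1, ho2⟩
    · have ho1' : (g F).2.1 (t F) = true := ho1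
      have ho2' : ((g F).1 (t F) : ℕ) + 1 = 2 * L := ho2
      rw [ho1'] at h2
      have h4 : F.2.1 (t F) = false := by simpa using h2.symm
      rw [h4] at h1
      simp [intSign] at h1
      omega
    · have ho1' : (g F).2.1 (t F) = false := ho1
      have ho2' : ((g F).1 (t F) : ℕ) = 0 := ho2
      rw [ho1'] at h2
      have h4 : F.2.1 (t F) = true := by simpa using h2.symm
      rw [h4] at h1
      simp [intSign] at h1
      omega
  refine sum_zmod_two_eq_zero_of_involution _ _ g
    (fun F hF => ?_) (fun F hF => ?_) (fun F hF h => ?_) (fun F hF => ?_)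
  · simpa using ho F (by simpa using hF)
  · have hF' : ¬ F.Outward := by simpa using hF
    have : ∀ j : Fin (d + 2), j ≠ Fin.last (d + 1) → flagPt (g F) j = flagPt F j := by
      intro j hj
      have hj' : (j : ℕ) ≤ d := by
        have := j.2
        have h2 : (j : ℕ) ≠ d + 1 := fun h => hj (Fin.ext (by simpa using h))
        omega
      funext i
      by_cases hi : i = t F
      · subst hi
        have h1 : (g F).2.2 (t F) = Fin.last d := by simp [g, t]
        have h2 : F.2.2 (t F) = Fin.last d := by simp [t]
        simp only [flagPt, hc F hF', hs F, h1, h2, Fin.val_last, hj', if_true]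
        cases F.2.1 (t F) <;> simp [intSign] <;> ring
      · simp [flagPt, g, Function.update_of_ne hi]
    refine if_congr ⟨fun h => h.congr fun i hi => by rw [this i hi],
      fun h => h.congr fun i hi => by rw [this i hi]⟩ rfl rfl
  · have h1 := hs F
    rw [h] at h1
    simp at h1
  · have hF' : ¬ F.Outward := by simpa using hF
    have h1 := hc F hF'
    have h2 := hc (g F) (ho F hF')
    rw [ht, hs] at h2
    refine Prod.ext ?_ (Prod.ext ?_ rfl)
    · funext i
      by_cases hi : i = t F
      · subst hi
        apply Fin.ext
        zify
        rw [h2, h1]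
        cases F.2.1 (t F) <;> simp [intSign]
      · have : i ≠ t (g F) := hi
        change Function.update (Function.update F.1 (t F) _) (t (g F)) _ i = _
        rw [Function.update_of_ne this, Function.update_of_ne hi]
    · funext i
      by_cases hi : i = t F
      · subst hi
        have := hs (g F)
        rw [ht F] at this
        exact this.trans (by rw [hs, Bool.not_not])
      · have : i ≠ t (g F) := hi
        change Function.update (Function.update F.2.1 (t F) _) (t (g F)) _ i = _
        rw [Function.update_of_ne this, Function.update_of_ne hi]

open scoped Classical in
/-- The boundary of a subdivided cube of dimension `d + 1`, mapped in general position to a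
`d`-dimensional space, has an even number of facets hitting the origin. -/
theorem sum_facetHit_outward [FiniteDimensional ℝ E] (hd : Module.finrank ℝ E = d)
    (φ : (κ → ℤ) → E)
    (hφ : ∀ (F : CubeFlag κ d L) (e : Fin d → Fin (d + 2)), Function.Injective e →
      LinearIndependent ℝ (fun i => φ (flagPt F (e i)))) :
    ∑ F : CubeFlag κ d L with F.Outward,
      (if FacetHit (fun j => φ (flagPt F j)) (Fin.last (d + 1)) then (1 : ZMod 2) else 0) = 0 := by
  have h0 : ∑ F : CubeFlag κ d L, ∑ j, (if FacetHit (fun j => φ (flagPt F j)) j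
      then (1 : ZMod 2) else 0) = 0 :=
    Finset.sum_eq_zero fun F _ => sum_facetHit_eq_zero hd (fun j => φ (flagPt F j)) (hφ F)
  rw [Finset.sum_comm, Fin.sum_univ_castSucc, Fin.sum_univ_succ] at h0
  rw [Fin.castSucc_zero, sum_facetHit_zero, zero_add,
    Finset.sum_eq_zero (fun j _ => by
      rw [← Fin.succ_castSucc]; exact sum_facetHit_middle φ j), zero_add] at h0
  rw [← Finset.sum_filter_add_sum_filter_not _ (fun F : CubeFlag κ d L => F.Outward),
    sum_facetHit_last_inward, add_zero] at h0
  exact h0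

end

theorem finite_setOf_not_linearIndependent_line {E : Type*} [AddCommGroup E] [Module ℝ E]
    [FiniteDimensional ℝ E] {d : ℕ} (hd : Module.finrank ℝ E = d) (A B : Fin d → E)
    (hB : LinearIndependent ℝ B) :
    {s : ℝ | ¬ LinearIndependent ℝ (fun i => (1 - s) • A i + s • B i)}.Finite := by
  classical
  let b : Module.Basis (Fin d) ℝ E := Module.finBasisOfFinrankEq ℝ E hd
  let M := b.toMatrix A
  let N := b.toMatrix B
  have hLI : ∀ v : Fin d → E, LinearIndependent ℝ v ↔ (b.toMatrix v).det ≠ 0 := by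
    intro v
    rw [← isUnit_iff_ne_zero, ← Module.Basis.det_apply, ← Module.Basis.is_basis_iff_det]
    constructor
    · intro h
      exact ⟨h, h.span_eq_top_of_card_eq_finrank' (by simp [hd])⟩
    · exact fun h => h.1
  let p : Polynomial ℝ := (Matrix.of fun i j =>
    (1 - Polynomial.X) * Polynomial.C (M i j) + Polynomial.X * Polynomial.C (N i j)).det
  have hp : ∀ s, p.eval s = (b.toMatrix (fun i => (1 - s) • A i + s • B i)).det := by
    intro s
    change Polynomial.evalRingHom s p = _
    rw [RingHom.map_det]
    congr 1
    ext i j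
    simp [M, N, Module.Basis.toMatrix_apply]
    ring
  have hp0 : p ≠ 0 := by
    intro h
    have h1 := hp 1
    rw [h] at h1
    simp only [Polynomial.eval_zero, sub_self, zero_smul, one_smul, zero_add] at h1
    exact (hLI B).1 hB h1.symm
  refine (p.rootSet_finite ℝ).subset fun s hs => ?_
  rw [Polynomial.mem_rootSet]
  refine ⟨hp0, ?_⟩
  by_contra hne
  refine hs ((hLI _).2 ?_)
  rw [← hp]
  simpa using hne

/-- Perturbation to general position inside an affinely closed family of functions. -/
theorem exists_linearIndependent_near {Y E : Type*} [NormedAddCommGroup E] [NormedSpace ℝ E]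
    [FiniteDimensional ℝ E] {d : ℕ} (hd : Module.finrank ℝ E = d) (S : Set (Y → E))
    (hS : ∀ φ ∈ S, ∀ ψ ∈ S, ∀ s : ℝ, (fun y => (1 - s) • φ y + s • ψ y) ∈ S)
    (T : Finset (Fin d → Y)) (hT : ∀ τ ∈ T, ∃ φ ∈ S, LinearIndependent ℝ (fun i => φ (τ i)))
    (Y₀ : Finset Y) (φ : Y → E) (hφ : φ ∈ S) (η : ℝ) (hη : 0 < η) :
    ∃ ψ ∈ S, (∀ y ∈ Y₀, ‖ψ y - φ y‖ < η) ∧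
      ∀ τ ∈ T, LinearIndependent ℝ (fun i => ψ (τ i)) := by
  classical
  induction T using Finset.induction_on generalizing η with
  | empty => exact ⟨φ, hφ, by simpa using fun _ _ => hη, by simp⟩
  | insert τ T hτ ih =>
    obtain ⟨φ₁, h₁, hn₁, hi₁⟩ := ih (fun τ' h => hT τ' (Finset.mem_insert_of_mem h)) (η / 2)
      (by linarith)
    obtain ⟨φ₂, h₂, hi₂⟩ := hT τ (Finset.mem_insert_self _ _)
    have hc : ∀ y, Continuous fun s : ℝ => (1 - s) • φ₁ y + s • φ₂ y := fun y => by fun_prop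
    have e1 : ∀ᶠ s in nhdsWithin (0 : ℝ) {0}ᶜ,
        LinearIndependent ℝ (fun i => (1 - s) • φ₁ (τ i) + s • φ₂ (τ i)) := by
      have hfin := finite_setOf_not_linearIndependent_line hd (fun i => φ₁ (τ i))
        (fun i => φ₂ (τ i)) hi₂
      have h3 : ∀ᶠ s in nhdsWithin (0 : ℝ) {0}ᶜ, s ∉
          {s : ℝ | ¬ LinearIndependent ℝ (fun i => (1 - s) • φ₁ (τ i) + s • φ₂ (τ i))} \ {0} :=
        nhdsWithin_le_nhds ((hfin.sdiff.isClosed.isOpen_compl).mem_nhds (by simp))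
      filter_upwards [h3, self_mem_nhdsWithin] with s hs hs0
      by_contra hcon
      exact hs ⟨hcon, hs0⟩
    have e2 : ∀ τ' ∈ T, ∀ᶠ s in nhds (0 : ℝ),
        LinearIndependent ℝ (fun i => (1 - s) • φ₁ (τ' i) + s • φ₂ (τ' i)) := by
      intro τ' hτ'
      have hcont : Continuous fun s : ℝ => fun i => (1 - s) • φ₁ (τ' i) + s • φ₂ (τ' i) :=
        continuous_pi fun i => hc _
      refine hcont.continuousAt.eventually (p := fun v => LinearIndependent ℝ v) ?_
      refine isOpen_setOfPred_linearIndependent.mem_nhds ?_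
      simpa using hi₁ τ' hτ'
    have e3 : ∀ y ∈ Y₀, ∀ᶠ s in nhds (0 : ℝ), ‖((1 - s) • φ₁ y + s • φ₂ y) - φ y‖ < η := by
      intro y hy
      have hcont : Continuous fun s : ℝ => ‖((1 - s) • φ₁ y + s • φ₂ y) - φ y‖ :=
        ((hc y).sub continuous_const).norm
      refine hcont.continuousAt.eventually (Iio_mem_nhds ?_)
      have := hn₁ y hy
      simp
      linarith
    have e2' := nhdsWithin_le_nhds (s := ({0}ᶜ : Set ℝ))
      ((Filter.eventually_all_finset T).2 e2)
    have e3' := nhdsWithin_le_nhds (s := ({0}ᶜ : Set ℝ))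
      ((Filter.eventually_all_finset Y₀).2 e3)
    obtain ⟨s, hs1, hs2, hs3⟩ := (e1.and (Filter.Eventually.and e2' e3')).exists
    refine ⟨_, hS φ₁ h₁ φ₂ h₂ s, hs3, fun τ' hτ' => ?_⟩
    rcases Finset.mem_insert.1 hτ' with rfl | h
    · exact hs1
    · exact hs2 τ' h

theorem FacetHit.map_iff {E F : Type*} [AddCommGroup E] [Module ℝ E] [AddCommGroup F] [Module ℝ F]
    {n : ℕ} {v : Fin n → E} {j : Fin n} (T : E →ₗ[ℝ] F) (hT : Function.Injective T) :
    FacetHit (fun i => T (v i)) j ↔ FacetHit v j := by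
  refine ⟨fun ⟨l, h0, hp, hs⟩ => ⟨l, h0, hp, hT ?_⟩, fun h => h.map T⟩
  simpa [map_sum] using hs

/-- An involutive signed permutation of coordinates. -/
structure SignedPerm (κ : Type*) where
  /-- The underlying permutation. -/
  toFun : κ → κ
  /-- The coordinates that change sign. -/
  neg : κ → Bool
  involutive : ∀ a, toFun (toFun a) = a
  neg_toFun : ∀ a, neg (toFun a) = neg a

namespace SignedPerm

variable {κ : Type*}

/-- The action of a signed permutation on vectors. -/
def act {R : Type*} [Neg R] (T : SignedPerm κ) (z : κ → R) : κ → R :=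
  fun a => if T.neg a then -z (T.toFun a) else z (T.toFun a)

/-- The underlying permutation as an equivalence. -/
def equiv (T : SignedPerm κ) : κ ≃ κ := ⟨T.toFun, T.toFun, T.involutive, T.involutive⟩

/-- The extension of a signed permutation by a fixed coordinate. -/
def option (T : SignedPerm κ) : SignedPerm (Option κ) where
  toFun := Option.map T.toFun
  neg a := a.elim false T.neg
  involutive a := by cases a <;> simp [T.involutive]
  neg_toFun a := by cases a <;> simp [T.neg_toFun]

/-- The action of a signed permutation on flags. -/
def actFlag {d L : ℕ} (T : SignedPerm κ) (F : CubeFlag κ d L) : CubeFlag κ d L :=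
  (fun a => if T.neg a then (F.1 (T.toFun a)).rev else F.1 (T.toFun a),
    fun a => if T.neg a then !F.2.1 (T.toFun a) else F.2.1 (T.toFun a),
    T.equiv.trans F.2.2)

theorem flagPt_actFlag {d L : ℕ} (T : SignedPerm κ) (F : CubeFlag κ d L) (j : Fin (d + 2)) :
    flagPt (T.actFlag F) j = T.act (flagPt F j) := by
  funext a
  have h2 := (F.1 (T.toFun a)).2
  simp only [flagPt, actFlag, act, Equiv.trans_apply, equiv, Equiv.coe_fn_mk]
  by_cases hn : T.neg a
  · simp only [hn, if_true, Fin.val_rev]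
    rw [Nat.cast_sub (by omega)]
    push_cast
    cases F.2.1 (T.toFun a) <;> simp only [intSign] <;> split_ifs <;> simp_all <;> ring
  · simp only [hn]
    simp

theorem actFlag_actFlag {d L : ℕ} (T : SignedPerm κ) (F : CubeFlag κ d L) :
    T.actFlag (T.actFlag F) = F := by
  refine Prod.ext ?_ (Prod.ext ?_ ?_)
  · funext a
    by_cases hn : T.neg a <;> simp [actFlag, T.involutive, T.neg_toFun, hn]
  · funext a
    by_cases hn : T.neg a <;> simp [actFlag, T.involutive, T.neg_toFun, hn]
  · ext a
    simp [actFlag, equiv, T.involutive]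

theorem axis_actFlag {d L : ℕ} (T : SignedPerm κ) (F : CubeFlag κ d L) :
    (T.actFlag F).2.2.symm (Fin.last d) = T.toFun (F.2.2.symm (Fin.last d)) := by
  simp [actFlag, equiv]

end SignedPerm

section

variable {κ : Type*} {d L : ℕ}

theorem flagPt_abs_le (F : CubeFlag κ d L) (j : Fin (d + 2)) (a : κ) :
    |flagPt F j a| ≤ 2 * L := by
  have h2 := (F.1 a).2
  have h3 : intSign (F.2.1 a) = 1 ∨ intSign (F.2.1 a) = -1 := by
    cases F.2.1 a <;> simp [intSign]
  rw [abs_le]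
  simp only [flagPt]
  split_ifs <;> omega

theorem flagPt_sub_abs_le (F : CubeFlag κ d L) (j j' : Fin (d + 2)) (a : κ) :
    |flagPt F j a - flagPt F j' a| ≤ 1 := by
  rw [abs_le]
  cases h : F.2.1 a <;> simp only [flagPt, intSign, h] <;> split_ifs <;> simp_all

theorem flagPt_axis (F : CubeFlag κ d L) {j : Fin (d + 2)} (hj : j ≠ Fin.last (d + 1)) :
    flagPt F j (F.2.2.symm (Fin.last d)) =
      2 * (F.1 (F.2.2.symm (Fin.last d)) : ℤ) + 1 - 2 * L +
        intSign (F.2.1 (F.2.2.symm (Fin.last d))) := by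
  have hj' : (j : ℕ) ≤ d := by
    have := j.2
    have h2 : (j : ℕ) ≠ d + 1 := fun h => hj (Fin.ext (by simpa using h))
    omega
  simp [flagPt, hj']

theorem flagPt_injective (F : CubeFlag κ d L) : Function.Injective (flagPt F) := by
  have key : ∀ j j' : Fin (d + 2), j < j' → flagPt F j ≠ flagPt F j' := by
    intro j j' hjj h
    have h1 : (j : ℕ) < d + 1 := by have := j'.2; have : (j : ℕ) < j' := hjj; omega
    have h2 := congrFun h (F.2.2.symm ⟨j, h1⟩)
    have h3 : (j : ℕ) < j' := hjj
    simp only [flagPt, Equiv.apply_symm_apply, le_refl, if_true] at h2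
    rw [if_neg (by omega)] at h2
    cases hb : F.2.1 (F.2.2.symm ⟨j, h1⟩) <;> rw [hb] at h2 <;> simp [intSign] at h2
  intro j j' h
  by_contra hne
  rcases lt_or_gt_of_ne hne with h' | h'
  · exact key _ _ h' h
  · exact key _ _ h' h.symm

open scoped Classical in
/-- The facets on the two sides of the cube orthogonal to an axis cancel if the map is
equivariant with respect to a signed permutation exchanging the two sides. -/
theorem sum_facetHit_axis_eq_zero [Fintype κ] {E : Type*} [AddCommGroup E] [Module ℝ E]
    (i : κ) (T : SignedPerm κ) (hTi : T.toFun i = i) (hneg : T.neg i = true) (ρ : E →ₗ[ℝ] E)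
    (hρ : Function.Injective ρ) (φ : (κ → ℤ) → E)
    (hφ : ∀ Z : κ → ℤ, (∀ a, |Z a| ≤ 2 * L) → |Z i| = 2 * L → φ (T.act Z) = ρ (φ Z)) :
    ∑ F : CubeFlag κ d L with F.Outward ∧ F.2.2.symm (Fin.last d) = i,
      (if FacetHit (fun j => φ (flagPt F j)) (Fin.last (d + 1)) then (1 : ZMod 2) else 0) = 0 := by
  refine sum_zmod_two_eq_zero_of_involution _ _ T.actFlag
    (fun F hF => ?_) (fun F hF => ?_) (fun F hF h => ?_) (fun F hF => T.actFlag_actFlag F)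
  · rw [Finset.mem_filter] at hF ⊢
    obtain ⟨-, ho, hi⟩ := hF
    refine ⟨Finset.mem_univ _, ?_, by rw [T.axis_actFlag, hi, hTi]⟩
    unfold CubeFlag.Outward at ho ⊢
    rw [T.axis_actFlag, hi, hTi]
    rw [hi] at ho
    have h2 := (F.1 i).2
    simp only [SignedPerm.actFlag, hTi, hneg, if_true, Fin.val_rev]
    rcases ho with ⟨h, h'⟩ | ⟨h, h'⟩
    · right; simp [h]; omega
    · left; simp [h]; omega
  · rw [Finset.mem_filter] at hF
    obtain ⟨-, ho, hi⟩ := hF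
    have : ∀ j, j ≠ Fin.last (d + 1) → φ (flagPt (T.actFlag F) j) = ρ (φ (flagPt F j)) := by
      intro j hj
      rw [T.flagPt_actFlag]
      refine hφ _ (flagPt_abs_le F j) ?_
      rw [← hi, flagPt_axis F hj]
      have h2 := (F.1 (F.2.2.symm (Fin.last d))).2
      rcases ho with ⟨h, h'⟩ | ⟨h, h'⟩
      · rw [h, abs_of_nonneg] <;> simp [intSign] <;> omega
      · rw [h, abs_of_nonpos] <;> simp [intSign] <;> omega
    rw [← FacetHit.map_iff (v := fun j => φ (flagPt F j)) ρ hρ]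
    exact if_congr ⟨fun h => h.congr this, fun h => h.congr fun j hj => (this j hj).symm⟩ rfl rfl
  · have h1 := congrFun (congrArg (fun G : CubeFlag κ d L => G.1) h) i
    have h2 := (F.1 i).2
    simp only [SignedPerm.actFlag, hTi, hneg, if_true] at h1
    have h3 := congrArg Fin.val h1
    rw [Fin.val_rev] at h3
    omega

end

section

variable {d L : ℕ}

/-- Partial sums of a family of coefficients. -/
def partialSum (l : Fin (d + 2) → ℝ) (r : ℕ) : ℝ :=
  ∑ j : Fin (d + 2), if (j : ℕ) ≤ r then l j else 0

theorem partialSum_zero (l : Fin (d + 2) → ℝ) : partialSum l 0 = l 0 := by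
  rw [partialSum, Finset.sum_eq_single 0]
  · simp
  · intro j _ hj
    rw [if_neg]
    intro h
    exact hj (Fin.ext (by simpa using h))
  · simp

theorem partialSum_succ (l : Fin (d + 2) → ℝ) {r : ℕ} (hr : r + 1 < d + 2) :
    partialSum l (r + 1) = partialSum l r + l ⟨r + 1, hr⟩ := by
  have : l ⟨r + 1, hr⟩ = ∑ j : Fin (d + 2), if j = ⟨r + 1, hr⟩ then l j else 0 := by simp
  rw [this, partialSum, partialSum, ← Finset.sum_add_distrib]
  refine Finset.sum_congr rfl fun j _ => ?_
  simp only [Fin.ext_iff]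
  split_ifs <;> first | omega | simp

theorem partialSum_lt (l : Fin (d + 2) → ℝ) (hl : ∀ j, j ≠ Fin.last (d + 1) → 0 < l j)
    {r s : ℕ} (hrs : r < s) (hs : s ≤ d) : partialSum l r < partialSum l s := by
  induction s with
  | zero => omega
  | succ s ih =>
    rw [partialSum_succ l (by omega)]
    have h1 : 0 < l ⟨s + 1, by omega⟩ := hl _ (by
      intro h
      have := congrArg Fin.val h
      simp at this
      omega)
    rcases Nat.lt_succ_iff_lt_or_eq.1 hrs with h | rfl
    · have := ih h (by omega)
      linarith
    · linarith

theorem partialSum_of_support (l : Fin (d + 2) → ℝ) {r : ℕ}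
    (hl : ∀ j : Fin (d + 2), r < (j : ℕ) → l j = 0) :
    partialSum l r = ∑ j, l j := by
  refine Finset.sum_congr rfl fun j _ => ?_
  split_ifs with h
  · rfl
  · exact (hl j (by omega)).symm

theorem intSign_mul_self (b : Bool) : ((intSign b : ℤ) : ℝ) * intSign b = 1 := by
  cases b <;> simp [intSign]

theorem partialSum_eq_of_relation {κ : Type*} (F : CubeFlag κ d L) (l : Fin (d + 2) → ℝ) (a : κ)
    (p : ℝ) (h : ∑ j, l j * ((flagPt F j a : ℝ) - p) = 0) :
    partialSum l (F.2.2 a) =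
      (∑ j, l j) * (intSign (F.2.1 a) * (p - (2 * (F.1 a : ℕ) + 1 - 2 * L))) := by
  have h1 : ∑ j, l j * ((flagPt F j a : ℝ) - p) =
      intSign (F.2.1 a) * partialSum l (F.2.2 a) -
        (∑ j, l j) * (p - (2 * (F.1 a : ℕ) + 1 - 2 * L)) := by
    rw [partialSum, Finset.mul_sum, Finset.sum_mul, ← Finset.sum_sub_distrib]
    refine Finset.sum_congr rfl fun j _ => ?_
    simp only [flagPt]
    push_cast
    split_ifs
    · ring
    · ring
  rw [h1, sub_eq_zero] at h
  have h2 := congrArg (fun x => (intSign (F.2.1 a) : ℝ) * x) h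
  rw [← mul_assoc, intSign_mul_self, one_mul] at h2
  rw [h2]; ring

/-- A nontrivial relation between the vertices of a flag and a generic point uses all facets. -/
theorem flag_relation_eq_zero {ι : Type*} (F : CubeFlag (Option ι) d L) (q : ι → ℤ) (y : ι → ℝ)
    (hy0 : ∀ i, 0 < y i) (hy1 : ∀ i, y i < 1) (hy : Function.Injective y)
    (l : Fin (d + 2) → ℝ) (hl : ∀ j : Fin (d + 2), (F.2.2 none : ℕ) < (j : ℕ) → l j = 0)
    (hl0 : ∃ j, j ≠ Fin.last (d + 1) ∧ l j = 0)
    (hrel : ∀ i, ∑ j, l j * ((flagPt F j (some i) : ℝ) - (2 * q i + 1 - 2 * L + y i)) = 0) :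
    l = 0 := by
  let n : ι → ℤ := fun i => q i - F.1 (some i)
  let Y : Option ι → ℝ := fun a => a.elim 1 fun i =>
    intSign (F.2.1 (some i)) * (2 * n i + y i)
  have hC : ∀ a, partialSum l (F.2.2 a) = (∑ j, l j) * Y a := by
    intro a
    cases a with
    | none => simp [Y, partialSum_of_support l hl]
    | some i =>
      rw [partialSum_eq_of_relation F l _ _ (hrel i)]
      simp only [Y, n, Option.elim]
      push_cast
      ring
  have hs : ∀ b, intSign b = 1 ∨ intSign b = -1 := fun b => by cases b <;> simp [intSign]
  have hY0 : ∀ a, Y a ≠ 0 := by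
    intro a
    cases a with
    | none => simp [Y]
    | some i =>
      simp only [Y, Option.elim]
      intro h
      have h1 := hy0 i
      have h2 := hy1 i
      have h3 : (2 * n i : ℝ) + y i = 0 := by
        rcases hs (F.2.1 (some i)) with h' | h' <;> rw [h'] at h <;> push_cast at h <;> linarith
      have h4 : (-1 : ℝ) < ((2 * n i : ℤ) : ℝ) := by push_cast; linarith
      have h5 : ((2 * n i : ℤ) : ℝ) < 0 := by push_cast; linarith
      have h6 : -1 < 2 * n i := by exact_mod_cast h4
      have h7 : 2 * n i < 0 := by exact_mod_cast h5
      omega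
  have key : ∀ (N : ℤ) (t : ℝ), -2 < t → t < 2 → 2 * (N : ℝ) = t → t = 0 := by
    intro N t h1 h2 h3
    have h4 : (-2 : ℝ) < ((2 * N : ℤ) : ℝ) := by push_cast; linarith
    have h5 : ((2 * N : ℤ) : ℝ) < 2 := by push_cast; linarith
    have h6 : -2 < 2 * N := by exact_mod_cast h4
    have h7 : 2 * N < 2 := by exact_mod_cast h5
    have h8 : N = 0 := by omega
    rw [← h3, h8]; simp
  have hnone : ∀ i, Y (some i) ≠ 1 := by
    intro i h
    simp only [Y, Option.elim] at h
    have h1 := hy0 i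
    have h2 := hy1 i
    rcases hs (F.2.1 (some i)) with h' | h' <;> rw [h'] at h <;> push_cast at h
    · have := key (n i) (1 - y i) (by linarith) (by linarith) (by linarith)
      linarith
    · have := key (n i + 1) (1 - y i) (by linarith) (by linarith) (by push_cast; linarith)
      linarith
  have hYinj : Function.Injective Y := by
    intro a b hab
    cases a with
    | none =>
      cases b with
      | none => rfl
      | some j => exact absurd hab.symm (hnone j)
    | some i =>
      cases b with
      | none => exact absurd hab (hnone i)
      | some j =>
        simp only [Y, Option.elim] at hab
        have h1 := hy0 i
        have h2 := hy1 i
        have h1' := hy0 j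
        have h2' := hy1 j
        have fin : ∀ N : ℤ, 2 * (N : ℝ) = y i - y j → some i = some j := by
          intro N hN
          have := key N _ (by linarith) (by linarith) hN
          rw [hy (sub_eq_zero.1 this)]
        have fin2 : ∀ N : ℤ, 2 * (N : ℝ) = y i + y j → False := by
          intro N hN
          have := key N _ (by linarith) (by linarith) hN
          linarith
        rcases hs (F.2.1 (some i)) with h' | h' <;> rcases hs (F.2.1 (some j)) with h'' | h'' <;>
          rw [h', h''] at hab <;> push_cast at hab
        · exact fin (n j - n i) (by push_cast; linarith)
        · exact (fin2 (-n j - n i) (by push_cast; linarith)).elim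
        · exact (fin2 (-n j - n i) (by push_cast; linarith)).elim
        · exact fin (n j - n i) (by push_cast; linarith)
  have hC' : ∀ r (hr : r < d + 1), partialSum l r = (∑ j, l j) * Y (F.2.2.symm ⟨r, hr⟩) := by
    intro r hr
    have := hC (F.2.2.symm ⟨r, hr⟩)
    simpa using this
  have hΛ : ∑ j, l j = 0 := by
    by_contra hne
    obtain ⟨j, hj, hj0⟩ := hl0
    have hjd : (j : ℕ) < d + 1 := by
      have := j.2
      have h2 : (j : ℕ) ≠ d + 1 := fun h => hj (Fin.ext (by simpa using h))
      omega
    obtain ⟨r, hr⟩ | hr : (∃ r, (j : ℕ) = r + 1) ∨ (j : ℕ) = 0 := by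
      rcases Nat.eq_zero_or_pos (j : ℕ) with h | h
      · exact Or.inr h
      · exact Or.inl ⟨j - 1, by omega⟩
    · have h1 := partialSum_succ l (r := r) (by omega)
      have h2 : (⟨r + 1, by omega⟩ : Fin (d + 2)) = j := Fin.ext hr.symm
      rw [h2, hj0, add_zero, hC' _ (by omega), hC' r (by omega)] at h1
      have h3 := F.2.2.symm.injective (hYinj (mul_left_cancel₀ hne h1))
      simp at h3
    · have h1 := partialSum_zero l
      have h2 : j = 0 := Fin.ext (by simpa using hr)
      rw [h2] at hj0
      rw [hj0, hC' 0 (by omega)] at h1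
      exact mul_ne_zero hne (hY0 _) h1
  have hz : ∀ r, r < d + 1 → partialSum l r = 0 := fun r hr => by rw [hC' r hr, hΛ, zero_mul]
  funext j
  rcases Nat.lt_or_ge j (d + 1) with hj | hj
  · obtain ⟨r, hr⟩ | hr : (∃ r, (j : ℕ) = r + 1) ∨ (j : ℕ) = 0 := by
      rcases Nat.eq_zero_or_pos (j : ℕ) with h | h
      · exact Or.inr h
      · exact Or.inl ⟨j - 1, by omega⟩
    · have h1 := partialSum_succ l (r := r) (by omega)
      have h2 : (⟨r + 1, by omega⟩ : Fin (d + 2)) = j := Fin.ext hr.symm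
      rw [h2, hz _ (by omega), hz _ (by omega)] at h1
      simpa using h1.symm
    · have h2 : j = 0 := Fin.ext (by simpa using hr)
      rw [h2, ← partialSum_zero l, hz 0 (by omega)]
      rfl
  · exact hl j (by have := (F.2.2 none).2; omega)

/-- The only facet containing a generic point is the expected one. -/
theorem flag_hit_unique {ι : Type*} (F : CubeFlag (Option ι) d L) (q : ι → ℤ)
    (rk : Option ι ≃ Fin (d + 1)) (hrk : rk none = Fin.last d)
    (hF : F.2.2 none = Fin.last d)
    (l : Fin (d + 2) → ℝ) (hlast : l (Fin.last (d + 1)) = 0)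
    (hl : ∀ j, j ≠ Fin.last (d + 1) → 0 < l j)
    (hrel : ∀ i, ∑ j, l j * ((flagPt F j (some i) : ℝ) -
      (2 * q i + 1 - 2 * L + ((rk (some i) : ℕ) + 1) / (d + 1))) = 0) :
    (∀ i, (F.1 (some i) : ℤ) = q i) ∧ (∀ i, F.2.1 (some i) = true) ∧ F.2.2 = rk := by
  have hd : (0 : ℝ) < d + 1 := by positivity
  have hsupp : ∀ j : Fin (d + 2), d < (j : ℕ) → l j = 0 := by
    intro j hj
    have : j = Fin.last (d + 1) := Fin.ext (by have := j.2; simp; omega)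
    rw [this, hlast]
  have hΛ := partialSum_of_support l hsupp
  have hpos0 : 0 < partialSum l 0 := by
    rw [partialSum_zero]
    exact hl 0 (by simp [Fin.ext_iff])
  have hnn : ∀ r, r ≤ d → 0 < partialSum l r := by
    intro r hr
    rcases Nat.eq_zero_or_pos r with rfl | h
    · exact hpos0
    · exact hpos0.trans (partialSum_lt l hl h hr)
  have hΛpos : 0 < ∑ j, l j := by rw [← hΛ]; exact hnn d le_rfl
  have hne : ∀ i, (F.2.2 (some i) : ℕ) < d := by
    intro i
    have h1 := (F.2.2 (some i)).2
    have h2 : F.2.2 (some i) ≠ Fin.last d := by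
      rw [← hF]
      intro h
      simpa using F.2.2.injective h
    have h3 : (F.2.2 (some i) : ℕ) ≠ d := fun h => h2 (Fin.ext (by simpa using h))
    omega
  have hne' : ∀ i, (rk (some i) : ℕ) < d := by
    intro i
    have h1 := (rk (some i)).2
    have h2 : rk (some i) ≠ Fin.last d := by
      rw [← hrk]
      intro h
      simpa using rk.injective h
    have h3 : (rk (some i) : ℕ) ≠ d := fun h => h2 (Fin.ext (by simpa using h))
    omega
  have hmain : ∀ i, (F.1 (some i) : ℤ) = q i ∧ F.2.1 (some i) = true := by
    intro i
    have h1 := partialSum_eq_of_relation F l _ _ (hrel i)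
    have h2 := hnn _ (hne i).le
    have h3 := partialSum_lt l hl (hne i) le_rfl
    rw [hΛ] at h3
    rw [h1] at h2 h3
    have h4 := pos_of_mul_pos_right h2 hΛpos.le
    have h5 := lt_of_mul_lt_mul_left (h3.trans_eq (mul_one _).symm) hΛpos.le
    have hy0 : (0 : ℝ) < ((rk (some i) : ℕ) + 1) / (d + 1) := by positivity
    have hy1 : ((rk (some i) : ℕ) + 1 : ℝ) / (d + 1) < 1 := by
      rw [div_lt_one hd]
      have : ((rk (some i) : ℕ) : ℝ) < d := by exact_mod_cast hne' i
      linarith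
    generalize ((rk (some i) : ℕ) + 1 : ℝ) / (d + 1) = t at *
    have h6 : (-1 : ℝ) < 2 * ((q i - (F.1 (some i) : ℕ) : ℤ) : ℝ) + t ∧
        2 * ((q i - (F.1 (some i) : ℕ) : ℤ) : ℝ) + t < 1 := by
      cases hb : F.2.1 (some i) <;> rw [hb] at h4 h5 <;> simp [intSign] at h4 h5 <;>
        push_cast <;> constructor <;> linarith
    have h7 : q i - (F.1 (some i) : ℕ) = 0 := by
      have h8 : (-2 : ℝ) < ((2 * (q i - (F.1 (some i) : ℕ)) : ℤ) : ℝ) := by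
        push_cast at h6 ⊢; linarith
      have h9 : ((2 * (q i - (F.1 (some i) : ℕ)) : ℤ) : ℝ) < 1 := by
        push_cast at h6 ⊢; linarith
      have h8' : -2 < 2 * (q i - (F.1 (some i) : ℕ)) := by exact_mod_cast h8
      have h9' : 2 * (q i - (F.1 (some i) : ℕ)) < 1 := by exact_mod_cast h9
      omega
    refine ⟨by omega, ?_⟩
    by_contra hb
    have hb' : F.2.1 (some i) = false := by simpa using hb
    have hq : (q i : ℝ) = (F.1 (some i) : ℕ) := by
      have : q i = (F.1 (some i) : ℕ) := by omega
      rw [this]; simp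
    rw [hb', hq] at h4
    simp [intSign] at h4
    linarith
  refine ⟨fun i => (hmain i).1, fun i => (hmain i).2, ?_⟩
  have hps : ∀ i, partialSum l (F.2.2 (some i)) =
      (∑ j, l j) * (((rk (some i) : ℕ) + 1) / (d + 1)) := by
    intro i
    rw [partialSum_eq_of_relation F l _ _ (hrel i), (hmain i).2, ← (hmain i).1]
    simp [intSign]
  have hmono : StrictMono (F.2.2.symm.trans rk) := by
    intro r s hrs
    simp only [Equiv.trans_apply]
    obtain ⟨a, rfl⟩ := F.2.2.surjective r
    obtain ⟨b, rfl⟩ := F.2.2.surjective s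
    simp only [Equiv.symm_apply_apply]
    cases a with
    | none =>
      rw [hF] at hrs
      exact absurd (Fin.le_last _) (not_le.2 hrs)
    | some i =>
      cases b with
      | none =>
        rw [hrk]
        exact Fin.lt_def.2 (by simpa using hne' i)
      | some j =>
        have h1 := partialSum_lt l hl (Fin.lt_def.1 hrs) (hne j).le
        rw [hps, hps] at h1
        have h2 := lt_of_mul_lt_mul_left h1 hΛpos.le
        rw [div_lt_div_iff_of_pos_right hd] at h2
        have h3 : ((rk (some i) : ℕ) : ℝ) < (rk (some j) : ℕ) := by linarith
        exact Fin.lt_def.2 (by exact_mod_cast h3)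
  have hid : ((F.2.2.symm.trans rk : Fin (d + 1) ≃ Fin (d + 1)) : Fin (d + 1) → Fin (d + 1)) = id :=
    (hmono.range_inj strictMono_id).1 (by simp)
  ext a
  have := congrFun hid (F.2.2 a)
  simp at this
  rw [this]

/-- The expected facet does contain the generic point. -/
theorem flag_hit_rel {ι : Type*} (F : CubeFlag (Option ι) d L) (q : ι → ℤ)
    (hq : ∀ i, (F.1 (some i) : ℤ) = q i) (hs : ∀ i, F.2.1 (some i) = true) (i : ι) :
    ∑ j : Fin (d + 2), (if j = Fin.last (d + 1) then (0 : ℝ) else 1) *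
      ((flagPt F j (some i) : ℝ) -
        (2 * q i + 1 - 2 * L + ((F.2.2 (some i) : ℕ) + 1) / (d + 1))) = 0 := by
  rw [Fin.sum_univ_castSucc]
  have h0 : ∀ j : Fin (d + 1), j.castSucc ≠ Fin.last (d + 1) := fun j => (Fin.castSucc_lt_last j).ne
  have h1 : ∀ j : Fin (d + 1), ((flagPt F j.castSucc (some i) : ℝ) -
      (2 * q i + 1 - 2 * L + ((F.2.2 (some i) : ℕ) + 1) / (d + 1))) =
      (if (j : ℕ) < (F.2.2 (some i) : ℕ) + 1 then 1 else 0) -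
        ((F.2.2 (some i) : ℕ) + 1) / (d + 1) := by
    intro j
    simp only [flagPt, hs, intSign, if_true, Fin.val_castSucc, ← hq, Nat.lt_succ_iff]
    push_cast
    ring
  simp only [h0, if_false, if_true, zero_mul, add_zero, one_mul, h1, Finset.sum_sub_distrib]
  have h2 : ∑ j : Fin (d + 1), (if (j : ℕ) < (F.2.2 (some i) : ℕ) + 1 then (1 : ℝ) else 0) =
      (F.2.2 (some i) : ℕ) + 1 := by
    rw [Finset.sum_boole]
    have : (Finset.univ.filter fun j : Fin (d + 1) => (j : ℕ) < (F.2.2 (some i) : ℕ) + 1) =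
        Finset.Iic (F.2.2 (some i)) := by
      ext j
      simp only [Finset.mem_filter, Finset.mem_univ, true_and, Finset.mem_Iic, Fin.le_def,
        Nat.lt_succ_iff]
    rw [this, Fin.card_Iic (F.2.2 (some i))]
    push_cast
    ring
  rw [h2]
  simp
  field_simp
  ring

end

theorem exists_linearIndependent_extend {E : Type*} [AddCommGroup E] [Module ℝ E]
    [FiniteDimensional ℝ E] {d : ℕ} (hd : Module.finrank ℝ E = d) (P : Finset (Fin d))
    (v : Fin d → E) (h : LinearIndepOn ℝ v (P : Set (Fin d))) :
    ∃ w : Fin d → E, (∀ i ∈ P, w i = v i) ∧ LinearIndependent ℝ w := by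
  classical
  induction hn : (Finset.univ \ P).card generalizing P v with
  | zero =>
    have hP : P = Finset.univ := by
      rw [Finset.card_eq_zero, Finset.sdiff_eq_empty_iff_subset] at hn
      exact Finset.univ_subset_iff.1 hn
    subst hP
    refine ⟨v, fun _ _ => rfl, ?_⟩
    simpa [linearIndepOn_univ_iff] using h
  | succ n ih =>
    obtain ⟨i, hi⟩ := Finset.card_pos.1 (by rw [hn]; exact Nat.succ_pos n)
    have hiP : i ∉ P := (Finset.mem_sdiff.1 hi).2
    have hlt : P.card < d := by
      have := Finset.card_lt_univ_of_notMem hiP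
      simpa using this
    obtain ⟨x, hx⟩ : ∃ x, x ∉ Submodule.span ℝ (v '' P) := by
      by_contra hcon
      push Not at hcon
      have htop : Submodule.span ℝ (v '' P) = ⊤ := by
        rw [eq_top_iff]; exact fun x _ => hcon x
      have h1 := finrank_span_finset_le_card (R := ℝ) (P.image v)
      rw [Set.finrank, Finset.coe_image, htop, finrank_top, hd] at h1
      have := Finset.card_image_le (s := P) (f := v)
      omega
    let v' := Function.update v i x
    have hv' : ∀ j ∈ P, v' j = v j := fun j hj => by
      have : j ≠ i := fun h => hiP (h ▸ hj)
      simp [v', this]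
    have himg : v' '' P = v '' P := Set.image_congr fun j hj => hv' j hj
    have hLI : LinearIndepOn ℝ v' (insert i P : Finset (Fin d)) := by
      rw [Finset.coe_insert]
      refine LinearIndepOn.insert ((linearIndepOn_congr fun j hj => hv' j hj).2 h) ?_
      rw [himg]
      simpa [v'] using hx
    obtain ⟨w, hw, hw'⟩ := ih (insert i P) v' hLI (by
      rw [Finset.sdiff_insert, Finset.card_erase_of_mem hi, hn]; rfl)
    exact ⟨w, fun j hj => (hw j (Finset.mem_insert_of_mem hj)).trans (hv' j hj), hw'⟩

set_option maxHeartbeats 400000 in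
open scoped Classical in
/-- Discrete form of the parity principle: a homotopy of equivariant maps of the boundary of
the cube has an even number of zeros, located at the pinned places. -/
theorem even_card_of_pinned_family {ι E J : Type*} [Fintype ι] [Fintype J]
    [NormedAddCommGroup E] [NormedSpace ℝ E] [FiniteDimensional ℝ E] {d L : ℕ}
    (hd : Module.finrank ℝ E = d) (hL : 1 ≤ L)
    (T : ι → SignedPerm ι) (hTi : ∀ i, (T i).toFun i = i) (hTn : ∀ i, (T i).neg i = true)
    (ρ : ι → E →ₗ[ℝ] E) (hρ : ∀ i, Function.Injective (ρ i))
    (rk : Option ι ≃ Fin (d + 1)) (hrk : rk none = Fin.last d)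
    (near : J → Set (ι → ℤ)) (q : J → ι → Fin (2 * L)) (lin : J → (ι → ℝ) →ₗ[ℝ] E)
    (hlin : ∀ j, Function.Injective (lin j))
    (near_interior : ∀ j, ∀ W ∈ near j, ∀ i, |W i| < 2 * L)
    (near_unique : ∀ j j', ∀ W ∈ near j, ∀ W' ∈ near j', (∀ i, |W i - W' i| ≤ 1) → j = j')
    (near_center : ∀ j (W : ι → ℤ),
      (∀ i, |W i - (2 * ((q j i : ℕ) : ℤ) + 1 - 2 * (L : ℤ))| ≤ 1) → W ∈ near j)
    (pin : (ι → ℤ) → E)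
    (hpin : ∀ j, ∀ W ∈ near j, pin W = lin j fun i => (W i : ℝ) -
      (2 * (q j i : ℕ) + 1 - 2 * L + ((rk (some i) : ℕ) + 1) / (d + 1)))
    (good : ∀ (F : CubeFlag (Option ι) d L) (val : (ι → ℤ) → E), ∃ G : (ι → ℤ) → E,
      (∀ i (W : ι → ℤ), (∀ a, |W a| ≤ 2 * (L : ℤ)) → |W i| = 2 * (L : ℤ) →
        G ((T i).act W) = ρ i (G W)) ∧
      ∀ j, G (fun i => flagPt F j (some i)) = val fun i => flagPt F j (some i))
    (φ₀ : (Option ι → ℤ) → E) (η : ℝ) (hη : 0 < η)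
    (φ₀_equiv : ∀ i (Z : Option ι → ℤ), (∀ a, |Z (some a)| ≤ 2 * L) → |Z (some i)| = 2 * L →
      φ₀ ((T i).option.act Z) = ρ i (φ₀ Z))
    (φ₀_pin : ∀ j (Z : Option ι → ℤ), Z none = 2 * L → (fun i => Z (some i)) ∈ near j →
      φ₀ Z = pin fun i => Z (some i))
    (bottom : ∀ F : CubeFlag (Option ι) d L, (∀ j, j ≠ Fin.last (d + 1) →
      flagPt F j none = -(2 * L)) → ∃ u, ∀ j, j ≠ Fin.last (d + 1) →
        ‖φ₀ (flagPt F j) - u‖ + η < ‖u‖)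
    (top : ∀ F : CubeFlag (Option ι) d L, (∀ j, j ≠ Fin.last (d + 1) →
      flagPt F j none = 2 * L) → (∃ j, j ≠ Fin.last (d + 1) ∧ ∀ a,
        (fun i => flagPt F j (some i)) ∉ near a) → ∃ u, ∀ j, j ≠ Fin.last (d + 1) →
        ‖φ₀ (flagPt F j) - u‖ + η < ‖u‖) :
    Even (Fintype.card J) := by
  let sp : (Option ι → ℤ) → ι → ℤ := fun Z i => Z (some i)
  let S : Set ((Option ι → ℤ) → E) := {φ |
    (∀ i (Z : Option ι → ℤ), (∀ a, |Z (some a)| ≤ 2 * L) → |Z (some i)| = 2 * L →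
      φ ((T i).option.act Z) = ρ i (φ Z)) ∧
    ∀ j (Z : Option ι → ℤ), Z none = 2 * L → sp Z ∈ near j → φ Z = pin (sp Z)}
  have hS : ∀ φ ∈ S, ∀ ψ ∈ S, ∀ s : ℝ, (fun y => (1 - s) • φ y + s • ψ y) ∈ S := by
    intro φ hφ ψ hψ s
    refine ⟨fun i Z h1 h2 => ?_, fun j Z h1 h2 => ?_⟩
    · simp [hφ.1 i Z h1 h2, hψ.1 i Z h1 h2]
    · simp only [hφ.2 j Z h1 h2, hψ.2 j Z h1 h2]
      rw [← add_smul]; simp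
  have hspact : ∀ i Z, sp ((T i).option.act Z) = (T i).act (sp Z) := fun i Z => rfl
  have hnoneact : ∀ i (Z : Option ι → ℤ), (T i).option.act Z none = Z none := fun i Z => rfl
  have hrky : ∀ i, 0 < (((rk (some i) : ℕ) : ℝ) + 1) / (d + 1) ∧
      (((rk (some i) : ℕ) : ℝ) + 1) / (d + 1) < 1 := by
    intro i
    have h1 := (rk (some i)).2
    have h2 : rk (some i) ≠ Fin.last d := by
      rw [← hrk]
      intro h
      simpa using rk.injective h
    have h3 : (rk (some i) : ℕ) ≠ d := fun h => h2 (Fin.ext (by simpa using h))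
    have h4 : (rk (some i) : ℕ) < d := by omega
    have h5 : ((rk (some i) : ℕ) : ℝ) < d := by exact_mod_cast h4
    refine ⟨by positivity, ?_⟩
    rw [div_lt_one (by positivity)]
    linarith
  have hrkinj : Function.Injective fun i => (((rk (some i) : ℕ) : ℝ) + 1) / (d + 1) := by
    intro i i' h
    have hd' : (d : ℝ) + 1 ≠ 0 := by positivity
    have h1 : ((rk (some i) : ℕ) : ℝ) = (rk (some i') : ℕ) := by
      have := (div_left_inj' hd').1 h
      linarith
    have h2 : (rk (some i) : ℕ) = (rk (some i') : ℕ) := by exact_mod_cast h1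
    simpa using rk.injective (Fin.ext h2)
  -- tuples of vertices of a flag can be made independent
  have generic : ∀ (F : CubeFlag (Option ι) d L) (e : Fin d → Fin (d + 2)),
      Function.Injective e → ∃ φ ∈ S, LinearIndependent ℝ fun i => φ (flagPt F (e i)) := by
    intro F e he
    let P : Finset (Fin d) := Finset.univ.filter fun i =>
      flagPt F (e i) none = 2 * L ∧ ∃ j, sp (flagPt F (e i)) ∈ near j
    let v : Fin d → E := fun i => pin (sp (flagPt F (e i)))
    have hLI : LinearIndepOn ℝ v (P : Set (Fin d)) := by
      rcases P.eq_empty_or_nonempty with hP | ⟨i₀, hi₀⟩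
      · rw [hP]; simp
      obtain ⟨j, hj⟩ := (Finset.mem_filter.1 hi₀).2.2
      have hall : ∀ i ∈ P, sp (flagPt F (e i)) ∈ near j := by
        intro i hi
        obtain ⟨j', hj'⟩ := (Finset.mem_filter.1 hi).2.2
        rwa [near_unique j j' _ hj _ hj' fun a => flagPt_sub_abs_le F _ _ _]
      rw [linearIndepOn_finset_iff]
      intro f hf
      let l : Fin (d + 2) → ℝ := fun b => ∑ i ∈ P, if e i = b then f i else 0
      have hle : ∀ i ∈ P, l (e i) = f i := by
        intro i hi
        simp only [l]
        rw [Finset.sum_eq_single i]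
        · simp
        · intro i' _ hne
          rw [if_neg fun h => hne (he h)]
        · exact fun h => (h hi).elim
      have hl0 : ∀ b, (∀ i ∈ P, e i ≠ b) → l b = 0 := by
        intro b hb
        exact Finset.sum_eq_zero fun i hi => if_neg (hb i hi)
      have hlsum : ∀ g : Fin (d + 2) → ℝ, ∑ b, l b * g b = ∑ i ∈ P, f i * g (e i) := by
        intro g
        simp only [l, Finset.sum_mul]
        rw [Finset.sum_comm]
        refine Finset.sum_congr rfl fun i _ => ?_
        simp
      have hPle : ∀ i ∈ P, (e i : ℕ) ≤ (F.2.2 none : ℕ) := by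
        intro i hi
        have h1 := (Finset.mem_filter.1 hi).2.1
        by_contra hcon
        simp only [flagPt, hcon, if_false] at h1
        omega
      have hzero := flag_relation_eq_zero F (fun i => ((q j i : ℕ) : ℤ))
        (fun i => (((rk (some i) : ℕ) : ℝ) + 1) / (d + 1)) (fun i => (hrky i).1)
        (fun i => (hrky i).2) hrkinj l (fun b hb => hl0 b fun i hi h => by
          have := hPle i hi
          rw [h] at this
          omega) ?_ ?_
      · intro i hi
        rw [← hle i hi, hzero]; rfl
      · have hcard : (P.image e).card < (Finset.univ.map
            (Fin.castSuccEmb (n := d + 1))).card := by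
          rw [Finset.card_map, Finset.card_univ, Fintype.card_fin]
          calc _ ≤ P.card := Finset.card_image_le
            _ ≤ d := by simpa using Finset.card_le_univ P
            _ < d + 1 := Nat.lt_succ_self d
        obtain ⟨b, hb, hb'⟩ := Finset.exists_mem_notMem_of_card_lt_card hcard
        obtain ⟨b', -, rfl⟩ := Finset.mem_map.1 hb
        refine ⟨_, (Fin.castSucc_lt_last b').ne, hl0 _ fun i hi h => hb' ?_⟩
        exact Finset.mem_image.2 ⟨i, hi, h⟩
      · have h1 : lin j (∑ i ∈ P, f i • fun a => ((flagPt F (e i) (some a) : ℝ) -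
            (2 * (q j a : ℕ) + 1 - 2 * L + ((rk (some a) : ℕ) + 1) / (d + 1)))) = 0 := by
          rw [map_sum, ← hf]
          refine Finset.sum_congr rfl fun i hi => ?_
          rw [map_smul]
          simp only [v]
          rw [hpin j _ (hall i hi)]
        rw [map_eq_zero_iff _ (hlin j)] at h1
        intro a
        rw [hlsum]
        have := congrFun h1 a
        simpa using this
    obtain ⟨w, hw, hwLI⟩ := exists_linearIndependent_extend hd P v hLI
    have hτ : Function.Injective fun i => flagPt F (e i) := (flagPt_injective F).comp he
    let valfun : (Option ι → ℤ) → E := Function.extend (fun i => flagPt F (e i)) w 0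
    choose G hG1 hG2 using fun t : ℤ => good F fun W => valfun fun a => a.elim t W
    let φ : (Option ι → ℤ) → E := fun Z =>
      if Z none = 2 * L ∧ ∃ j, sp Z ∈ near j then pin (sp Z) else G (Z none) (sp Z)
    refine ⟨φ, ⟨fun i Z h1 h2 => ?_, fun j Z h1 h2 => ?_⟩, ?_⟩
    · have hn1 : ¬ (Z none = 2 * L ∧ ∃ j, sp Z ∈ near j) := by
        rintro ⟨-, j, hj⟩
        exact (near_interior j _ hj i).ne h2
      have hn2 : ¬ ((T i).option.act Z none = 2 * L ∧ ∃ j, sp ((T i).option.act Z) ∈ near j) := by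
        rintro ⟨-, j, hj⟩
        refine (near_interior j _ hj i).ne ?_
        rw [hspact]
        simpa [SignedPerm.act, hTi, hTn, sp] using h2
      simp only [φ]
      rw [if_neg hn1, if_neg hn2, hspact, hnoneact]
      exact hG1 _ i _ h1 h2
    · simp only [φ]
      rw [if_pos ⟨h1, j, h2⟩]
    · convert hwLI using 1
      funext i
      simp only [φ]
      split_ifs with hc
      · have : i ∈ P := Finset.mem_filter.2 ⟨Finset.mem_univ _, hc⟩
        rw [hw i this]
      · have h1 := hG2 (flagPt F (e i) none) (e i)
        have h2 : (fun a : Option ι => a.elim (flagPt F (e i) none)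
            fun i' => flagPt F (e i) (some i')) = flagPt F (e i) := by
          funext a; cases a <;> rfl
        refine h1.trans ?_
        simp only [h2, valfun]
        exact hτ.extend_apply w 0 i
  obtain ⟨φ, hφS, hφη, hφLI⟩ := exists_linearIndependent_near hd S hS
    ((Finset.univ.filter fun p : CubeFlag (Option ι) d L × (Fin d → Fin (d + 2)) =>
      Function.Injective p.2).image fun p i => flagPt p.1 (p.2 i))
    (by
      intro τ hτ
      obtain ⟨p, hp, rfl⟩ := Finset.mem_image.1 hτ
      exact generic p.1 p.2 (Finset.mem_filter.1 hp).2)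
    (Finset.univ.image fun p : CubeFlag (Option ι) d L × Fin (d + 2) => flagPt p.1 p.2)
    φ₀ ⟨φ₀_equiv, φ₀_pin⟩ η hη
  have hφη' : ∀ (F : CubeFlag (Option ι) d L) j, ‖φ (flagPt F j) - φ₀ (flagPt F j)‖ < η :=
    fun F j => hφη _ (Finset.mem_image.2 ⟨(F, j), Finset.mem_univ _, rfl⟩)
  have hsum := sum_facetHit_outward (L := L) (κ := Option ι) hd φ (by
    intro F e he
    exact hφLI _ (Finset.mem_image.2 ⟨(F, e), Finset.mem_filter.2 ⟨Finset.mem_univ _, he⟩, rfl⟩))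
  have hax : ∀ i, ∑ F : CubeFlag (Option ι) d L with
      F.Outward ∧ F.2.2.symm (Fin.last d) = some i,
      (if FacetHit (fun j => φ (flagPt F j)) (Fin.last (d + 1)) then (1 : ZMod 2) else 0) = 0 := by
    intro i
    have h := sum_facetHit_axis_eq_zero (d := d) (L := L) (some i)
      (T i).option (by simp [SignedPerm.option, hTi]) (by simp [SignedPerm.option, hTn])
      (ρ i) (hρ i) φ fun Z h1 h2 => hφS.1 i Z (fun a => h1 _) h2
    convert h
  replace hsum : ∑ F : CubeFlag (Option ι) d L with
      F.Outward ∧ F.2.2.symm (Fin.last d) = none,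
      (if FacetHit (fun j => φ (flagPt F j)) (Fin.last (d + 1)) then (1 : ZMod 2) else 0) = 0 := by
    rw [← Finset.sum_fiberwise _ fun F : CubeFlag (Option ι) d L => F.2.2.symm (Fin.last d),
      Fintype.sum_option] at hsum
    simp only [Finset.filter_filter] at hsum
    rwa [Finset.sum_eq_zero (s := Finset.univ) (fun i _ => hax i), add_zero] at hsum
  rw [Finset.sum_boole, Finset.filter_filter] at hsum
  have nohit : ∀ F : CubeFlag (Option ι) d L, (∃ u, ∀ j, j ≠ Fin.last (d + 1) →
        ‖φ₀ (flagPt F j) - u‖ + η < ‖u‖) →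
      ¬ FacetHit (fun j => φ (flagPt F j)) (Fin.last (d + 1)) := by
    rintro F ⟨u, hu⟩
    refine not_facetHit_of_norm_sub_lt (by omega) u fun j hj => ?_
    have h1 := hu j hj
    have h2 := hφη' F j
    have h3 := norm_add_le (φ (flagPt F j) - φ₀ (flagPt F j)) (φ₀ (flagPt F j) - u)
    rw [sub_add_sub_cancel] at h3
    linarith
  let FJ : J → CubeFlag (Option ι) d L := fun j =>
    (fun a => a.elim ⟨2 * L - 1, by omega⟩ (q j), fun _ => true, rk)
  have hFJ_near : ∀ j b, sp (flagPt (FJ j) b) ∈ near j := by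
    intro j b
    refine near_center j _ fun i => ?_
    simp only [sp, flagPt, FJ, Option.elim, intSign, if_true]
    split_ifs <;> simp
  have hFJ_inj : Function.Injective FJ := by
    intro j j' h
    refine near_unique j j' _ (hFJ_near j 0) _ (hFJ_near j' 0) fun i => ?_
    rw [h]; simp
  have hset : (Finset.univ.filter fun F : CubeFlag (Option ι) d L =>
      (F.Outward ∧ F.2.2.symm (Fin.last d) = none) ∧
        FacetHit (fun j => φ (flagPt F j)) (Fin.last (d + 1))) = Finset.univ.image FJ := by
    ext F
    simp only [Finset.mem_filter, Finset.mem_univ, true_and, Finset.mem_image]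
    constructor
    · rintro ⟨⟨ho, hax⟩, hhit⟩
      have htime := fun j hj => flagPt_axis F (j := j) hj
      unfold CubeFlag.Outward at ho
      rw [hax] at ho htime
      rcases ho with ⟨hs, hc⟩ | ⟨hs, hc⟩
      swap
      · refine absurd hhit (nohit F (bottom F fun j hj => ?_))
        rw [htime j hj, hs, hc]
        simp only [intSign]
        push_cast
        ring_nf
      have htime' : ∀ j, j ≠ Fin.last (d + 1) → flagPt F j none = 2 * L := by
        intro j hj
        rw [htime j hj, hs]
        simp [intSign]
        omega
      have hall : ∀ b, b ≠ Fin.last (d + 1) → ∃ j, sp (flagPt F b) ∈ near j := by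
        by_contra hcon
        push Not at hcon
        exact nohit F (top F htime' hcon) hhit
      obtain ⟨j, hj⟩ := hall 0 (by simp [Fin.ext_iff])
      have hall' : ∀ b, b ≠ Fin.last (d + 1) → sp (flagPt F b) ∈ near j := by
        intro b hb
        obtain ⟨j', hj'⟩ := hall b hb
        rwa [near_unique j j' _ hj _ hj' fun a => flagPt_sub_abs_le F _ _ _]
      obtain ⟨l, hl0, hlp, hls⟩ := hhit
      have hrel : ∀ i, ∑ b, l b * ((flagPt F b (some i) : ℝ) -
          (2 * (((q j i : ℕ) : ℤ) : ℝ) + 1 - 2 * L + ((rk (some i) : ℕ) + 1) / (d + 1))) = 0 := by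
        have h1 : lin j (∑ b, l b • fun a => ((flagPt F b (some a) : ℝ) -
            (2 * (q j a : ℕ) + 1 - 2 * L + ((rk (some a) : ℕ) + 1) / (d + 1)))) = 0 := by
          rw [map_sum, ← hls]
          refine Finset.sum_congr rfl fun b _ => ?_
          by_cases hb : b = Fin.last (d + 1)
          · rw [hb, hl0]; simp
          · rw [map_smul]
            change _ = l b • φ (flagPt F b)
            rw [hφS.2 j _ (htime' b hb) (hall' b hb), hpin j _ (hall' b hb)]
        rw [map_eq_zero_iff _ (hlin j)] at h1
        intro a
        have := congrFun h1 a
        simpa using this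
      have hpi : F.2.2 none = Fin.last d := by rw [← hax]; simp
      obtain ⟨g1, g2, g3⟩ := flag_hit_unique F _ rk hrk hpi l hl0 hlp hrel
      refine ⟨j, Prod.ext ?_ (Prod.ext ?_ g3.symm)⟩
      · funext a
        cases a with
        | none =>
          apply Fin.ext
          simp only [FJ, Option.elim]
          omega
        | some i =>
          apply Fin.ext
          have := g1 i
          simp only [FJ, Option.elim]
          omega
      · funext a
        cases a with
        | none => exact hs.symm
        | some i => exact (g2 i).symm
    · rintro ⟨j, rfl⟩
      have hax : (FJ j).2.2.symm (Fin.last d) = none := by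
        rw [← hrk]; exact rk.symm_apply_apply none
      have ho : (FJ j).2.1 none = true ∧ ((FJ j).1 none : ℕ) + 1 = 2 * L := by
        refine ⟨rfl, ?_⟩
        simp only [FJ, Option.elim]
        omega
      refine ⟨⟨?_, hax⟩, fun b => if b = Fin.last (d + 1) then 0 else 1, by simp, ?_, ?_⟩
      · unfold CubeFlag.Outward
        rw [hax]
        exact Or.inl ho
      · intro i hi
        simp [hi]
      · have htime : ∀ b, b ≠ Fin.last (d + 1) → flagPt (FJ j) b none = 2 * L := by
          intro b hb
          have h1 := flagPt_axis (FJ j) hb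
          rw [hax] at h1
          rw [h1, ho.1]
          have h2 : (((FJ j).1 none : ℕ) : ℤ) + 1 = 2 * L := by exact_mod_cast ho.2
          simp only [intSign, if_true]
          omega
        have h1 : lin j (∑ b : Fin (d + 2), (if b = Fin.last (d + 1) then (0 : ℝ) else 1) •
            fun a => ((flagPt (FJ j) b (some a) : ℝ) -
            (2 * (q j a : ℕ) + 1 - 2 * L + ((rk (some a) : ℕ) + 1) / (d + 1)))) = 0 := by
          rw [map_eq_zero_iff _ (hlin j)]
          funext i
          have := flag_hit_rel (FJ j) (fun i => ((q j i : ℕ) : ℤ)) (fun _ => rfl)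
            (fun _ => rfl) i
          rw [Finset.sum_apply]
          refine Eq.trans (Finset.sum_congr rfl fun b _ => ?_) this
          rw [Pi.smul_apply, smul_eq_mul]
          simp [FJ]
        rw [← h1, map_sum]
        refine Finset.sum_congr rfl fun b _ => ?_
        by_cases hb : b = Fin.last (d + 1)
        · simp [hb]
        · rw [map_smul]
          change (_ : ℝ) • φ (flagPt (FJ j) b) = _
          rw [hφS.2 j _ (htime b hb) (hFJ_near j b), hpin j _ (hFJ_near j b)]
  rw [hset, Finset.card_image_of_injective _ hFJ_inj, Finset.card_univ,
    ZMod.natCast_eq_zero_iff_even] at hsum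
  exact hsum

open Filter Topology in
/-- Parity principle: for two maps of a cube that satisfy the same equivariance conditions on the
boundary, if one has no zeros then the other one has an even number of zeros, provided these are
nondegenerate. -/
theorem even_card_of_equivariant_cube_maps {ι E J : Type*} [Fintype ι] [Fintype J]
    [NormedAddCommGroup E] [NormedSpace ℝ E] [FiniteDimensional ℝ E]
    (hd : Module.finrank ℝ E = Fintype.card ι)
    (T : ι → SignedPerm ι) (hTi : ∀ i, (T i).toFun i = i) (hTn : ∀ i, (T i).neg i = true)
    (ρ : ι → E →ₗ[ℝ] E) (hρ : ∀ i, Function.Injective (ρ i))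
    (Φ Ψ : (ι → ℝ) → E) (hΦ : Continuous Φ) (hΨ : Continuous Ψ)
    (hΦT : ∀ i (z : ι → ℝ), ‖z‖ ≤ 1 → |z i| = 1 → Φ ((T i).act z) = ρ i (Φ z))
    (hΨT : ∀ i (z : ι → ℝ), ‖z‖ ≤ 1 → |z i| = 1 → Ψ ((T i).act z) = ρ i (Ψ z))
    (hΦ0 : ∀ z, ‖z‖ ≤ 1 → Φ z ≠ 0)
    (c : J → ι → ℝ) (hc : Function.Injective c) (hc1 : ∀ j, ‖c j‖ < 1)
    (hΨ0 : ∀ z, ‖z‖ ≤ 1 → Ψ z = 0 → ∃ j, z = c j)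
    (lin : J → (ι → ℝ) →ₗ[ℝ] E) (hlin : ∀ j, Function.Injective (lin j))
    (hloc : ∀ j, ∀ᶠ v in 𝓝 (0 : ι → ℝ), Ψ (c j + v) = lin j v)
    (μ : ℝ) (hμ : 0 < μ)
    (hgood : ∀ A : Finset (ι → ℝ), (∀ a ∈ A, ‖a‖ ≤ 1) → (∀ a ∈ A, ∀ b ∈ A, ‖a - b‖ ≤ μ) →
      ∀ val : (ι → ℝ) → E, ∃ F : (ι → ℝ) → E,
        (∀ i (z : ι → ℝ), ‖z‖ ≤ 1 → |z i| = 1 → F ((T i).act z) = ρ i (F z)) ∧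
        ∀ a ∈ A, F a = val a) :
    Even (Fintype.card J) := by
  classical
  obtain ⟨ρ0, hρ0, hlocal⟩ := Metric.eventually_nhds_iff.1 (eventually_all.2 hloc)
  obtain ⟨r, ⟨⟨hr1, hr2⟩, hr3⟩, hr4⟩ : ∃ r : ℝ, ((r < ρ0 ∧ ∀ j, r < 1 - ‖c j‖) ∧
      ∀ j j', j ≠ j' → 3 * r < ‖c j - c j'‖) ∧ 0 < r := by
    have h1 : ∀ᶠ r in 𝓝[>] (0 : ℝ), (r < ρ0 ∧ ∀ j, r < 1 - ‖c j‖) ∧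
        ∀ j j', j ≠ j' → 3 * r < ‖c j - c j'‖ := by
      refine ((Eventually.and ?_ ?_).and ?_).filter_mono nhdsWithin_le_nhds
      · exact eventually_lt_nhds hρ0
      · exact eventually_all.2 fun j => eventually_lt_nhds (by linarith [hc1 j])
      · refine eventually_all.2 fun j => eventually_all.2 fun j' => ?_
        by_cases hj : j = j'
        · exact Eventually.of_forall fun _ h => (h hj).elim
        · have : 0 < ‖c j - c j'‖ := norm_pos_iff.2 (sub_ne_zero.2 (hc.ne hj))
          filter_upwards [eventually_lt_nhds (a := (0 : ℝ)) (b := ‖c j - c j'‖ / 3) (by positivity)]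
            with r hr _
          linarith
    exact (h1.and self_mem_nhdsWithin).exists
  let K : Set (ι → ℝ) := Metric.closedBall 0 1
  have hKmem : ∀ z, z ∈ K ↔ ‖z‖ ≤ 1 := fun z => mem_closedBall_zero_iff
  have hK : IsCompact K := isCompact_closedBall 0 1
  obtain ⟨ν₁, hν₁, hν₁'⟩ := hK.exists_forall_le' (f := fun z => ‖Φ z‖) hΦ.norm.continuousOn (a := 0)
    (fun z hz => norm_pos_iff.2 (hΦ0 z ((hKmem z).1 hz)))
  have hK' : IsCompact (K ∩ {z | ∀ j, r ≤ ‖z - c j‖}) := by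
    refine hK.inter_right ?_
    simp only [Set.ofPred_forall]
    exact isClosed_iInter fun j => isClosed_le continuous_const (by fun_prop)
  obtain ⟨ν₂, hν₂, hν₂'⟩ := hK'.exists_forall_le' (f := fun z => ‖Ψ z‖)
    hΨ.norm.continuousOn (a := 0) (fun z hz => norm_pos_iff.2 fun h => by
      obtain ⟨j, rfl⟩ := hΨ0 z ((hKmem z).1 hz.1) h
      have := hz.2 j
      simp only [sub_self, norm_zero] at this
      linarith)
  let ν := min ν₁ ν₂
  have hν : 0 < ν := lt_min hν₁ hν₂
  obtain ⟨δ₁, hδ₁, hδ₁'⟩ := Metric.uniformContinuousOn_iff.1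
    (hK.uniformContinuousOn_of_continuous hΦ.continuousOn) (ν / 4) (by positivity)
  obtain ⟨δ₂, hδ₂, hδ₂'⟩ := Metric.uniformContinuousOn_iff.1
    (hK.uniformContinuousOn_of_continuous hΨ.continuousOn) (ν / 4) (by positivity)
  have hlinc : ∀ j, ∀ᶠ v in 𝓝 (0 : ι → ℝ), ‖lin j v‖ < ν / 4 := by
    intro j
    have h1 : Continuous fun v => ‖lin j v‖ := (lin j).continuous_of_finiteDimensional.norm
    refine h1.continuousAt.eventually_lt continuousAt_const ?_
    simpa using by positivity
  obtain ⟨δ₃, hδ₃, hδ₃'⟩ := Metric.eventually_nhds_iff.1 (eventually_all.2 hlinc)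
  obtain ⟨L', hL'⟩ := exists_nat_one_div_lt (K := ℝ)
    (lt_min (lt_min (lt_min hr4 hμ) (lt_min hδ₁ hδ₂)) hδ₃)
  simp only [lt_min_iff] at hL'
  obtain ⟨⟨⟨hLr, hLμ⟩, hL1, hL2⟩, hL3⟩ := hL'
  obtain ⟨L, hL⟩ : ∃ L, L = L' + 1 := ⟨_, rfl⟩
  have hcast : (L' : ℝ) + 1 = L := by rw [hL]; push_cast; rfl
  rw [hcast] at hLr hLμ hL1 hL2 hL3
  have hLpos : (0 : ℝ) < L := by rw [← hcast]; positivity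
  have hhalf : 1 / (2 * (L : ℝ)) < 1 / L := by
    rw [one_div_lt_one_div (by positivity) hLpos]; linarith
  let zz : (ι → ℤ) → ι → ℝ := fun W i => (W i : ℝ) / (2 * L)
  have zz_sub : ∀ W W', (∀ i, |W i - W' i| ≤ 1) → ‖zz W - zz W'‖ ≤ 1 / (2 * L) := by
    intro W W' h
    rw [pi_norm_le_iff_of_nonneg (by positivity)]
    intro i
    have h1 : |(W i : ℝ) - W' i| ≤ 1 := by exact_mod_cast h i
    have h2 : (zz W - zz W') i = ((W i : ℝ) - W' i) / (2 * L) := by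
      simp only [zz, Pi.sub_apply]; ring
    rw [h2, Real.norm_eq_abs, abs_div, abs_of_pos (by positivity : (0 : ℝ) < 2 * L)]
    gcongr
  have zz_norm : ∀ W : ι → ℤ, (∀ i, |W i| ≤ 2 * (L : ℤ)) → ‖zz W‖ ≤ 1 := by
    intro W h
    rw [pi_norm_le_iff_of_nonneg zero_le_one]
    intro i
    have h1 : |(W i : ℝ)| ≤ 2 * L := by exact_mod_cast h i
    rw [Real.norm_eq_abs, abs_div, abs_of_pos (by positivity : (0 : ℝ) < 2 * L),
      div_le_one (by positivity)]
    exact h1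
  have zz_abs : ∀ (W : ι → ℤ) i, |W i| = 2 * (L : ℤ) → |zz W i| = 1 := by
    intro W i h
    have h1 : |(W i : ℝ)| = 2 * L := by exact_mod_cast h
    rw [abs_div, abs_of_pos (by positivity : (0 : ℝ) < 2 * L), h1, div_self (by positivity)]
  have zz_act : ∀ i (W : ι → ℤ), zz ((T i).act W) = (T i).act (zz W) := by
    intro i W
    funext a
    simp only [zz, SignedPerm.act]
    split_ifs
    · push_cast; ring
    · rfl
  have zz_inj : Function.Injective zz := by
    intro W W' h
    funext i
    have h1 := congrFun h i
    simp only [zz] at h1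
    rw [div_left_inj' (by positivity)] at h1
    exact_mod_cast h1
  have hci : ∀ j i, |c j i| < 1 := fun j i =>
    lt_of_le_of_lt (by rw [← Real.norm_eq_abs]; exact norm_le_pi_norm (c j) i) (hc1 j)
  have hqlt : ∀ j i, ⌊(L : ℝ) * (c j i + 1)⌋₊ < 2 * L := by
    intro j i
    have h1 := abs_lt.1 (hci j i)
    rw [Nat.floor_lt (by nlinarith)]
    push_cast
    nlinarith
  let q : J → ι → Fin (2 * L) := fun j i => ⟨⌊(L : ℝ) * (c j i + 1)⌋₊, hqlt j i⟩
  have hq : ∀ j i, |2 * ((q j i : ℕ) : ℝ) + 1 - 2 * L - 2 * L * c j i| ≤ 1 := by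
    intro j i
    have h1 := abs_lt.1 (hci j i)
    have h2 := Nat.floor_le (a := (L : ℝ) * (c j i + 1)) (by nlinarith)
    have h3 := Nat.lt_floor_add_one ((L : ℝ) * (c j i + 1))
    rw [abs_le]
    simp only [q]
    constructor <;> linarith
  have hclose : ∀ j (x : ι → ℝ), (∀ i, |x i - (2 * ((q j i : ℕ) : ℝ) + 1 - 2 * L)| ≤ 1) →
      ‖(fun i => x i / (2 * L)) - c j‖ ≤ 1 / L := by
    intro j x hx
    rw [pi_norm_le_iff_of_nonneg (by positivity)]
    intro i
    have h2 : ((fun i => x i / (2 * (L : ℝ))) - c j) i = (x i - 2 * L * c j i) / (2 * L) := by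
      simp only [Pi.sub_apply]; field_simp
    rw [h2, Real.norm_eq_abs, abs_div, abs_of_pos (by positivity : (0 : ℝ) < 2 * L),
      div_le_div_iff₀ (by positivity) hLpos]
    have h3 := abs_le.1 (hx i)
    have h4 := abs_le.1 (hq j i)
    have h5 : |x i - 2 * L * c j i| ≤ 2 := by rw [abs_le]; constructor <;> linarith
    nlinarith
  let d := Fintype.card ι
  have hcard : Fintype.card (Option ι) = Fintype.card (Fin (d + 1)) := by simp [d]
  let e0 : Option ι ≃ Fin (d + 1) := Fintype.equivOfCardEq hcard
  let rk : Option ι ≃ Fin (d + 1) := e0.trans (Equiv.swap (e0 none) (Fin.last d))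
  have hrk : rk none = Fin.last d := by simp [rk]
  let cen : J → ι → ℝ := fun j i =>
    (2 * ((q j i : ℕ) : ℝ) + 1 - 2 * L + ((rk (some i) : ℕ) + 1) / ((d : ℝ) + 1)) 
  have hcen : ∀ j, ‖(fun i => cen j i / (2 * L)) - c j‖ ≤ 1 / L := by
    intro j
    refine hclose j _ fun i => ?_
    have h1 : ((rk (some i) : ℕ) : ℝ) + 1 ≤ (d : ℝ) + 1 := by exact_mod_cast (rk (some i)).2
    simp only [cen, add_sub_cancel_left]
    rw [abs_of_nonneg (by positivity), div_le_one (by positivity)]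
    exact h1
  let near : J → Set (ι → ℤ) := fun j => {W | ‖zz W - c j‖ ≤ r}
  have near_unique : ∀ j j', ∀ W ∈ near j, ∀ W' ∈ near j', (∀ i, |W i - W' i| ≤ 1) → j = j' := by
    intro j j' W hW W' hW' h
    by_contra hne
    have h1 := hr3 j j' hne
    have h2 := zz_sub W W' h
    have h3 : c j - c j' = (c j - zz W) + (zz W - zz W') + (zz W' - c j') := by abel
    have h4 := norm_add₃_le (a := c j - zz W) (b := zz W - zz W') (c := zz W' - c j')
    rw [← h3, norm_sub_rev (c j) (zz W)] at h4
    simp only [near, Set.mem_ofPred_eq] at hW hW'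
    linarith
  let linL : J → (ι → ℝ) →ₗ[ℝ] E := fun j => (1 / (2 * (L : ℝ))) • lin j
  let pin : (ι → ℤ) → E := fun W =>
    if h : ∃ j, W ∈ near j then linL h.choose fun i => (W i : ℝ) - cen h.choose i else 0
  have hpin : ∀ j, ∀ W ∈ near j, pin W = linL j fun i => (W i : ℝ) - cen j i := by
    intro j W hW
    have h : ∃ j, W ∈ near j := ⟨j, hW⟩
    have h1 : h.choose = j := near_unique _ _ W h.choose_spec W hW fun i => by simp
    simp only [pin]
    rw [dif_pos h, h1]
  have hpinΨ : ∀ j, ∀ W ∈ near j, ‖pin W - Ψ (zz W)‖ < ν / 4 := by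
    intro j W hW
    have h1 : Ψ (zz W) = lin j (zz W - c j) := by
      have := hlocal (y := zz W - c j) (by
        rw [dist_zero_right]
        exact lt_of_le_of_lt hW hr1) j
      rwa [add_sub_cancel] at this
    rw [hpin j W hW, h1]
    have h2 : linL j (fun i => (W i : ℝ) - cen j i) =
        lin j (zz W - fun i => cen j i / (2 * L)) := by
      simp only [linL, LinearMap.smul_apply, ← map_smul]
      congr 1
      funext i
      simp only [zz, Pi.smul_apply, Pi.sub_apply, smul_eq_mul]
      ring
    rw [h2, ← map_sub]
    refine hδ₃' ?_ j
    rw [dist_zero_right]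
    have h3 : zz W - (fun i => cen j i / (2 * (L : ℝ))) - (zz W - c j) =
      -((fun i => cen j i / (2 * (L : ℝ))) - c j) := by abel
    rw [h3, norm_neg]
    exact (hcen j).trans_lt hL3
  have hflag : ∀ (F : CubeFlag (Option ι) d L) j a, |flagPt F j a| ≤ 2 * (L : ℤ) := flagPt_abs_le
  have hflagz : ∀ (F : CubeFlag (Option ι) d L) j, ‖zz fun i => flagPt F j (some i)‖ ≤ 1 :=
    fun F j => zz_norm _ fun i => hflag F j _
  have hflagd : ∀ (F : CubeFlag (Option ι) d L) j j',
      ‖(zz fun i => flagPt F j (some i)) - zz fun i => flagPt F j' (some i)‖ ≤ 1 / (2 * L) :=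
    fun F j j' => zz_sub _ _ fun i => flagPt_sub_abs_le F j j' (some i)
  have hL1' : 1 ≤ L := by omega
  have near_interior : ∀ j, ∀ W ∈ near j, ∀ i, |W i| < 2 * (L : ℤ) := by
    intro j W hW i
    have h1 : ‖zz W‖ < 1 := by
      have h2 := norm_add_le (zz W - c j) (c j)
      rw [sub_add_cancel] at h2
      have h3 := hr2 j
      simp only [near, Set.mem_ofPred_eq] at hW
      linarith
    have h2 := (norm_le_pi_norm (zz W) i).trans_lt h1
    simp only [zz] at h2
    rw [Real.norm_eq_abs, abs_div, abs_of_pos (by positivity : (0 : ℝ) < 2 * L),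
      div_lt_one (by positivity)] at h2
    exact_mod_cast h2
  refine even_card_of_pinned_family (L := L) hd hL1' T hTi hTn ρ hρ rk hrk near q linL ?_
    near_interior near_unique ?_ pin hpin ?_
    (fun Z => if Z none = 2 * (L : ℤ) then
      (if ∃ j, (fun i => Z (some i)) ∈ near j then pin fun i => Z (some i)
        else Ψ (zz fun i => Z (some i)))
      else Φ (zz fun i => Z (some i))) (ν / 4) (by positivity) ?_ ?_ ?_ ?_
  · intro j
    refine (injective_iff_map_eq_zero _).2 fun x hx => ?_
    simp only [linL, LinearMap.smul_apply] at hx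
    rw [smul_eq_zero] at hx
    rcases hx with hx | hx
    · exact absurd hx (by positivity)
    · exact (map_eq_zero_iff _ (hlin j)).1 hx
  · intro j W h
    refine le_trans (hclose j _ fun i => ?_) hLr.le
    exact_mod_cast h i
  · intro F val
    obtain ⟨G, hG1, hG2⟩ := hgood (Finset.univ.image fun j => zz fun i => flagPt F j (some i))
      (by simpa using hflagz F) (by
        intro a ha b hb
        obtain ⟨j, -, rfl⟩ := Finset.mem_image.1 ha
        obtain ⟨j', -, rfl⟩ := Finset.mem_image.1 hb
        exact (hflagd F j j').trans (hhalf.trans hLμ).le)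
      (Function.extend zz val 0)
    refine ⟨fun W => G (zz W), fun i W h1 h2 => ?_, fun j => ?_⟩
    · change G (zz ((T i).act W)) = _
      rw [zz_act]
      exact hG1 i _ (zz_norm W h1) (zz_abs W i h2)
    · change G (zz _) = _
      rw [hG2 _ (Finset.mem_image.2 ⟨j, Finset.mem_univ _, rfl⟩), zz_inj.extend_apply]
  · intro i Z h1 h2
    have hn1 : ¬ ∃ j, (fun i => Z (some i)) ∈ near j := by
      rintro ⟨j, hj⟩
      exact (near_interior j _ hj i).ne h2
    have hsp : (fun a => (T i).option.act Z (some a)) = (T i).act fun a => Z (some a) := rfl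
    have hn2 : ¬ ∃ j, ((T i).act fun a => Z (some a)) ∈ near j := by
      rintro ⟨j, hj⟩
      refine (near_interior j _ hj i).ne ?_
      simpa [SignedPerm.act, hTi, hTn] using h2
    have hnone : (T i).option.act Z none = Z none := rfl
    simp only [hn1, hn2, if_false, hnone, hsp, zz_act]
    split_ifs
    · exact hΨT i _ (zz_norm _ h1) (zz_abs (fun a => Z (some a)) i h2)
    · exact hΦT i _ (zz_norm _ h1) (zz_abs (fun a => Z (some a)) i h2)
  · intro j Z h1 h2
    have h3 : ∃ j, (fun i => Z (some i)) ∈ near j := ⟨j, h2⟩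
    simp only [h1, h3, if_true]
  · intro F hF
    refine ⟨Φ (zz fun i => flagPt F 0 (some i)), fun j hj => ?_⟩
    have h0 : ¬ flagPt F j none = 2 * (L : ℤ) := by
      rw [hF j hj]; omega
    simp only [h0, if_false]
    have h1 := hδ₁' _ ((hKmem _).2 (hflagz F j)) _ ((hKmem _).2 (hflagz F 0)) (by
      rw [dist_eq_norm]
      exact (hflagd F j 0).trans_lt (hhalf.trans hL1))
    rw [dist_eq_norm] at h1
    have h2 := hν₁' _ ((hKmem _).2 (hflagz F 0))
    have h3 : ν ≤ ν₁ := min_le_left _ _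
    linarith
  · rintro F hF ⟨j₀, hj₀, hj₀'⟩
    refine ⟨Ψ (zz fun i => flagPt F j₀ (some i)), fun j hj => ?_⟩
    simp only [hF j hj, if_true]
    have h1 := hδ₂' _ ((hKmem _).2 (hflagz F j)) _ ((hKmem _).2 (hflagz F j₀)) (by
      rw [dist_eq_norm]
      exact (hflagd F j j₀).trans_lt (hhalf.trans hL2))
    rw [dist_eq_norm] at h1
    have h2 := hν₂' _ ⟨(hKmem _).2 (hflagz F j₀), fun a => le_of_lt (not_le.1 (hj₀' a))⟩
    have h3 : ν ≤ ν₂ := min_le_right _ _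
    split_ifs with hn
    · obtain ⟨a, ha⟩ := hn
      have h4 := hpinΨ a _ ha
      have h5 := norm_sub_le_norm_sub_add_norm_sub (pin fun i => flagPt F j (some i))
        (Ψ (zz fun i => flagPt F j (some i))) (Ψ (zz fun i => flagPt F j₀ (some i)))
      linarith
    · linarith

/-- The inner nodes of a complete binary tree. -/
inductive TreeNode : ℕ → Type
  | root (h : ℕ) : TreeNode (h + 1)
  | child {h : ℕ} (b : Bool) (u : TreeNode h) : TreeNode (h + 1)

/-- The leaves of a complete binary tree. -/
inductive TreeLeaf : ℕ → Type
  | nil : TreeLeaf 0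
  | cons {h : ℕ} (b : Bool) (l : TreeLeaf h) : TreeLeaf (h + 1)

/-- The sign attached to a direction in a binary tree. -/
def boolSign (b : Bool) : ℝ := if b then 1 else -1

theorem boolSign_not (b : Bool) : boolSign (!b) = -boolSign b := by
  cases b <;> simp [boolSign]

namespace TreeLeaf

/-- A leaf below the root is a leaf of one of the two subtrees. -/
def equivProd (h : ℕ) : TreeLeaf (h + 1) ≃ Bool × TreeLeaf h where
  toFun | cons b l => (b, l)
  invFun p := cons p.1 p.2
  left_inv | cons _ _ => rfl
  right_inv _ := rfl

/-- The tree of height zero has one leaf. -/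
def equivUnit : TreeLeaf 0 ≃ Unit where
  toFun _ := ()
  invFun _ := nil
  left_inv | nil => rfl
  right_inv _ := rfl

noncomputable instance : ∀ h, Fintype (TreeLeaf h)
  | 0 => Fintype.ofEquiv _ equivUnit.symm
  | h + 1 =>
    let _ : Fintype (TreeLeaf h) := instFintype h
    Fintype.ofEquiv _ (equivProd h).symm

theorem card (h : ℕ) : Fintype.card (TreeLeaf h) = 2 ^ h := by
  induction h with
  | zero => rw [Fintype.card_congr equivUnit]; simp
  | succ h ih => rw [Fintype.card_congr (equivProd h), Fintype.card_prod, ih]; simp [pow_succ']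

/-- Total reversal of the tree, on leaves. -/
def rev : {h : ℕ} → TreeLeaf h → TreeLeaf h
  | _, nil => nil
  | _, cons b l => cons (!b) l.rev

/-- Exchange of the two subtrees below a node, on leaves. -/
def flip : {h : ℕ} → TreeNode h → TreeLeaf h → TreeLeaf h
  | _, .root _, cons b l => cons (!b) l
  | _, .child b v, cons b' l => cons b' (if b = b' then flip v l else l)

theorem rev_rev {h : ℕ} (l : TreeLeaf h) : l.rev.rev = l := by
  induction l with
  | nil => rfl
  | cons b l ih => simp [rev, ih]

theorem flip_flip {h : ℕ} (v : TreeNode h) (l : TreeLeaf h) : flip v (flip v l) = l := by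
  induction v with
  | root h => cases l; simp [flip]
  | child b v ih =>
    cases l with
    | cons b' l => simp only [flip]; split_ifs <;> simp [ih]

end TreeLeaf

namespace TreeNode

/-- A node is the root or a node of one of the two subtrees. -/
def equivOption (h : ℕ) : TreeNode (h + 1) ≃ Option (Bool × TreeNode h) where
  toFun | root _ => none | child b u => some (b, u)
  invFun | none => root h | some p => child p.1 p.2
  left_inv | root _ => rfl | child _ _ => rfl
  right_inv | none => rfl | some _ => rfl

/-- The tree of height zero has no nodes. -/
def equivEmpty : TreeNode 0 ≃ Empty where
  toFun u := nomatch u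
  invFun u := nomatch u
  left_inv u := nomatch u
  right_inv u := nomatch u

noncomputable instance : ∀ h, Fintype (TreeNode h)
  | 0 => Fintype.ofEquiv _ equivEmpty.symm
  | h + 1 =>
    let _ : Fintype (TreeNode h) := instFintype h
    Fintype.ofEquiv _ (equivOption h).symm

theorem card (h : ℕ) : Fintype.card (TreeNode h) = 2 ^ h - 1 := by
  induction h with
  | zero => rw [Fintype.card_congr equivEmpty]; simp
  | succ h ih =>
    rw [Fintype.card_congr (equivOption h), Fintype.card_option, Fintype.card_prod, ih,
      Fintype.card_bool, pow_succ']
    have := Nat.one_le_two_pow (n := h)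
    omega

/-- The height of a node above the lowest nodes. -/
def ht : {h : ℕ} → TreeNode h → ℕ
  | _, root h => h
  | _, child _ u => u.ht

theorem ht_lt {h : ℕ} (u : TreeNode h) : u.ht < h := by
  induction u with
  | root h => exact Nat.lt_succ_self h
  | child b u ih => exact ih.trans (Nat.lt_succ_self _)

/-- Total reversal of the tree, on nodes. -/
def rev : {h : ℕ} → TreeNode h → TreeNode h
  | _, root h => root h
  | _, child b u => child (!b) u.rev

open scoped Classical in
/-- Exchange of the two subtrees below a node, on nodes. -/
noncomputable def flip : {h : ℕ} → TreeNode h → TreeNode h → TreeNode h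
  | _, .root h, .root _ => root h
  | _, .root _, child b u => child (!b) u
  | _, .child _ _, .root _ => root _
  | _, .child b v, child b' u => child b' (if b = b' then flip v u else u)

theorem rev_rev {h : ℕ} (u : TreeNode h) : u.rev.rev = u := by
  induction u with
  | root h => rfl
  | child b u ih => simp [rev, ih]

theorem ht_rev {h : ℕ} (u : TreeNode h) : u.rev.ht = u.ht := by
  induction u with
  | root h => rfl
  | child b u ih => simp [rev, ht, ih]

theorem flip_flip {h : ℕ} (v u : TreeNode h) : flip v (flip v u) = u := by
  induction v with
  | root h => cases u <;> simp [flip]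
  | child b v ih =>
    cases u with
    | root => simp [flip]
    | child b' u => simp only [flip]; split_ifs <;> simp [ih]

theorem ht_flip {h : ℕ} (v u : TreeNode h) : (flip v u).ht = u.ht := by
  induction v with
  | root h => cases u <;> simp [flip, ht]
  | child b v ih =>
    cases u with
    | root => simp [flip]
    | child b' u => simp only [flip, ht]; split_ifs <;> simp [ih]

theorem flip_self {h : ℕ} (v : TreeNode h) : flip v v = v := by
  induction v with
  | root h => simp [flip]
  | child b v ih => simp [flip, ih]

theorem flip_eq_self_iff {h : ℕ} (v u : TreeNode h) : flip v u = v ↔ u = v := by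
  constructor
  · intro hu
    rw [← flip_flip v u, hu, flip_self]
  · rintro rfl
    exact flip_self u

end TreeNode

section

variable {W : Type*} [AddCommGroup W] [Module ℝ W]

/-- The signed sum of the labels on the path to a leaf. -/
def leafSum : {h : ℕ} → (TreeNode h → W) → TreeLeaf h → W
  | _, _, .nil => 0
  | _, ψ, .cons b l => boolSign b • ψ (.root _) + leafSum (fun u => ψ (.child b u)) l

/-- The base point plus the signed sum of the labels on the path to a node. -/
def nodePos : {h : ℕ} → W → (TreeNode h → W) → TreeNode h → W
  | _, x, _, .root _ => x
  | _, x, w, .child b u => nodePos (x + boolSign b • w (.root _)) (fun v => w (.child b v)) u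

/-- The mean value of a function on the leaves. -/
noncomputable def leafMean : {h : ℕ} → (TreeLeaf h → W) → W
  | 0, G => G .nil
  | _ + 1, G => (1 / 2 : ℝ) • (leafMean (fun l => G (.cons true l)) +
      leafMean fun l => G (.cons false l))

/-- The label of each node that recovers a function on the leaves up to a constant. -/
noncomputable def leafDiff : {h : ℕ} → (TreeLeaf h → W) → TreeNode h → W
  | _, G, .root _ => (1 / 2 : ℝ) • (leafMean (fun l => G (.cons true l)) -
      leafMean fun l => G (.cons false l))
  | _, G, .child b u => leafDiff (fun l => G (.cons b l)) u

theorem leafMean_add {h : ℕ} (F G : TreeLeaf h → W) :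
    leafMean (fun l => F l + G l) = leafMean F + leafMean G := by
  induction h with
  | zero => rfl
  | succ h ih => simp only [leafMean, ih]; module

theorem leafMean_const {h : ℕ} (x : W) : leafMean (fun _ : TreeLeaf h => x) = x := by
  induction h with
  | zero => rfl
  | succ h ih => simp only [leafMean, ih]; module

theorem leafMean_leafSum {h : ℕ} (ψ : TreeNode h → W) : leafMean (leafSum ψ) = 0 := by
  induction h with
  | zero => rfl
  | succ h ih =>
    simp only [leafMean, leafSum, leafMean_add, leafMean_const, ih]
    simp [boolSign]

theorem leafDiff_const_add_leafSum {h : ℕ} (x : W) (ψ : TreeNode h → W) :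
    leafDiff (fun l => x + leafSum ψ l) = ψ := by
  funext u
  induction u generalizing x with
  | root h =>
    simp only [leafDiff, leafSum, leafMean_add, leafMean_const]
    have := leafMean_leafSum fun u => ψ (.child true u)
    rw [this]
    have := leafMean_leafSum fun u => ψ (.child false u)
    rw [this]
    simp only [boolSign]
    simp only [if_true, Bool.false_eq_true, if_false]
    module
  | child b u ih =>
    simp only [leafDiff, leafSum, ← add_assoc]
    exact ih _ fun u => ψ (.child b u)

theorem leafDiff_leafSum {h : ℕ} (ψ : TreeNode h → W) : leafDiff (leafSum ψ) = ψ := by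
  have := leafDiff_const_add_leafSum 0 ψ
  simpa only [zero_add] using this

theorem eq_leafMean_add_leafSum {h : ℕ} (G : TreeLeaf h → W) (l : TreeLeaf h) :
    G l = leafMean G + leafSum (leafDiff G) l := by
  induction l with
  | nil => simp [leafMean, leafSum]
  | cons b l ih =>
    rw [ih fun l => G (.cons b l)]
    simp only [leafSum, leafMean, leafDiff, boolSign]
    cases b
    · simp only [Bool.false_eq_true, if_false]; module
    · simp only [if_true]; module

theorem leafSum_zero {h : ℕ} (l : TreeLeaf h) : leafSum (fun _ => (0 : W)) l = 0 := by
  induction l with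
  | nil => rfl
  | cons b l ih => simp [leafSum, ih]

theorem eq_of_leafDiff_eq_zero {h : ℕ} {G : TreeLeaf h → W} (hG : leafDiff G = 0)
    (l l' : TreeLeaf h) : G l = G l' := by
  rw [eq_leafMean_add_leafSum G l, eq_leafMean_add_leafSum G l', hG]
  exact congrArg _ ((leafSum_zero l).trans (leafSum_zero l').symm)

theorem leafMean_rev {h : ℕ} (G : TreeLeaf h → W) : leafMean (fun l => G l.rev) = leafMean G := by
  induction h with
  | zero => rfl
  | succ h ih =>
    simp only [leafMean, TreeLeaf.rev]
    rw [ih fun l => G (.cons (!true) l), ih fun l => G (.cons (!false) l), add_comm]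
    rfl

theorem leafMean_flip {h : ℕ} (v : TreeNode h) (G : TreeLeaf h → W) :
    leafMean (fun l => G (TreeLeaf.flip v l)) = leafMean G := by
  induction v with
  | root h => simp only [leafMean, TreeLeaf.flip]; rw [add_comm]; rfl
  | child b v ih =>
    cases b
    · simp only [leafMean, TreeLeaf.flip, Bool.false_eq_true, if_false, if_true]
      rw [ih fun l => G (.cons false l)]
    · simp only [leafMean, TreeLeaf.flip, Bool.true_eq_false, if_false, if_true]
      rw [ih fun l => G (.cons true l)]

theorem leafDiff_rev {h : ℕ} (G : TreeLeaf h → W) (u : TreeNode h) :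
    leafDiff (fun l => G l.rev) u = -leafDiff G u.rev := by
  induction u with
  | root h =>
    simp only [leafDiff, TreeLeaf.rev, TreeNode.rev]
    rw [leafMean_rev fun l => G (.cons (!true) l), leafMean_rev fun l => G (.cons (!false) l)]
    simp only [Bool.not_true, Bool.not_false]
    module
  | child b u ih =>
    simp only [leafDiff, TreeLeaf.rev, TreeNode.rev]
    exact ih fun l => G (.cons (!b) l)

open scoped Classical in
theorem leafDiff_flip {h : ℕ} (v : TreeNode h) (G : TreeLeaf h → W) (u : TreeNode h) :
    leafDiff (fun l => G (TreeLeaf.flip v l)) u =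
      if u = v then -leafDiff G (TreeNode.flip v u) else leafDiff G (TreeNode.flip v u) := by
  induction v with
  | root h =>
    cases u with
    | root =>
      simp only [leafDiff, TreeLeaf.flip, TreeNode.flip, if_true, Bool.not_true, Bool.not_false]
      module
    | child b u => simp [leafDiff, TreeLeaf.flip, TreeNode.flip]
  | child b v ih =>
    cases u with
    | root =>
      simp only [leafDiff, TreeLeaf.flip, TreeNode.flip, reduceCtorEq, if_false]
      cases b
      · simp only [Bool.false_eq_true, if_false, if_true]
        rw [leafMean_flip v fun l => G (.cons false l)]
      · simp only [Bool.true_eq_false, if_false, if_true]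
        rw [leafMean_flip v fun l => G (.cons true l)]
    | child b' u =>
      simp only [leafDiff, TreeLeaf.flip, TreeNode.flip, TreeNode.child.injEq]
      by_cases hb : b = b'
      · subst hb
        simp only [if_true, true_and]
        exact ih (fun l => G (.cons b l)) u
      · simp [hb, Ne.symm hb]

theorem leafSum_rev {h : ℕ} (ψ : TreeNode h → W) (l : TreeLeaf h) :
    leafSum (fun u => ψ u.rev) l = -leafSum ψ l.rev := by
  induction l with
  | nil => simp [leafSum, TreeLeaf.rev]
  | cons b l ih =>
    simp only [leafSum, TreeLeaf.rev, TreeNode.rev, ih fun u => ψ (.child (!b) u), boolSign_not]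
    module

open scoped Classical in
theorem leafSum_flip {h : ℕ} (v : TreeNode h) (ψ : TreeNode h → W) (l : TreeLeaf h) :
    leafSum (fun u => if u = v then -ψ (TreeNode.flip v u) else ψ (TreeNode.flip v u)) l =
      leafSum ψ (TreeLeaf.flip v l) := by
  induction v with
  | root h =>
    cases l with
    | cons b l => simp [leafSum, TreeLeaf.flip, TreeNode.flip, boolSign_not]
  | child b v ih =>
    cases l with
    | cons b' l =>
      simp only [leafSum, TreeLeaf.flip, TreeNode.flip, TreeNode.child.injEq,
        reduceCtorEq, if_false]
      congr 1
      by_cases hb : b = b'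
      · subst hb
        simp only [if_true, true_and]
        exact ih (fun u => ψ (.child b u)) l
      · simp [hb, Ne.symm hb]

theorem nodePos_rev {h : ℕ} (x : W) (w : TreeNode h → W) (u : TreeNode h) :
    nodePos (-x) (fun v => w v.rev) u = -nodePos x w u.rev := by
  induction u generalizing x with
  | root h => simp [nodePos, TreeNode.rev]
  | child b u ih =>
    simp only [nodePos, TreeNode.rev, boolSign_not]
    rw [← ih]
    congr 1
    module

open scoped Classical in
theorem nodePos_flip {h : ℕ} (v : TreeNode h) (x : W) (w : TreeNode h → W) (u : TreeNode h) :
    nodePos x (fun u => if u = v then -w (TreeNode.flip v u) else w (TreeNode.flip v u)) u =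
      nodePos x w (TreeNode.flip v u) := by
  induction v generalizing x with
  | root h =>
    cases u with
    | root => simp [nodePos, TreeNode.flip]
    | child b u => simp [nodePos, TreeNode.flip, boolSign_not]
  | child b v ih =>
    cases u with
    | root => simp [nodePos, TreeNode.flip]
    | child b' u =>
      simp only [nodePos, TreeNode.flip, TreeNode.child.injEq,
        reduceCtorEq, if_false]
      by_cases hb : b = b'
      · subst hb
        simp only [if_true, true_and]
        exact ih _ (fun u => w (.child b u)) u
      · simp [hb, Ne.symm hb]

end

theorem abs_le_of_abs_nodePos_le {h : ℕ} (x η : ℝ) (w : TreeNode h → ℝ) {e : ℕ} (he : e < h)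
    (hw : ∀ u : TreeNode h, u.ht = e → |nodePos x w u| ≤ η) :
    |x| ≤ η ∧ ∀ u : TreeNode h, e < u.ht → |w u| ≤ η := by
  induction h generalizing x with
  | zero => omega
  | succ h ih =>
    rcases (Nat.lt_succ_iff.1 he).eq_or_lt with rfl | hlt
    · refine ⟨by simpa [nodePos] using hw (.root e) rfl, fun u hu => ?_⟩
      have := u.ht_lt
      omega
    · have key := fun b => ih (x + boolSign b * w (.root h)) (fun u => w (.child b u)) hlt
        fun u hu => by simpa [nodePos] using hw (.child b u) hu
      have h1 := abs_le.1 (key true).1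
      have h2 := abs_le.1 (key false).1
      simp only [boolSign, if_true, Bool.false_eq_true, if_false] at h1 h2
      refine ⟨abs_le.2 ⟨by linarith, by linarith⟩, fun u hu => ?_⟩
      cases u with
      | root => exact abs_le.2 ⟨by linarith, by linarith⟩
      | child b u => exact (key b).2 u hu

theorem norm_leafSum_le {W : Type*} [NormedAddCommGroup W] [NormedSpace ℝ W] {h : ℕ} (δ : ℝ)
    (ψ : TreeNode h → W) (hψ : ∀ u, ‖ψ u‖ ≤ δ * 4 ^ u.ht) (l : TreeLeaf h) :
    3 * ‖leafSum ψ l‖ ≤ δ * (4 ^ h - 1) := by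
  induction l with
  | nil => simp [leafSum]
  | @cons h b l ih =>
    have h1 := ih (fun u => ψ (.child b u)) fun u => hψ (.child b u)
    have h2 := hψ (.root h)
    have h3 := norm_add_le (boolSign b • ψ (.root h)) (leafSum (fun u => ψ (.child b u)) l)
    have h4 : ‖boolSign b • ψ (.root h)‖ = ‖ψ (.root h)‖ := by
      cases b <;> simp [boolSign]
    simp only [leafSum, TreeNode.ht, pow_succ] at *
    linarith

theorem le_norm_leafSum_sub {W : Type*} [NormedAddCommGroup W] [NormedSpace ℝ W] {h : ℕ} {δ : ℝ}
    (hδ : 0 ≤ δ)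
    (ψ : TreeNode h → W) (hψ : ∀ u, ‖ψ u‖ ≤ δ * 4 ^ u.ht) (hψ' : ∀ u, δ * 4 ^ u.ht ≤ 2 * ‖ψ u‖)
    {l l' : TreeLeaf h} (hl : l ≠ l') : δ ≤ 3 * ‖leafSum ψ l - leafSum ψ l'‖ := by
  induction h with
  | zero => cases l; cases l'; exact absurd rfl hl
  | succ h ih =>
    cases l with
    | cons b l =>
    cases l' with
    | cons b' l' =>
    by_cases hb : b = b'
    · subst hb
      have hl' : l ≠ l' := fun h => hl (by rw [h])
      simp only [leafSum, add_sub_add_left_eq_sub]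
      exact ih (fun u => ψ (.child b u)) (fun u => hψ (.child b u))
        (fun u => hψ' (.child b u)) hl'
    · have h1 := norm_leafSum_le δ (fun u => ψ (.child b u)) (fun u => hψ (.child b u)) l
      have h2 := norm_leafSum_le δ (fun u => ψ (.child b' u)) (fun u => hψ (.child b' u)) l'
      have h3 := hψ' (.root h)
      have h4 : ‖(boolSign b - boolSign b') • ψ (.root h)‖ = 2 * ‖ψ (.root h)‖ := by
        rw [norm_smul]
        congr 1
        cases b <;> cases b' <;> simp_all [boolSign] <;> norm_num
      simp only [leafSum]
      have h5 : (boolSign b - boolSign b') • ψ (.root h) =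
          (boolSign b • ψ (.root h) + leafSum (fun u => ψ (.child b u)) l -
            (boolSign b' • ψ (.root h) + leafSum (fun u => ψ (.child b' u)) l')) +
          leafSum (fun u => ψ (.child b' u)) l' - leafSum (fun u => ψ (.child b u)) l := by
        module
      have h6 := norm_sub_le ((boolSign b • ψ (.root h) + leafSum (fun u => ψ (.child b u)) l -
            (boolSign b' • ψ (.root h) + leafSum (fun u => ψ (.child b' u)) l')) +
          leafSum (fun u => ψ (.child b' u)) l') (leafSum (fun u => ψ (.child b u)) l)
      rw [← h5, h4] at h6
      have h7 := norm_add_le (boolSign b • ψ (.root h) + leafSum (fun u => ψ (.child b u)) l -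
            (boolSign b' • ψ (.root h) + leafSum (fun u => ψ (.child b' u)) l'))
          (leafSum (fun u => ψ (.child b' u)) l')
      have h8 : δ * 1 ≤ δ * 4 ^ h := mul_le_mul_of_nonneg_left (one_le_pow₀ (by norm_num)) hδ
      simp only [TreeNode.ht] at h3
      nlinarith

/-- The value at `T` of the polynomial of degree `d` with leading coefficient `s` and lower
coefficients `y`. -/
def polyVal (d : ℕ) (y : ℕ → ℝ) (s T : ℝ) : ℝ := ∑ i ∈ Finset.range d, y i * T ^ i + s * T ^ d

open Polynomial in
/-- A polynomial vanishing at as many sample points as its degree is determined by its leading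
coefficient; if that coefficient is scaled down enough the others are small. -/
theorem exists_polyVal_coeff_bound (M : ℕ) : ∃ κ : ℝ, 0 < κ ∧
    ∀ (J : Finset (Fin M)) (d : ℕ), J.card = d → ∀ (y : ℕ → ℝ) (s : ℝ),
      (∀ j ∈ J, polyVal d y (κ * s) (j : ℕ) = 0) →
      (∀ i < d, |y i| ≤ |s| / 8) ∧ (s ≠ 0 → ∀ j ∉ J, polyVal d y (κ * s) (j : ℕ) ≠ 0) := by
  classical
  let Q : Finset (Fin M) → ℝ[X] := fun J => ∏ j ∈ J, (X - C ((j : ℕ) : ℝ))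
  obtain ⟨B, hB⟩ : ∃ B : ℝ, ∀ J i, |(Q J).coeff i| ≤ B := by
    refine ⟨∑ J, ∑ i ∈ Finset.range (M + 1), |(Q J).coeff i|, fun J i => ?_⟩
    by_cases hi : i < M + 1
    · refine le_trans ?_ (Finset.single_le_sum
        (f := fun J => ∑ i ∈ Finset.range (M + 1), |(Q J).coeff i|)
        (fun J _ => Finset.sum_nonneg fun _ _ => abs_nonneg _) (Finset.mem_univ J))
      exact Finset.single_le_sum (f := fun i => |(Q J).coeff i|)
        (fun _ _ => abs_nonneg _) (Finset.mem_range.2 hi)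
    · have h1 : (Q J).natDegree ≤ M := by
        simp only [Q, natDegree_finsetProd_X_sub_C_eq_card]
        simpa using Finset.card_le_univ J
      rw [coeff_eq_zero_of_natDegree_lt (by omega), abs_zero]
      exact Finset.sum_nonneg fun _ _ => Finset.sum_nonneg fun _ _ => abs_nonneg _
  have hB0 : 0 ≤ B := (abs_nonneg _).trans (hB ∅ 0)
  refine ⟨1 / (8 * (B + 1)), by positivity, ?_⟩
  rintro J d rfl y s hJ
  set κ : ℝ := 1 / (8 * (B + 1)) with hκ
  have hκ0 : 0 < κ := by positivity
  let R : ℝ[X] := ∑ i ∈ Finset.range J.card, C (y i) * X ^ i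
  have hRdeg : R.degree < (J.card : WithBot ℕ) := by
    refine (degree_sum_le _ _).trans_lt ?_
    rw [Finset.sup_lt_iff (by exact_mod_cast WithBot.bot_lt_coe _)]
    intro i hi
    exact (degree_C_mul_X_pow_le _ _).trans_lt (by exact_mod_cast Finset.mem_range.1 hi)
  have hval : ∀ T : ℝ, polyVal J.card y (κ * s) T = (R + C (κ * s) * X ^ J.card).eval T := by
    intro T
    simp [polyVal, R, eval_finsetSum]
  have hQm : (Q J).Monic := monic_prod_X_sub_C _ _
  have hQd : (Q J).natDegree = J.card := natDegree_finsetProd_X_sub_C_eq_card _ _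
  have hsub : ((X : ℝ[X]) ^ J.card - Q J).degree < (J.card : WithBot ℕ) := by
    have h1 : (Q J).degree = (J.card : WithBot ℕ) := by rw [degree_eq_natDegree hQm.ne_zero, hQd]
    have := degree_sub_lt_left (p := (X : ℝ[X]) ^ J.card) (q := Q J) (by rw [h1, degree_X_pow])
      (monic_X_pow _).ne_zero (by rw [(monic_X_pow _).leadingCoeff, hQm.leadingCoeff])
    rwa [degree_X_pow] at this
  have hzero : R + C (κ * s) * (X ^ J.card - Q J) = 0 := by
    have hinj : Set.InjOn (fun j : Fin M => ((j : ℕ) : ℝ)) (J : Set (Fin M)) := by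
      intro a _ b _ h
      simpa [Fin.ext_iff] using h
    refine eq_zero_of_degree_lt_of_eval_index_eq_zero _ hinj ?_ fun j hj => ?_
    · refine (degree_add_le _ _).trans_lt (max_lt hRdeg ?_)
      refine (degree_mul_le _ _).trans_lt ?_
      refine lt_of_le_of_lt ?_ hsub
      calc (C (κ * s)).degree + (X ^ J.card - Q J).degree ≤ 0 + (X ^ J.card - Q J).degree :=
            add_le_add_left degree_C_le _
        _ = _ := zero_add _
    · have h1 := hJ j hj
      rw [hval] at h1
      have h2 : (Q J).eval ((j : ℕ) : ℝ) = 0 := by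
        simp only [Q, eval_prod]
        exact Finset.prod_eq_zero hj (by simp)
      rw [mul_sub, eval_add, eval_sub, eval_mul (p := C (κ * s)) (q := Q J), h2]
      rw [eval_add] at h1
      linarith
  have hR : R + C (κ * s) * X ^ J.card = C (κ * s) * Q J := by
    rw [mul_sub] at hzero
    linear_combination hzero
  refine ⟨fun i hi => ?_, fun hs j hj h => ?_⟩
  · have h1 := congrArg (fun p => p.coeff i) hR
    simp only [coeff_add, coeff_C_mul, coeff_X_pow, hi.ne, if_false, mul_zero, add_zero, R,
      finsetSum_coeff] at h1
    rw [Finset.sum_eq_single i (fun b _ hb => by simp [hb.symm]) (fun h => (h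
      (Finset.mem_range.2 hi)).elim)] at h1
    simp only [if_true, mul_one] at h1
    rw [h1, abs_mul, abs_mul, abs_of_pos hκ0]
    calc κ * |s| * |(Q J).coeff i| ≤ κ * |s| * (B + 1) := by
          gcongr
          linarith [hB J i]
      _ = |s| / 8 := by rw [hκ]; field_simp
  · rw [hval, hR, eval_mul, eval_C, mul_eq_zero] at h
    rcases h with h | h
    · exact (mul_ne_zero hκ0.ne' hs) h
    · simp only [Q, eval_prod, Finset.prod_eq_zero_iff, eval_sub, eval_X, eval_C, sub_eq_zero] at h
      obtain ⟨a, ha, hja⟩ := h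
      have : j = a := Fin.ext (by exact_mod_cast hja)
      exact hj (this ▸ ha)

theorem odd_choose_two_pow_sub_one (ℓ j : ℕ) (hj : j ≤ 2 ^ ℓ - 1) :
    Odd ((2 ^ ℓ - 1).choose j) := by
  have h2 := Nat.one_le_two_pow (n := ℓ)
  induction j with
  | zero => simp
  | succ j ih =>
    have h1 := ih (by omega)
    have h3 : (2 ^ ℓ).choose (j + 1) = (2 ^ ℓ - 1).choose j + (2 ^ ℓ - 1).choose (j + 1) := by
      rw [← Nat.choose_succ_succ]
      congr 1
      omega
    have h4 : 2 ∣ (2 ^ ℓ).choose (j + 1) :=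
      Nat.prime_two.dvd_choose_pow (by omega) (by omega)
    rw [h3, ← even_iff_two_dvd] at h4
    by_contra hcon
    rw [Nat.not_odd_iff_even] at hcon
    exact Nat.not_even_iff_odd.2 h1 ((Nat.even_add.1 h4).2 hcon)

/-- A continuous replacement of the product: the signed minimum of the absolute values. -/
noncomputable def signedMin (α β : ℝ) : ℝ := (|α + β| - |α - β|) / 2

theorem signedMin_neg_left (α β : ℝ) : signedMin (-α) β = -signedMin α β := by
  have h1 : -α + β = -(α - β) := by ring
  have h2 : -α - β = -(α + β) := by ring
  rw [signedMin, signedMin, h1, h2, abs_neg, abs_neg]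
  ring

theorem signedMin_comm (α β : ℝ) : signedMin α β = signedMin β α := by
  rw [signedMin, signedMin, add_comm, abs_sub_comm]

theorem signedMin_neg_right (α β : ℝ) : signedMin α (-β) = -signedMin α β := by
  rw [signedMin_comm, signedMin_neg_left, signedMin_comm]

theorem signedMin_of_abs_lt {α β : ℝ} (h : |α| < |β|) : signedMin α β = SignType.sign β * α := by
  rcases lt_trichotomy β 0 with hβ | rfl | hβ
  · rw [abs_of_neg hβ, abs_lt] at h
    rw [sign_neg hβ, signedMin, abs_of_nonpos (by linarith), abs_of_nonneg (by linarith)]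
    simp
    ring
  · simp at h
    exact absurd h (not_lt.2 (abs_nonneg _))
  · rw [abs_of_pos hβ, abs_lt] at h
    rw [sign_pos hβ, signedMin, abs_of_nonneg (by linarith), abs_of_nonpos (by linarith)]
    simp
    ring

theorem signedMin_eq_zero_iff {α β : ℝ} : signedMin α β = 0 ↔ α = 0 ∨ β = 0 := by
  constructor
  · intro h
    have h1 : |α + β| = |α - β| := by rw [signedMin] at h; linarith
    have h2 : α * β = 0 := by
      have := sq_eq_sq_iff_abs_eq_abs (α + β) (α - β)
      have h3 := this.2 h1
      linarith [h3, (by ring : (α + β) ^ 2 - (α - β) ^ 2 = 4 * (α * β))]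
    exact mul_eq_zero.1 h2
  · rintro (rfl | rfl) <;> simp [signedMin]

theorem continuous_signedMin : Continuous fun p : ℝ × ℝ => signedMin p.1 p.2 := by
  unfold signedMin
  fun_prop

section TreeSymmetry

variable {W : Type*} [AddCommGroup W] {h : ℕ}

/-- The symmetries of the tree, on leaves: total reversal, or exchange below a node. -/
def leafSym : Option (TreeNode h) → TreeLeaf h → TreeLeaf h
  | none, l => l.rev
  | some v, l => TreeLeaf.flip v l

open scoped Classical in
/-- The action of the symmetries of the tree on labellings of the nodes. -/
noncomputable def treeSym : Option (TreeNode h) → (TreeNode h → W) → TreeNode h → W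
  | none, ψ, u => -ψ u.rev
  | some v, ψ, u => if u = v then -ψ (TreeNode.flip v u) else ψ (TreeNode.flip v u)

/-- The sign by which a symmetry of the tree acts on the base point. -/
def symSign : Option (TreeNode h) → ℤˣ
  | none => -1
  | some _ => 1

theorem symSign_mul_self (s : Option (TreeNode h)) : symSign s * symSign s = 1 := by
  cases s <;> simp [symSign]

theorem leafSym_leafSym (s : Option (TreeNode h)) (l : TreeLeaf h) :
    leafSym s (leafSym s l) = l := by
  cases s with
  | none => exact l.rev_rev
  | some v => exact TreeLeaf.flip_flip v l

theorem treeSym_treeSym (s : Option (TreeNode h)) (ψ : TreeNode h → W) :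
    treeSym s (treeSym s ψ) = ψ := by
  funext u
  cases s with
  | none => simp [treeSym, TreeNode.rev_rev]
  | some v =>
    by_cases hu : u = v <;>
      simp [treeSym, TreeNode.flip_eq_self_iff, TreeNode.flip_flip, hu, TreeNode.flip_self]

theorem treeSym_add (s : Option (TreeNode h)) (ψ φ : TreeNode h → W) :
    treeSym s (ψ + φ) = treeSym s ψ + treeSym s φ := by
  funext u
  cases s with
  | none => simp [treeSym, add_comm]
  | some v =>
    simp only [treeSym, Pi.add_apply]
    split_ifs <;> simp [add_comm]

variable [Module ℝ W]

theorem treeSym_smul (s : Option (TreeNode h)) (c : ℝ) (ψ : TreeNode h → W) :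
    treeSym s (c • ψ) = c • treeSym s ψ := by
  funext u
  cases s with
  | none => simp [treeSym]
  | some v =>
    simp only [treeSym, Pi.smul_apply]
    split_ifs <;> simp

/-- The action on labellings as a linear map. -/
noncomputable def treeSymLin (W : Type*) [AddCommGroup W] [Module ℝ W] (s : Option (TreeNode h)) :
    (TreeNode h → W) →ₗ[ℝ] TreeNode h → W where
  toFun := treeSym s
  map_add' := treeSym_add s
  map_smul' := treeSym_smul s

theorem treeSymLin_injective (s : Option (TreeNode h)) :
    Function.Injective (treeSymLin W s) := fun ψ φ hψ => by
  rw [← treeSym_treeSym s ψ, ← treeSym_treeSym s φ]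
  exact congrArg (treeSym s) hψ

theorem leafDiff_leafSym (s : Option (TreeNode h)) (G : TreeLeaf h → W) :
    leafDiff (fun l => G (leafSym s l)) = treeSym s (leafDiff G) := by
  funext u
  cases s with
  | none => exact leafDiff_rev G u
  | some v => exact leafDiff_flip v G u

theorem leafSum_smul (c : ℝ) (ψ : TreeNode h → W) (l : TreeLeaf h) :
    leafSum (fun u => c • ψ u) l = c • leafSum ψ l := by
  induction l with
  | nil => simp [leafSum]
  | cons b l ih => simp only [leafSum, ih, smul_add, smul_comm c]

theorem leafSum_neg (ψ : TreeNode h → W) (l : TreeLeaf h) :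
    leafSum (fun u => -ψ u) l = -leafSum ψ l := by
  simpa using leafSum_smul (-1) ψ l

theorem leafSum_treeSym (s : Option (TreeNode h)) (ψ : TreeNode h → W) (l : TreeLeaf h) :
    leafSum (treeSym s ψ) l = leafSum ψ (leafSym s l) := by
  cases s with
  | none =>
    change leafSum (fun u => -ψ u.rev) l = leafSum ψ l.rev
    rw [leafSum_neg (fun u => ψ u.rev), leafSum_rev, neg_neg]
  | some v => exact leafSum_flip v ψ l

theorem treeSym_ht_smul (s : Option (TreeNode h)) (ψ : TreeNode h → W) (c : ℕ → ℝ)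
    (u : TreeNode h) : c u.ht • treeSym s ψ u = treeSym s (fun u => c u.ht • ψ u) u := by
  cases s with
  | none => simp [treeSym, TreeNode.ht_rev]
  | some v =>
    simp only [treeSym, TreeNode.ht_flip]
    split_ifs <;> simp

theorem leafSum_smul_treeSym (s : Option (TreeNode h)) (ψ : TreeNode h → W) (c : ℕ → ℝ)
    (ε : ℤˣ) (l : TreeLeaf h) :
    leafSum (fun u => c u.ht • (ε • treeSym s ψ u)) l =
      ε • leafSum (fun u => c u.ht • ψ u) (leafSym s l) := by
  rw [← leafSum_treeSym]
  have h1 : (fun u => c u.ht • (ε • treeSym s ψ u)) =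
      fun u => ((ε : ℤ) : ℝ) • treeSym s (fun u => c u.ht • ψ u) u := by
    funext u
    rw [← treeSym_ht_smul, Units.smul_def, ← Int.cast_smul_eq_zsmul ℝ, smul_comm]
  rw [h1, leafSum_smul, Units.smul_def, ← Int.cast_smul_eq_zsmul ℝ]

theorem nodePos_smul (c : ℝ) (x : W) (w : TreeNode h → W) (u : TreeNode h) :
    nodePos (c • x) (fun v => c • w v) u = c • nodePos x w u := by
  induction u generalizing x with
  | root h => rfl
  | child b u ih =>
    simp only [nodePos]
    rw [← ih, smul_add, smul_comm c]

theorem nodePos_add (x y : W) (w w' : TreeNode h → W) (u : TreeNode h) :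
    nodePos (x + y) (fun v => w v + w' v) u = nodePos x w u + nodePos y w' u := by
  induction u generalizing x y with
  | root h => rfl
  | child b u ih =>
    simp only [nodePos]
    rw [← ih, smul_add, add_add_add_comm]

theorem nodePos_none (x : W) (w : TreeNode h → W) (u : TreeNode h) :
    nodePos (-x) (fun v => -treeSym none w v) u = -nodePos x w u.rev := by
  simpa only [treeSym, neg_neg] using nodePos_rev x w u

theorem nodePos_some (v : TreeNode h) (x : W) (w : TreeNode h → W) (u : TreeNode h) :
    nodePos x (treeSym (some v) w) u = nodePos x w (TreeNode.flip v u) :=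
  nodePos_flip v x w u

theorem continuous_leafSum {X : Type*} [TopologicalSpace X] [TopologicalSpace W]
    [ContinuousAdd W] [ContinuousConstSMul ℝ W] {ψ : X → TreeNode h → W} (hψ : Continuous ψ)
    (l : TreeLeaf h) : Continuous fun x => leafSum (ψ x) l := by
  induction l with
  | nil => exact continuous_const
  | cons b l ih =>
    simp only [leafSum]
    exact ((continuous_pi_iff.1 hψ _).const_smul _).add
      (ih (continuous_pi fun u => continuous_pi_iff.1 hψ _))

theorem continuous_leafMean {X : Type*} [TopologicalSpace X] [TopologicalSpace W]
    [ContinuousAdd W] [ContinuousConstSMul ℝ W] {G : X → TreeLeaf h → W} (hG : Continuous G) :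
    Continuous fun x => leafMean (G x) := by
  induction h with
  | zero => exact continuous_pi_iff.1 hG _
  | succ h ih =>
    simp only [leafMean]
    exact ((ih (continuous_pi fun l => continuous_pi_iff.1 hG _)).add
      (ih (continuous_pi fun l => continuous_pi_iff.1 hG _))).const_smul _

theorem continuous_leafDiff {X : Type*} [TopologicalSpace X] [TopologicalSpace W]
    [IsTopologicalAddGroup W] [ContinuousConstSMul ℝ W] {G : X → TreeLeaf h → W}
    (hG : Continuous G) : Continuous fun x => leafDiff (G x) := by
  refine continuous_pi fun u => ?_
  induction u with
  | root h =>
    simp only [leafDiff]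
    exact ((continuous_leafMean (continuous_pi fun l => continuous_pi_iff.1 hG _)).sub
      (continuous_leafMean (continuous_pi fun l => continuous_pi_iff.1 hG _))).const_smul _
  | child b u ih =>
    simp only [leafDiff]
    exact ih (continuous_pi fun l => continuous_pi_iff.1 hG _)

end TreeSymmetry

section CubeConfig

variable {h m r : ℕ}

/-- The symmetry of the tree attached to a coordinate of the cube. -/
def coordSym : Fin r ⊕ TreeNode h × Fin m → Option (TreeNode h)
  | .inl _ => none
  | .inr p => some p.1

open scoped Classical in
/-- The action of the symmetries of the tree on the coordinates of the cube. -/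
noncomputable def cubePerm : Option (TreeNode h) → SignedPerm (Fin r ⊕ TreeNode h × Fin m)
  | none =>
    { toFun := Sum.map id fun p => (p.1.rev, p.2)
      neg := Sum.isLeft
      involutive := by rintro (i | p) <;> simp [TreeNode.rev_rev]
      neg_toFun := by rintro (i | p) <;> simp }
  | some v =>
    { toFun := Sum.map id fun p => (TreeNode.flip v p.1, p.2)
      neg := Sum.elim (fun _ => false) fun p => decide (p.1 = v)
      involutive := by rintro (i | p) <;> simp [TreeNode.flip_flip]
      neg_toFun := by rintro (i | p) <;> simp [TreeNode.flip_eq_self_iff] }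

theorem cubePerm_toFun (i : Fin r ⊕ TreeNode h × Fin m) :
    (cubePerm (coordSym i)).toFun i = i := by
  rcases i with i | p <;> simp [cubePerm, coordSym, TreeNode.flip_self]

theorem cubePerm_neg (i : Fin r ⊕ TreeNode h × Fin m) :
    (cubePerm (coordSym i)).neg i = true := by
  rcases i with i | p <;> simp [cubePerm, coordSym]

/-- The last coordinate completing a vector of norm at most one to one of norm at least a half,
vanishing on the unit sphere. -/
noncomputable def capHeight {m : ℕ} (p : Fin m → ℝ) : ℝ := min (1 / 2) (1 - ‖p‖)

theorem capHeight_neg (p : Fin m → ℝ) : capHeight (-p) = capHeight p := by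
  simp [capHeight]

theorem continuous_capHeight : Continuous (capHeight (m := m)) := by
  unfold capHeight
  fun_prop

theorem capHeight_nonneg {p : Fin m → ℝ} (hp : ‖p‖ ≤ 1) : 0 ≤ capHeight p :=
  le_min (by norm_num) (by linarith)

theorem capHeight_le (p : Fin m → ℝ) : capHeight p ≤ 1 / 2 := min_le_left _ _

theorem capHeight_of_norm_le {p : Fin m → ℝ} (hp : ‖p‖ ≤ 1 / 2) : capHeight p = 1 / 2 :=
  min_eq_left (by linarith)

theorem capHeight_of_norm_eq_one {p : Fin m → ℝ} (hp : ‖p‖ = 1) : capHeight p = 0 := by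
  rw [capHeight, hp]; norm_num

/-- A vector of the unit ball lifted to the upper half of an annulus. -/
noncomputable def capLift {m : ℕ} (p : Fin m → ℝ) : (Fin m → ℝ) × ℝ := (p, capHeight p)

theorem continuous_capLift : Continuous (capLift (m := m)) :=
  continuous_id.prodMk continuous_capHeight

theorem norm_capLift_le {p : Fin m → ℝ} (hp : ‖p‖ ≤ 1) : ‖capLift p‖ ≤ 1 := by
  rw [capLift, norm_prod_le_iff]
  refine ⟨hp, ?_⟩
  rw [Real.norm_of_nonneg (capHeight_nonneg hp)]
  linarith [capHeight_le p]

theorem half_le_norm_capLift {p : Fin m → ℝ} (hp : ‖p‖ ≤ 1) : 1 / 2 ≤ ‖capLift p‖ := by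
  rw [capLift, Prod.norm_def, le_max_iff, Real.norm_of_nonneg (capHeight_nonneg hp)]
  by_cases h1 : 1 / 2 ≤ ‖p‖
  · exact Or.inl h1
  · exact Or.inr (capHeight_of_norm_le (not_le.1 h1).le).ge

theorem capLift_neg_of_norm_eq_one {p : Fin m → ℝ} (hp : ‖p‖ = 1) :
    capLift (-p) = -capLift p := by
  rw [capLift, capLift, capHeight_neg, capHeight_of_norm_eq_one hp]
  simp

/-- The first block of coordinates of the cube, completed by zeros. -/
def baseCoord (m : ℕ) (z : Fin r ⊕ TreeNode h × Fin m → ℝ) (t : Fin m) : ℝ :=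
  if ht : (t : ℕ) < r then z (.inl ⟨t, ht⟩) else 0

/-- The block of coordinates of the cube belonging to a node. -/
def nodeCoord (z : Fin r ⊕ TreeNode h × Fin m → ℝ) (u : TreeNode h) (t : Fin m) : ℝ :=
  z (.inr (u, t))

theorem norm_baseCoord_le {z : Fin r ⊕ TreeNode h × Fin m → ℝ} (hz : ‖z‖ ≤ 1) :
    ‖baseCoord m z‖ ≤ 1 := by
  refine (pi_norm_le_iff_of_nonneg zero_le_one).2 fun t => ?_
  rw [baseCoord]
  split_ifs
  · exact (norm_le_pi_norm z _).trans hz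
  · simp

theorem norm_nodeCoord_le {z : Fin r ⊕ TreeNode h × Fin m → ℝ} (hz : ‖z‖ ≤ 1) (u : TreeNode h) :
    ‖nodeCoord z u‖ ≤ 1 :=
  (pi_norm_le_iff_of_nonneg zero_le_one).2 fun _ => (norm_le_pi_norm z _).trans hz

theorem continuous_baseCoord : Continuous (baseCoord (h := h) (r := r) m) := by
  refine continuous_pi fun t => ?_
  simp only [baseCoord]
  split_ifs
  · exact continuous_apply _
  · exact continuous_const

/-- The configuration of a base point and node directions given by a point of the cube. -/
noncomputable def cubeConfig (z : Fin r ⊕ TreeNode h × Fin m → ℝ) :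
    ((Fin m → ℝ) × ℝ) × (TreeNode h → (Fin m → ℝ) × ℝ) :=
  (capLift (baseCoord m z), fun u => capLift (nodeCoord z u))

theorem continuous_cubeConfig : Continuous (cubeConfig (h := h) (m := m) (r := r)) :=
  (continuous_capLift.comp continuous_baseCoord).prodMk
    (continuous_pi fun _ => continuous_capLift.comp (continuous_pi fun _ => continuous_apply _))

theorem cubeConfig_injective (hr : r ≤ m) :
    Function.Injective (cubeConfig (h := h) (m := m) (r := r)) := by
  intro z z' hz
  have h1 : baseCoord m z = baseCoord m z' := congrArg (fun c => c.1.1) hz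
  have h2 : ∀ u, nodeCoord z u = nodeCoord z' u := fun u => congrArg (fun c => (c.2 u).1) hz
  funext i
  rcases i with i | ⟨u, t⟩
  · have := congrFun h1 ⟨i, i.2.trans_le hr⟩
    simpa [baseCoord] using this
  · exact congrFun (h2 u) t

/-- The symmetry attached to a face of the cube acts on the configurations over that face. -/
theorem cubeConfig_act (hr : r ≤ m) (i : Fin r ⊕ TreeNode h × Fin m)
    (z : Fin r ⊕ TreeNode h × Fin m → ℝ) (hz : ‖z‖ ≤ 1) (hi : |z i| = 1) :
    cubeConfig ((cubePerm (coordSym i)).act z) =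
      (symSign (coordSym i) • (cubeConfig z).1,
        fun u => symSign (coordSym i) • treeSym (coordSym i) (cubeConfig z).2 u) := by
  rcases i with i | ⟨v, t⟩
  · have hb : baseCoord m ((cubePerm (none : Option (TreeNode h))).act z) = -baseCoord m z := by
      funext t
      simp only [baseCoord, Pi.neg_apply]
      split_ifs <;> simp [SignedPerm.act, cubePerm]
    have hw : ∀ u, nodeCoord ((cubePerm (none : Option (TreeNode h))).act z) u =
        nodeCoord z u.rev := fun u => by
      funext t
      simp [nodeCoord, SignedPerm.act, cubePerm]
    have hn : ‖baseCoord m z‖ = 1 := by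
      refine le_antisymm (norm_baseCoord_le hz) ?_
      have := norm_le_pi_norm (baseCoord m z) ⟨i, i.2.trans_le hr⟩
      simp only [baseCoord, i.2, dif_pos] at this
      rwa [Real.norm_eq_abs, hi] at this
    simp [cubeConfig, coordSym, symSign, treeSym, hb, hw, capLift_neg_of_norm_eq_one hn]
  · have hb : baseCoord m ((cubePerm (some v)).act z) = baseCoord m z := by
      funext t
      simp only [baseCoord]
      split_ifs <;> simp [SignedPerm.act, cubePerm]
    have hw : ∀ u, u ≠ v → nodeCoord ((cubePerm (some v)).act z) u =
        nodeCoord z (TreeNode.flip v u) := fun u hu => by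
      funext t
      simp [nodeCoord, SignedPerm.act, cubePerm, hu]
    have hv : nodeCoord ((cubePerm (some v)).act z) v = -nodeCoord z v := by
      funext t
      simp [nodeCoord, SignedPerm.act, cubePerm, TreeNode.flip_self]
    have hn : ‖nodeCoord z v‖ = 1 := by
      refine le_antisymm (norm_nodeCoord_le hz v) ?_
      have := norm_le_pi_norm (nodeCoord z v) t
      rwa [Real.norm_eq_abs, nodeCoord, hi] at this
    simp only [cubeConfig, coordSym, symSign, treeSym, hb, one_smul]
    congr 1
    funext u
    by_cases hu : u = v
    · subst hu
      rw [if_pos rfl, hv, capLift_neg_of_norm_eq_one hn, TreeNode.flip_self]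
    · rw [if_neg hu, hw u hu]

end CubeConfig

theorem polyVal_add (d : ℕ) (y y' : ℕ → ℝ) (s s' T : ℝ) :
    polyVal d (fun i => y i + y' i) (s + s') T = polyVal d y s T + polyVal d y' s' T := by
  simp only [polyVal, add_mul, Finset.sum_add_distrib]
  ring

theorem polyVal_smul (d : ℕ) (a : ℝ) (y : ℕ → ℝ) (s T : ℝ) :
    polyVal d (fun i => a * y i) (a * s) T = a * polyVal d y s T := by
  simp only [polyVal, mul_add, Finset.mul_sum, mul_assoc]

section TestMap

variable {h m : ℕ}

/-- A coordinate of a vector, read as zero outside the range of indices. -/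
def coordAt (p : (Fin m → ℝ) × ℝ) (t : ℕ) : ℝ := if ht : t < m then p.1 ⟨t, ht⟩ else 0

theorem coordAt_add (p q : (Fin m → ℝ) × ℝ) (t : ℕ) :
    coordAt (p + q) t = coordAt p t + coordAt q t := by
  simp only [coordAt]
  split_ifs <;> simp

theorem coordAt_smul (a : ℝ) (p : (Fin m → ℝ) × ℝ) (t : ℕ) :
    coordAt (a • p) t = a * coordAt p t := by
  simp only [coordAt]
  split_ifs <;> simp

theorem coordAt_neg (p : (Fin m → ℝ) × ℝ) (t : ℕ) : coordAt (-p) t = -coordAt p t := by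
  simp only [coordAt]
  split_ifs <;> simp

/-- The value at `T` of the polynomial whose coefficients are the block of coordinates of the
position of a node that belongs to the height of the node. -/
noncomputable def testLow (c : ℕ) (κ : ℝ) (u : TreeNode h) (T : ℝ) :
    ((Fin m → ℝ) × ℝ) × (TreeNode h → (Fin m → ℝ) × ℝ) →ₗ[ℝ] ℝ where
  toFun p := polyVal (2 ^ u.ht * c) (fun i => nodePos (coordAt p.1 ((2 ^ u.ht - 1) * c + i))
    (fun v => coordAt (p.2 v) ((2 ^ u.ht - 1) * c + i)) u) (κ * p.1.2) T
  map_add' p q := by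
    simp only [Prod.fst_add, Prod.snd_add, Pi.add_apply, coordAt_add, nodePos_add, mul_add,
      polyVal_add]
  map_smul' a p := by
    simp only [Prod.smul_fst, Prod.smul_snd, Pi.smul_apply, coordAt_smul, RingHom.id_apply]
    have := fun i => nodePos_smul a (coordAt p.1 ((2 ^ u.ht - 1) * c + i))
      (fun v => coordAt (p.2 v) ((2 ^ u.ht - 1) * c + i)) u
    simp only [smul_eq_mul] at this
    simp only [this, smul_eq_mul, mul_left_comm κ, polyVal_smul]

/-- The value at `T` of the polynomial whose coefficients are the remaining coordinates of the
direction at a node. -/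
noncomputable def testHigh (c : ℕ) (κ : ℝ) (u : TreeNode h) (T : ℝ) :
    ((Fin m → ℝ) × ℝ) × (TreeNode h → (Fin m → ℝ) × ℝ) →ₗ[ℝ] ℝ where
  toFun p := polyVal (m - (2 ^ u.ht - 1) * c) (fun i => coordAt (p.2 u) ((2 ^ u.ht - 1) * c + i))
    (κ * (p.2 u).2) T
  map_add' p q := by
    simp only [Prod.snd_add, Pi.add_apply, coordAt_add, mul_add, polyVal_add]
  map_smul' a p := by
    simp only [Prod.smul_snd, Pi.smul_apply, coordAt_smul, RingHom.id_apply, smul_eq_mul,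
      mul_left_comm κ, polyVal_smul]

/-- The equivariant map whose zeros are counted. -/
noncomputable def testMap (M c : ℕ) (κ : ℝ)
    (p : ((Fin m → ℝ) × ℝ) × (TreeNode h → (Fin m → ℝ) × ℝ)) (u : TreeNode h) (j : Fin M) : ℝ :=
  signedMin (testLow c κ u (j : ℕ) p) (testHigh c κ u (j : ℕ) p)

theorem continuous_testMap (M c : ℕ) (κ : ℝ) :
    Continuous (testMap (h := h) (m := m) M c κ) :=
  continuous_pi fun u => continuous_pi fun j => continuous_signedMin.comp
    ((testLow c κ u (j : ℕ)).continuous_of_finiteDimensional.prodMk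
      (testHigh c κ u (j : ℕ)).continuous_of_finiteDimensional)

theorem testMap_treeSym (M c : ℕ) (κ : ℝ) (s : Option (TreeNode h))
    (p : ((Fin m → ℝ) × ℝ) × (TreeNode h → (Fin m → ℝ) × ℝ)) :
    testMap M c κ (symSign s • p.1, fun u => symSign s • treeSym s p.2 u) =
      treeSym s (testMap M c κ p) := by
  have polyVal_neg : ∀ (d : ℕ) (y : ℕ → ℝ) (s T : ℝ),
      polyVal d (fun i => -y i) (-s) T = -polyVal d y s T := fun d y s T => by
    simpa using polyVal_smul d (-1) y s T
  have coordAt_treeSym : ∀ (w : TreeNode h → (Fin m → ℝ) × ℝ) (v : TreeNode h) (t : ℕ),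
      coordAt (treeSym s w v) t = treeSym s (fun v => coordAt (w v) t) v := fun w v t => by
    cases s with
    | none => exact coordAt_neg _ _
    | some v' => by_cases hv : v = v' <;> simp [treeSym, hv, coordAt_neg]
  funext u j
  cases s with
  | none =>
    simp only [symSign, Units.neg_smul, one_smul]
    have h1 : testLow c κ u (j : ℕ) (-p.1, fun u => -treeSym none p.2 u) =
        -testLow c κ u.rev (j : ℕ) p := by
      simp [testLow, coordAt_neg, coordAt_treeSym, nodePos_none, TreeNode.ht_rev, polyVal_neg]
    have h2 : testHigh c κ u (j : ℕ) (-p.1, fun u => -treeSym none p.2 u) =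
        testHigh c κ u.rev (j : ℕ) p := by
      simp [testHigh, treeSym, TreeNode.ht_rev]
    simp only [testMap, h1, h2, signedMin_neg_left]
    rfl
  | some v =>
    simp only [symSign, one_smul]
    have h1 : testLow c κ u (j : ℕ) (p.1, fun u => treeSym (some v) p.2 u) =
        testLow c κ (TreeNode.flip v u) (j : ℕ) p := by
      simp only [testLow, LinearMap.coe_mk, AddHom.coe_mk, coordAt_treeSym, TreeNode.ht_flip]
      congr 1
      funext i
      exact nodePos_some v _ _ u
    by_cases hu : u = v
    · have h2 : testHigh c κ u (j : ℕ) (p.1, fun u => treeSym (some v) p.2 u) =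
          -testHigh c κ (TreeNode.flip v u) (j : ℕ) p := by
        subst hu
        simp [testHigh, treeSym, coordAt_neg, TreeNode.flip_self, polyVal_neg]
      simp only [testMap, h1, h2, signedMin_neg_right]
      rw [treeSym, if_pos hu]
      rfl
    · have h2 : testHigh c κ u (j : ℕ) (p.1, fun u => treeSym (some v) p.2 u) =
          testHigh c κ (TreeNode.flip v u) (j : ℕ) p := by
        simp [testHigh, treeSym, hu, TreeNode.ht_flip]
      simp only [testMap, h1, h2]
      rw [treeSym, if_neg hu]
      rfl

end TestMap

section ZeroCount

variable {h m M c : ℕ} {κ : ℝ}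

/-- The property of `κ` stated in `exists_polyVal_coeff_bound`. -/
def IsCoeffBound (M : ℕ) (κ : ℝ) : Prop :=
  ∀ (J : Finset (Fin M)) (d : ℕ), J.card = d → ∀ (y : ℕ → ℝ) (s : ℝ),
    (∀ j ∈ J, polyVal d y (κ * s) (j : ℕ) = 0) →
    (∀ i < d, |y i| ≤ |s| / 8) ∧ (s ≠ 0 → ∀ j ∉ J, polyVal d y (κ * s) (j : ℕ) ≠ 0)

theorem exists_block (c : ℕ) {t E : ℕ} (ht : t < (2 ^ E - 1) * c) :
    ∃ e < E, ∃ i < 2 ^ e * c, t = (2 ^ e - 1) * c + i := by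
  induction E with
  | zero => simp at ht
  | succ E ih =>
    by_cases h1 : t < (2 ^ E - 1) * c
    · obtain ⟨e, he, i, hi⟩ := ih h1
      exact ⟨e, he.trans (Nat.lt_succ_self _), i, hi⟩
    · refine ⟨E, Nat.lt_succ_self _, t - (2 ^ E - 1) * c, ?_, by omega⟩
      have h2 := Nat.one_le_two_pow (n := E)
      have h3 : (2 ^ (E + 1) - 1) * c = (2 ^ E - 1) * c + 2 ^ E * c := by
        rw [← add_mul, pow_succ]
        congr 1
        omega
      omega

theorem block_start_le (hM : m + c = M) (hle : 2 ^ h * c ≤ M) {e : ℕ} (he : e ≤ h) :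
    (2 ^ e - 1) * c ≤ m ∧ (m - (2 ^ e - 1) * c) + 2 ^ e * c = M := by
  have h1 : 2 ^ e * c ≤ 2 ^ h * c := Nat.mul_le_mul_right _ (Nat.pow_le_pow_right (by norm_num) he)
  have h2 : (2 ^ e - 1) * c + c = 2 ^ e * c := by
    rw [← Nat.succ_mul, Nat.succ_eq_add_one, Nat.sub_add_cancel Nat.one_le_two_pow]
  omega

theorem abs_coordAt_le_of_nodePos {E : ℕ} (hE : E ≤ h) (η : ℝ)
    (p : ((Fin m → ℝ) × ℝ) × (TreeNode h → (Fin m → ℝ) × ℝ))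
    (hb : ∀ u : TreeNode h, u.ht < E → ∀ i < 2 ^ u.ht * c,
      |nodePos (coordAt p.1 ((2 ^ u.ht - 1) * c + i))
        (fun v => coordAt (p.2 v) ((2 ^ u.ht - 1) * c + i)) u| ≤ η)
    {t : ℕ} (ht : t < (2 ^ E - 1) * c) :
    |coordAt p.1 t| ≤ η ∧ ∀ u : TreeNode h, E ≤ u.ht → |coordAt (p.2 u) t| ≤ η := by
  obtain ⟨e, he, i, hi, rfl⟩ := exists_block c ht
  obtain ⟨h1, h2⟩ := abs_le_of_abs_nodePos_le (coordAt p.1 ((2 ^ e - 1) * c + i)) η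
    (fun v => coordAt (p.2 v) ((2 ^ e - 1) * c + i)) (he.trans_le hE) fun u hu => by
      subst hu
      exact hb u he i hi
  exact ⟨h1, fun u hu => h2 u (he.trans_le hu)⟩

theorem abs_nodePos_le_of_testLow (hκ : IsCoeffBound M κ) {J : Finset (Fin M)} {u : TreeNode h}
    (hJ : J.card = 2 ^ u.ht * c) {p : ((Fin m → ℝ) × ℝ) × (TreeNode h → (Fin m → ℝ) × ℝ)}
    (hP : ∀ j ∈ J, testLow c κ u (j : ℕ) p = 0) :
    (∀ i < 2 ^ u.ht * c, |nodePos (coordAt p.1 ((2 ^ u.ht - 1) * c + i))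
        (fun v => coordAt (p.2 v) ((2 ^ u.ht - 1) * c + i)) u| ≤ |p.1.2| / 8) ∧
      (p.1.2 ≠ 0 → ∀ j ∉ J, testLow c κ u (j : ℕ) p ≠ 0) :=
  hκ J _ hJ _ _ hP

theorem abs_coordAt_le_of_testHigh (hκ : IsCoeffBound M κ) {J : Finset (Fin M)} {u : TreeNode h}
    (hJ : J.card = m - (2 ^ u.ht - 1) * c)
    {p : ((Fin m → ℝ) × ℝ) × (TreeNode h → (Fin m → ℝ) × ℝ)}
    (hR : ∀ j ∈ J, testHigh c κ u (j : ℕ) p = 0) :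
    (∀ t, (2 ^ u.ht - 1) * c ≤ t → |coordAt (p.2 u) t| ≤ |(p.2 u).2| / 8) ∧
      ((p.2 u).2 ≠ 0 → ∀ j ∉ J, testHigh c κ u (j : ℕ) p ≠ 0) := by
  obtain ⟨h1, h2⟩ := hκ J _ hJ _ _ hR
  refine ⟨fun t ht => ?_, h2⟩
  by_cases htm : t < m
  · have := h1 (t - (2 ^ u.ht - 1) * c) (by omega)
    rwa [Nat.add_sub_cancel' ht] at this
  · rw [coordAt, dif_neg htm, abs_zero]
    positivity

theorem abs_coordAt_le_of_linear_system (hκ : IsCoeffBound M κ) (hM : m + c = M)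
    (hle : 2 ^ h * c ≤ M) {J : TreeNode h → Finset (Fin M)} (hJ : ∀ u, (J u).card = 2 ^ u.ht * c)
    {p : ((Fin m → ℝ) × ℝ) × (TreeNode h → (Fin m → ℝ) × ℝ)}
    (hx : ∀ t, (2 ^ h - 1) * c ≤ t → coordAt p.1 t = 0)
    (hP : ∀ u, ∀ j ∈ J u, testLow c κ u (j : ℕ) p = 0)
    (hR : ∀ u, ∀ j ∉ J u, testHigh c κ u (j : ℕ) p = 0) {η : ℝ}
    (hη : |p.1.2| / 8 ≤ η) (hη' : ∀ u, |(p.2 u).2| / 8 ≤ η) :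
    (∀ t, |coordAt p.1 t| ≤ η) ∧ ∀ u t, |coordAt (p.2 u) t| ≤ η := by
  have hη0 : 0 ≤ η := (by positivity : 0 ≤ |p.1.2| / 8).trans hη
  have hlow := fun u : TreeNode h => (abs_nodePos_le_of_testLow hκ (hJ u) (hP u)).1
  constructor
  · intro t
    by_cases ht : (2 ^ h - 1) * c ≤ t
    · rw [hx t ht, abs_zero]
      exact hη0
    · exact (abs_coordAt_le_of_nodePos le_rfl η p
        (fun u _ i hi => (hlow u i hi).trans hη) (not_le.1 ht)).1
  · intro u t
    by_cases ht : (2 ^ u.ht - 1) * c ≤ t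
    · have hc : ((J u)ᶜ).card = m - (2 ^ u.ht - 1) * c := by
        rw [Finset.card_compl, Fintype.card_fin, hJ]
        have := (block_start_le hM hle u.ht_lt.le).2
        omega
      exact ((abs_coordAt_le_of_testHigh hκ hc fun j hj => hR u j (Finset.mem_compl.1 hj)).1
        t ht).trans (hη' u)
    · exact (abs_coordAt_le_of_nodePos u.ht_lt.le η p
        (fun u _ i hi => (hlow u i hi).trans hη) (not_le.1 ht)).2 u le_rfl

theorem norm_fst_le_of_abs_coordAt_le {p : (Fin m → ℝ) × ℝ} {η : ℝ} (hη : 0 ≤ η)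
    (hp : ∀ t, |coordAt p t| ≤ η) : ‖p.1‖ ≤ η :=
  (pi_norm_le_iff_of_nonneg hη).2 fun t => by
    have := hp t
    rwa [coordAt, dif_pos t.2] at this

theorem coordAt_cubeConfig_fst {r : ℕ} (z : Fin r ⊕ TreeNode h × Fin m → ℝ) {t : ℕ} (ht : r ≤ t) :
    coordAt (cubeConfig z).1 t = 0 := by
  simp [coordAt, cubeConfig, capLift, baseCoord, ht]

/-- The zeros of the test map in the cube solve one of finitely many affine systems. -/
theorem exists_subsets_of_testMap_eq_zero (hκ : IsCoeffBound M κ) (hM : m + c = M)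
    (hle : 2 ^ h * c ≤ M) {z : Fin ((2 ^ h - 1) * c) ⊕ TreeNode h × Fin m → ℝ} (hz : ‖z‖ ≤ 1)
    (hzero : testMap M c κ (cubeConfig z) = 0) :
    ∃ J : TreeNode h → Finset (Fin M), (∀ u, (J u).card = 2 ^ u.ht * c) ∧
      (∀ u, ∀ j ∈ J u, testLow c κ u (j : ℕ) (cubeConfig z) = 0) ∧
      (∀ u, ∀ j ∉ J u, testHigh c κ u (j : ℕ) (cubeConfig z) = 0) ∧
      (cubeConfig z).1.2 = 1 / 2 ∧ ∀ u, ((cubeConfig z).2 u).2 = 1 / 2 := by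
  classical
  set p := cubeConfig z with hp
  have hx2 : |p.1.2| ≤ 1 / 2 := by
    change |capHeight (baseCoord m z)| ≤ 1 / 2
    rw [abs_of_nonneg (capHeight_nonneg (norm_baseCoord_le hz))]
    exact capHeight_le _
  have hw2 : ∀ u, |(p.2 u).2| ≤ 1 / 2 := fun u => by
    change |capHeight (nodeCoord z u)| ≤ 1 / 2
    rw [abs_of_nonneg (capHeight_nonneg (norm_nodeCoord_le hz u))]
    exact capHeight_le _
  have hor : ∀ u (j : Fin M), testLow c κ u (j : ℕ) p = 0 ∨ testHigh c κ u (j : ℕ) p = 0 :=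
    fun u j => signedMin_eq_zero_iff.1 (congrFun (congrFun hzero u) j)
  have hw_half : ∀ u, (∀ t, |coordAt (p.2 u) t| ≤ 1 / 16) → (p.2 u).2 = 1 / 2 := fun u hu =>
    capHeight_of_norm_le ((norm_fst_le_of_abs_coordAt_le (by norm_num) hu).trans (by norm_num))
  have hstep : ∀ n, ∀ u : TreeNode h, u.ht = n → ∃ J : Finset (Fin M), J.card = 2 ^ u.ht * c ∧
      ∀ j ∈ J, testLow c κ u (j : ℕ) p = 0 := by
    intro n
    induction n using Nat.strong_induction_on with
    | _ n ih =>
      intro u hu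
      have hcoord : ∀ t < (2 ^ u.ht - 1) * c, |coordAt (p.2 u) t| ≤ 1 / 16 := fun t ht =>
        (abs_coordAt_le_of_nodePos u.ht_lt.le (1 / 16) p (fun v hv i hi => by
          obtain ⟨J, hJ, hJ0⟩ := ih v.ht (hu ▸ hv) v rfl
          linarith [(abs_nodePos_le_of_testLow hκ hJ hJ0).1 i hi]) ht).2 u le_rfl
      have hblock := block_start_le hM hle u.ht_lt.le
      set Z : Finset (Fin M) := Finset.univ.filter fun j => testLow c κ u (j : ℕ) p = 0 with hZ
      by_cases hcard : 2 ^ u.ht * c ≤ Z.card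
      · obtain ⟨J, hJZ, hJ⟩ := Finset.exists_subset_card_eq hcard
        exact ⟨J, hJ, fun j hj => (Finset.mem_filter.1 (hJZ hj)).2⟩
      · exfalso
        have hZc : m - (2 ^ u.ht - 1) * c < (Zᶜ).card := by
          rw [Finset.card_compl, Fintype.card_fin]
          omega
        have hZ0 : ∀ j ∈ Zᶜ, testHigh c κ u (j : ℕ) p = 0 := fun j hj =>
          (hor u j).resolve_left fun h0 =>
            Finset.mem_compl.1 hj (Finset.mem_filter.2 ⟨Finset.mem_univ _, h0⟩)
        obtain ⟨J, hJZ, hJ⟩ := Finset.exists_subset_card_eq hZc.le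
        obtain ⟨j, hjZ, hjJ⟩ := Finset.exists_of_ssubset
          (Finset.ssubset_iff_subset_ne.2 ⟨hJZ, fun heq => by rw [heq] at hJ; omega⟩)
        obtain ⟨h1, h2⟩ := abs_coordAt_le_of_testHigh hκ hJ fun j hj => hZ0 j (hJZ hj)
        have h3 : (p.2 u).2 = 1 / 2 := hw_half u fun t => by
          by_cases ht : (2 ^ u.ht - 1) * c ≤ t
          · linarith [h1 t ht, hw2 u]
          · exact hcoord t (not_le.1 ht)
        exact h2 (by rw [h3]; norm_num) j hjJ (hZ0 j hjZ)
  choose J hJ hJ0 using fun u => hstep _ u rfl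
  have hxcoord : ∀ t, |coordAt p.1 t| ≤ 1 / 16 := by
    intro t
    by_cases ht : (2 ^ h - 1) * c ≤ t
    · rw [hp, coordAt_cubeConfig_fst z ht]
      norm_num
    · exact (abs_coordAt_le_of_nodePos le_rfl (1 / 16) p (fun v _ i hi => by
        linarith [(abs_nodePos_le_of_testLow hκ (hJ v) (hJ0 v)).1 i hi]) (not_le.1 ht)).1
  have hx_half : p.1.2 = 1 / 2 := capHeight_of_norm_le
    ((norm_fst_le_of_abs_coordAt_le (by norm_num) hxcoord).trans (by norm_num))
  have hR : ∀ u, ∀ j ∉ J u, testHigh c κ u (j : ℕ) p = 0 := fun u j hj =>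
    (hor u j).resolve_left
      ((abs_nodePos_le_of_testLow hκ (hJ u) (hJ0 u)).2 (by rw [hx_half]; norm_num) j hj)
  refine ⟨J, hJ, hJ0, hR, hx_half, fun u => hw_half u fun t => ?_⟩
  exact (abs_coordAt_le_of_linear_system hκ hM hle hJ (fun t ht => coordAt_cubeConfig_fst z ht)
    hJ0 hR (by linarith) fun u => by linarith [hw2 u]).2 u t

end ZeroCount

open Filter Topology

section AffineSystem

variable {h m M c r : ℕ} {κ : ℝ}

/-- The coordinates of the configuration of a point of the cube, without the cap heights. -/
noncomputable def cubeLin (h m r : ℕ) : (Fin r ⊕ TreeNode h × Fin m → ℝ) →ₗ[ℝ]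
    ((Fin m → ℝ) × ℝ) × (TreeNode h → (Fin m → ℝ) × ℝ) where
  toFun z := ((baseCoord m z, 0), fun u => (nodeCoord z u, 0))
  map_add' z z' := by
    have : baseCoord m (z + z') = baseCoord m z + baseCoord m z' := by
      funext t
      simp only [baseCoord, Pi.add_apply]
      split_ifs <;> simp
    simp only [this, Prod.mk_add_mk, add_zero]
    congr 1
    funext u
    simp only [Pi.add_apply, Prod.mk_add_mk, add_zero]
    rfl
  map_smul' a z := by
    have : baseCoord m (a • z) = a • baseCoord m z := by
      funext t
      simp only [baseCoord, Pi.smul_apply]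
      split_ifs <;> simp
    simp only [this, RingHom.id_apply, Prod.smul_mk, smul_zero]
    congr 1
    funext u
    simp only [Pi.smul_apply, Prod.smul_mk, smul_zero]
    rfl

/-- The configuration with all coordinates zero and all cap heights one half. -/
noncomputable def capVec (h m : ℕ) : ((Fin m → ℝ) × ℝ) × (TreeNode h → (Fin m → ℝ) × ℝ) :=
  ((0, 1 / 2), fun _ => (0, 1 / 2))

theorem cubeConfig_eq_cubeLin_add {z : Fin r ⊕ TreeNode h × Fin m → ℝ}
    (h1 : (cubeConfig z).1.2 = 1 / 2) (h2 : ∀ u, ((cubeConfig z).2 u).2 = 1 / 2) :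
    cubeConfig z = cubeLin h m r z + capVec h m := by
  refine Prod.ext (Prod.ext ?_ ?_) (funext fun u => Prod.ext ?_ ?_)
  · simp [cubeLin, capVec, cubeConfig, capLift]
  · rw [h1]
    simp [cubeLin, capVec]
  · simp [cubeLin, capVec, cubeConfig, capLift]
  · rw [h2]
    simp [cubeLin, capVec]

theorem cubeConfig_eq_cubeLin_add_of_norm_le {z : Fin r ⊕ TreeNode h × Fin m → ℝ}
    (hz : ‖z‖ ≤ 1 / 2) : cubeConfig z = cubeLin h m r z + capVec h m := by
  refine cubeConfig_eq_cubeLin_add (capHeight_of_norm_le ?_) fun u => capHeight_of_norm_le ?_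
  · refine (pi_norm_le_iff_of_nonneg (by norm_num)).2 fun t => ?_
    rw [baseCoord]
    split_ifs
    · exact (norm_le_pi_norm z _).trans hz
    · norm_num
  · exact (pi_norm_le_iff_of_nonneg (by norm_num)).2 fun _ => (norm_le_pi_norm z _).trans hz

open scoped Classical in
/-- The linear system attached to a family of subsets. -/
noncomputable def testSystem (m c : ℕ) (κ : ℝ) (J : TreeNode h → Finset (Fin M)) :
    ((Fin m → ℝ) × ℝ) × (TreeNode h → (Fin m → ℝ) × ℝ) →ₗ[ℝ] TreeNode h → Fin M → ℝ :=
  LinearMap.pi fun u => LinearMap.pi fun j =>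
    if j ∈ J u then testLow c κ u (j : ℕ) else testHigh c κ u (j : ℕ)

theorem testSystem_of_mem {J : TreeNode h → Finset (Fin M)} {u : TreeNode h} {j : Fin M}
    (hj : j ∈ J u) (p : ((Fin m → ℝ) × ℝ) × (TreeNode h → (Fin m → ℝ) × ℝ)) :
    testSystem m c κ J p u j = testLow c κ u (j : ℕ) p := by
  simp [testSystem, hj]

theorem testSystem_of_notMem {J : TreeNode h → Finset (Fin M)} {u : TreeNode h} {j : Fin M}
    (hj : j ∉ J u) (p : ((Fin m → ℝ) × ℝ) × (TreeNode h → (Fin m → ℝ) × ℝ)) :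
    testSystem m c κ J p u j = testHigh c κ u (j : ℕ) p := by
  simp [testSystem, hj]

theorem coordAt_cubeLin_add_smul_fst (z : Fin r ⊕ TreeNode h × Fin m → ℝ) (a : ℝ) (t : ℕ) :
    coordAt (cubeLin h m r z + a • capVec h m).1 t =
      if ht : t < m then baseCoord m z ⟨t, ht⟩ else 0 := by
  simp [coordAt, cubeLin, capVec]

theorem coordAt_cubeLin_add_smul_snd (z : Fin r ⊕ TreeNode h × Fin m → ℝ) (a : ℝ) (u : TreeNode h)
    (t : ℕ) : coordAt ((cubeLin h m r z + a • capVec h m).2 u) t =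
      if ht : t < m then z (.inr (u, ⟨t, ht⟩)) else 0 := by
  simp [coordAt, cubeLin, capVec, nodeCoord]

theorem norm_le_of_testSystem_eq_zero (hκ : IsCoeffBound M κ) (hM : m + c = M)
    (hle : 2 ^ h * c ≤ M) {J : TreeNode h → Finset (Fin M)} (hJ : ∀ u, (J u).card = 2 ^ u.ht * c)
    {z : Fin ((2 ^ h - 1) * c) ⊕ TreeNode h × Fin m → ℝ} {a : ℝ} (ha : 0 ≤ a)
    (hz : testSystem m c κ J (cubeLin h m _ z + a • capVec h m) = 0) :
    ‖z‖ ≤ a / 16 := by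
  have hr := (block_start_le hM hle le_rfl).1
  have h1 : (cubeLin h m _ z + a • capVec h m).1.2 = a / 2 := by
    simp [cubeLin, capVec]
    ring
  have h2 : ∀ u, ((cubeLin h m _ z + a • capVec h m).2 u).2 = a / 2 := fun u => by
    simp [cubeLin, capVec]
    ring
  have habs : |a / 2| / 8 ≤ a / 16 := by
    rw [abs_of_nonneg (by linarith)]
    linarith
  obtain ⟨h3, h4⟩ := abs_coordAt_le_of_linear_system (η := a / 16) hκ hM hle hJ
    (p := cubeLin h m _ z + a • capVec h m)
    (fun t ht => by
      rw [coordAt_cubeLin_add_smul_fst]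
      simp [baseCoord, ht])
    (fun u j hj => by rw [← testSystem_of_mem hj, hz]; rfl)
    (fun u j hj => by rw [← testSystem_of_notMem hj, hz]; rfl)
    (by rwa [h1]) (fun u => by rwa [h2])
  refine (pi_norm_le_iff_of_nonneg (by linarith)).2 ?_
  rintro (i | ⟨u, t⟩)
  · have := h3 i
    rw [coordAt_cubeLin_add_smul_fst, dif_pos (i.2.trans_le hr)] at this
    simpa [baseCoord] using this
  · have := h4 u t
    rwa [coordAt_cubeLin_add_smul_snd, dif_pos t.2] at this

theorem finrank_eq_card_coords (hM : m + c = M) :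
    Module.finrank ℝ (TreeNode h → Fin M → ℝ) =
      Fintype.card (Fin ((2 ^ h - 1) * c) ⊕ TreeNode h × Fin m) := by
  rw [Module.finrank_pi_fintype]
  simp only [Module.finrank_fintype_fun_eq_card, Fintype.card_fin, Finset.sum_const,
    Finset.card_univ, smul_eq_mul, Fintype.card_sum, Fintype.card_prod, TreeNode.card, ← hM]
  ring

theorem injective_testSystem_comp (hκ : IsCoeffBound M κ) (hM : m + c = M)
    (hle : 2 ^ h * c ≤ M) {J : TreeNode h → Finset (Fin M)} (hJ : ∀ u, (J u).card = 2 ^ u.ht * c) :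
    Function.Injective (testSystem m c κ J ∘ₗ cubeLin h m ((2 ^ h - 1) * c)) := by
  refine (injective_iff_map_eq_zero _).2 fun z hz => ?_
  have := norm_le_of_testSystem_eq_zero hκ hM hle hJ (z := z) le_rfl (by simpa using hz)
  exact norm_le_zero_iff.1 (by simpa using this)

theorem exists_testSystem_eq_zero (hκ : IsCoeffBound M κ) (hM : m + c = M)
    (hle : 2 ^ h * c ≤ M) {J : TreeNode h → Finset (Fin M)} (hJ : ∀ u, (J u).card = 2 ^ u.ht * c) :
    ∃ z : Fin ((2 ^ h - 1) * c) ⊕ TreeNode h × Fin m → ℝ,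
      testSystem m c κ J (cubeLin h m _ z + capVec h m) = 0 := by
  have hsurj := (LinearMap.injective_iff_surjective_of_finrank_eq_finrank (by
    rw [finrank_eq_card_coords hM, Module.finrank_fintype_fun_eq_card])).1
    (injective_testSystem_comp hκ hM hle hJ)
  obtain ⟨z, hz⟩ := hsurj (-testSystem m c κ J (capVec h m))
  refine ⟨z, ?_⟩
  rw [LinearMap.comp_apply] at hz
  rw [map_add, hz, neg_add_cancel]

theorem testLow_testHigh_ne_zero (hκ : IsCoeffBound M κ) (hM : m + c = M)
    (hle : 2 ^ h * c ≤ M) {J : TreeNode h → Finset (Fin M)} (hJ : ∀ u, (J u).card = 2 ^ u.ht * c)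
    {z : Fin r ⊕ TreeNode h × Fin m → ℝ}
    (hz : testSystem m c κ J (cubeLin h m _ z + capVec h m) = 0) (u : TreeNode h) (j : Fin M) :
    (j ∉ J u → testLow c κ u (j : ℕ) (cubeLin h m _ z + capVec h m) ≠ 0) ∧
      (j ∈ J u → testHigh c κ u (j : ℕ) (cubeLin h m _ z + capVec h m) ≠ 0) := by
  constructor
  · refine (abs_nodePos_le_of_testLow hκ (hJ u) fun j hj => ?_).2 ?_ j
    · rw [← testSystem_of_mem hj, hz]; rfl
    · simp [cubeLin, capVec]
  · intro hj
    have hc : ((J u)ᶜ).card = m - (2 ^ u.ht - 1) * c := by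
      rw [Finset.card_compl, Fintype.card_fin, hJ]
      have := (block_start_le hM hle u.ht_lt.le).2
      omega
    refine (abs_coordAt_le_of_testHigh hκ hc fun j hj => ?_).2 ?_ j (by simpa using hj)
    · rw [← testSystem_of_notMem (Finset.mem_compl.1 hj), hz]; rfl
    · simp [cubeLin, capVec]

open scoped Classical in
/-- Near a zero the test map is the linear system up to signs. -/
theorem exists_sign_testMap (hκ : IsCoeffBound M κ) (hM : m + c = M)
    (hle : 2 ^ h * c ≤ M) {J : TreeNode h → Finset (Fin M)} (hJ : ∀ u, (J u).card = 2 ^ u.ht * c)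
    {z : Fin ((2 ^ h - 1) * c) ⊕ TreeNode h × Fin m → ℝ}
    (hz : testSystem m c κ J (cubeLin h m _ z + capVec h m) = 0) :
    ∃ L : (Fin ((2 ^ h - 1) * c) ⊕ TreeNode h × Fin m → ℝ) →ₗ[ℝ] TreeNode h → Fin M → ℝ,
      Function.Injective L ∧
        ∀ᶠ v in 𝓝 (0 : Fin ((2 ^ h - 1) * c) ⊕ TreeNode h × Fin m → ℝ),
          testMap M c κ (cubeConfig (z + v)) = L v := by
  have hnorm : ‖z‖ ≤ 1 / 16 :=
    norm_le_of_testSystem_eq_zero hκ hM hle hJ zero_le_one (by rwa [one_smul])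
  have hne := testLow_testHigh_ne_zero hκ hM hle hJ hz
  let σ : TreeNode h → Fin M → ℝ := fun u j =>
    if j ∈ J u then SignType.sign (testHigh c κ u (j : ℕ) (cubeLin h m _ z + capVec h m))
    else SignType.sign (testLow c κ u (j : ℕ) (cubeLin h m _ z + capVec h m))
  have hsign_ne : ∀ a : ℝ, a ≠ 0 → ((SignType.sign a : SignType) : ℝ) ≠ 0 := by
    intro a ha
    rcases lt_or_gt_of_ne ha with h1 | h1
    · simp [sign_neg h1]
    · simp [sign_pos h1]
  have hσ : ∀ u j, σ u j ≠ 0 := by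
    intro u j
    simp only [σ]
    split_ifs with hj
    · exact hsign_ne _ ((hne u j).2 hj)
    · exact hsign_ne _ ((hne u j).1 hj)
  let L0 := testSystem m c κ J ∘ₗ cubeLin h m ((2 ^ h - 1) * c)
  refine ⟨LinearMap.pi fun u => LinearMap.pi fun j =>
    σ u j • (LinearMap.proj j ∘ₗ LinearMap.proj u ∘ₗ L0), ?_, ?_⟩
  · refine (injective_iff_map_eq_zero _).2 fun v hv => ?_
    refine (injective_iff_map_eq_zero L0).1 (injective_testSystem_comp hκ hM hle hJ) v ?_
    funext u j
    have := congrFun (congrFun hv u) j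
    simp only [LinearMap.pi_apply, LinearMap.smul_apply, LinearMap.comp_apply, smul_eq_mul,
      Pi.zero_apply, mul_eq_zero, LinearMap.proj_apply] at this
    exact this.resolve_left (hσ u j)
  · have hsmall : ∀ᶠ v in 𝓝 (0 : Fin ((2 ^ h - 1) * c) ⊕ TreeNode h × Fin m → ℝ),
        ‖z + v‖ < 1 / 2 := by
      have hcont : Continuous fun v : Fin ((2 ^ h - 1) * c) ⊕ TreeNode h × Fin m → ℝ =>
        ‖z + v‖ := by fun_prop
      refine hcont.continuousAt.eventually_lt continuousAt_const ?_
      rw [add_zero]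
      linarith
    have hsign : ∀ a : ((Fin m → ℝ) × ℝ) × (TreeNode h → (Fin m → ℝ) × ℝ) →ₗ[ℝ] ℝ,
        ∀ b : ((Fin m → ℝ) × ℝ) × (TreeNode h → (Fin m → ℝ) × ℝ) →ₗ[ℝ] ℝ,
        a (cubeLin h m _ z + capVec h m) = 0 → b (cubeLin h m _ z + capVec h m) ≠ 0 →
        ∀ᶠ v in 𝓝 (0 : Fin ((2 ^ h - 1) * c) ⊕ TreeNode h × Fin m → ℝ),
          signedMin (a (cubeLin h m _ (z + v) + capVec h m))
            (b (cubeLin h m _ (z + v) + capVec h m)) =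
          SignType.sign (b (cubeLin h m _ z + capVec h m)) * a (cubeLin h m _ v) := by
      intro a b ha hb
      have hcube : Continuous fun v => cubeLin h m ((2 ^ h - 1) * c) (z + v) + capVec h m :=
        ((cubeLin h m _).continuous_of_finiteDimensional.comp
          (continuous_const.add continuous_id)).add continuous_const
      have hca := a.continuous_of_finiteDimensional.comp hcube
      have hcb := b.continuous_of_finiteDimensional.comp hcube
      have h1 : ∀ᶠ v in 𝓝 (0 : Fin ((2 ^ h - 1) * c) ⊕ TreeNode h × Fin m → ℝ),
          |a (cubeLin h m _ (z + v) + capVec h m)| < |b (cubeLin h m _ (z + v) + capVec h m)| := by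
        refine hca.abs.continuousAt.eventually_lt hcb.abs.continuousAt ?_
        simp only [Function.comp_apply, add_zero, ha, abs_zero]
        exact abs_pos.2 hb
      have h2 : ∀ᶠ v in 𝓝 (0 : Fin ((2 ^ h - 1) * c) ⊕ TreeNode h × Fin m → ℝ),
          0 < b (cubeLin h m _ z + capVec h m) * b (cubeLin h m _ (z + v) + capVec h m) := by
        refine continuousAt_const.eventually_lt
          ((continuous_const.mul hcb).continuousAt (f := fun v =>
            b (cubeLin h m _ z + capVec h m) * b (cubeLin h m _ (z + v) + capVec h m))) ?_
        simp only [add_zero]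
        exact mul_self_pos.2 hb
      filter_upwards [h1, h2] with v hv1 hv2
      have h3 : a (cubeLin h m _ (z + v) + capVec h m) = a (cubeLin h m _ v) := by
        rw [map_add (cubeLin h m _), add_right_comm, map_add a, ha, zero_add]
      rw [signedMin_of_abs_lt hv1, h3]
      congr 2
      rcases pos_and_pos_or_neg_and_neg_of_mul_pos hv2 with ⟨h4, h5⟩ | ⟨h4, h5⟩
      · rw [sign_pos h4, sign_pos h5]
      · rw [sign_neg h4, sign_neg h5]
    have hall : ∀ᶠ v in 𝓝 (0 : Fin ((2 ^ h - 1) * c) ⊕ TreeNode h × Fin m → ℝ), ∀ u (j : Fin M),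
        signedMin (testLow c κ u (j : ℕ) (cubeLin h m _ (z + v) + capVec h m))
          (testHigh c κ u (j : ℕ) (cubeLin h m _ (z + v) + capVec h m)) = σ u j * L0 v u j := by
      refine eventually_all.2 fun u => eventually_all.2 fun j => ?_
      by_cases hj : j ∈ J u
      · filter_upwards [hsign (testLow c κ u (j : ℕ)) (testHigh c κ u (j : ℕ))
          (by rw [← testSystem_of_mem hj, hz]; rfl) ((hne u j).2 hj)] with v hv
        rw [hv]
        simp only [σ, L0, if_pos hj, LinearMap.comp_apply, testSystem_of_mem hj]
      · filter_upwards [hsign (testHigh c κ u (j : ℕ)) (testLow c κ u (j : ℕ))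
          (by rw [← testSystem_of_notMem hj, hz]; rfl) ((hne u j).1 hj)] with v hv
        rw [signedMin_comm, hv]
        simp only [σ, L0, if_neg hj, LinearMap.comp_apply, testSystem_of_notMem hj]
    filter_upwards [hsmall, hall] with v hv1 hv2
    funext u j
    rw [cubeConfig_eq_cubeLin_add_of_norm_le hv1.le]
    exact hv2 u j

/-- An equivariant map of the cube with the symmetries of the test map has a zero, provided that
equivariant maps can take prescribed values on small finite sets. -/
theorem exists_zero_of_equivariant {ℓ : ℕ} (hM : m + c = 2 ^ ℓ - 1) (hle : 2 ^ h * c ≤ 2 ^ ℓ - 1)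
    (Φ : (Fin ((2 ^ h - 1) * c) ⊕ TreeNode h × Fin m → ℝ) → TreeNode h → Fin (2 ^ ℓ - 1) → ℝ)
    (hΦ : Continuous Φ)
    (hΦT : ∀ i z, ‖z‖ ≤ 1 → |z i| = 1 →
      Φ ((cubePerm (coordSym i)).act z) = treeSym (coordSym i) (Φ z))
    (μ : ℝ) (hμ : 0 < μ)
    (hgood : ∀ A : Finset (Fin ((2 ^ h - 1) * c) ⊕ TreeNode h × Fin m → ℝ),
      (∀ a ∈ A, ‖a‖ ≤ 1) → (∀ a ∈ A, ∀ b ∈ A, ‖a - b‖ ≤ μ) →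
      ∀ val : (Fin ((2 ^ h - 1) * c) ⊕ TreeNode h × Fin m → ℝ) →
        TreeNode h → Fin (2 ^ ℓ - 1) → ℝ,
      ∃ F : (Fin ((2 ^ h - 1) * c) ⊕ TreeNode h × Fin m → ℝ) → TreeNode h → Fin (2 ^ ℓ - 1) → ℝ,
        (∀ i z, ‖z‖ ≤ 1 → |z i| = 1 →
          F ((cubePerm (coordSym i)).act z) = treeSym (coordSym i) (F z)) ∧
        ∀ a ∈ A, F a = val a) :
    ∃ z, ‖z‖ ≤ 1 ∧ Φ z = 0 := by
  classical
  by_contra! hcon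
  obtain ⟨κ, -, hκ⟩ := exists_polyVal_coeff_bound (2 ^ ℓ - 1)
  replace hκ : IsCoeffBound (2 ^ ℓ - 1) κ := hκ
  have hr := (block_start_le hM hle le_rfl).1
  let 𝒥 := ∀ u : TreeNode h, {s : Finset (Fin (2 ^ ℓ - 1)) // s.card = 2 ^ u.ht * c}
  have hex := fun J : 𝒥 => exists_testSystem_eq_zero (J := fun u => (J u : Finset (Fin _)))
    hκ hM hle fun u => (J u).2
  choose ctr hctr using hex
  have hctr_norm : ∀ J, ‖ctr J‖ ≤ 1 / 16 := fun J =>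
    norm_le_of_testSystem_eq_zero (J := fun u => (J u : Finset (Fin _))) hκ hM hle
      (fun u => (J u).2) zero_le_one (by rw [one_smul]; exact hctr J)
  choose lin hlin hloc using fun J : 𝒥 => exists_sign_testMap hκ hM hle (fun u => (J u).2) (hctr J)
  have hctr_inj : Function.Injective ctr := by
    have hsub : ∀ J J' : 𝒥, ctr J = ctr J' → ∀ u, ∀ j ∈ (J u).1, j ∈ (J' u).1 := by
      intro J J' hJJ u j hj
      by_contra hj'
      refine (testLow_testHigh_ne_zero hκ hM hle (fun u => (J' u).2) (hctr J') u j).1 hj' ?_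
      rw [← hJJ, ← testSystem_of_mem (J := fun u => (J u : Finset (Fin _))) hj, hctr J]
      rfl
    intro J J' hJJ
    funext u
    refine Subtype.ext (Finset.Subset.antisymm ?_ ?_)
    · exact hsub J J' hJJ u
    · exact hsub J' J hJJ.symm u
  have heven := even_card_of_equivariant_cube_maps (finrank_eq_card_coords (h := h) hM)
    (fun i => cubePerm (coordSym i)) cubePerm_toFun cubePerm_neg
    (fun i => treeSymLin (Fin (2 ^ ℓ - 1) → ℝ) (coordSym i))
    (fun i => treeSymLin_injective (coordSym i)) Φ
    (fun z => testMap (2 ^ ℓ - 1) c κ (cubeConfig z)) hΦ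
    ((continuous_testMap _ c κ).comp continuous_cubeConfig) hΦT
    (fun i z hz hi => by
      rw [cubeConfig_act hr i z hz hi, testMap_treeSym]
      rfl) hcon
    ctr hctr_inj (fun J => (hctr_norm J).trans_lt (by norm_num))
    (fun z hz hzero => by
      obtain ⟨J, hJ, hP, hR, hx, hw⟩ := exists_subsets_of_testMap_eq_zero hκ hM hle hz hzero
      rw [cubeConfig_eq_cubeLin_add hx hw] at hP hR
      refine ⟨fun u => ⟨J u, hJ u⟩, injective_testSystem_comp hκ hM hle hJ ?_⟩
      have h1 : testSystem m c κ J (cubeLin h m _ z + capVec h m) = 0 := by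
        funext u j
        by_cases hj : j ∈ J u
        · rw [testSystem_of_mem hj, hP u j hj]; rfl
        · rw [testSystem_of_notMem hj, hR u j hj]; rfl
      have h2 := hctr fun u => ⟨J u, hJ u⟩
      rw [map_add] at h1 h2
      exact add_right_cancel (h1.trans h2.symm))
    lin hlin hloc μ hμ hgood
  refine Nat.not_even_iff_odd.2 ?_ heven
  rw [Fintype.card_pi]
  refine Finset.prod_induction _ Odd (fun _ _ => Odd.mul) odd_one fun u _ => ?_
  rw [Fintype.card_finset_len, Fintype.card_fin]
  refine odd_choose_two_pow_sub_one ℓ _ ?_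
  have := (block_start_le hM hle u.ht_lt.le).2
  omega

end AffineSystem

section LeafPoints

variable {h m r : ℕ} {δ : ℝ}

/-- The points at the leaves of a configuration, at scale `δ`. -/
noncomputable def leafPoints {m : ℕ} (δ : ℝ)
    (p : ((Fin m → ℝ) × ℝ) × (TreeNode h → (Fin m → ℝ) × ℝ)) (l : TreeLeaf h) : (Fin m → ℝ) × ℝ :=
  p.1 + leafSum (fun u => (δ * 4 ^ u.ht) • p.2 u) l

theorem continuous_leafPoints (δ : ℝ) : Continuous (leafPoints (h := h) (m := m) δ) := by
  have hψ : Continuous fun (p : ((Fin m → ℝ) × ℝ) × (TreeNode h → (Fin m → ℝ) × ℝ))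
      (u : TreeNode h) => (δ * 4 ^ u.ht) • p.2 u := by fun_prop
  exact continuous_pi fun l => continuous_fst.add (continuous_leafSum hψ l)

theorem leafPoints_treeSym (s : Option (TreeNode h))
    (p : ((Fin m → ℝ) × ℝ) × (TreeNode h → (Fin m → ℝ) × ℝ)) (l : TreeLeaf h) :
    leafPoints δ (symSign s • p.1, fun u => symSign s • treeSym s p.2 u) l =
      symSign s • leafPoints δ p (leafSym s l) := by
  simp only [leafPoints, smul_add]
  rw [leafSum_smul_treeSym s p.2 fun n => δ * 4 ^ n]

theorem nonempty_treeLeaf (h : ℕ) : Nonempty (TreeLeaf h) :=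
  Fintype.card_pos_iff.1 (by rw [TreeLeaf.card]; positivity)

theorem leafPoints_injective (hδ : 0 < δ) :
    Function.Injective (leafPoints (h := h) (m := m) δ) := by
  intro p q hpq
  have hw : ∀ u, p.2 u = q.2 u := by
    have h1 := leafDiff_const_add_leafSum p.1 fun u => (δ * 4 ^ u.ht) • p.2 u
    have h2 := leafDiff_const_add_leafSum q.1 fun u => (δ * 4 ^ u.ht) • q.2 u
    intro u
    have h3 : (δ * 4 ^ u.ht) • p.2 u = (δ * 4 ^ u.ht) • q.2 u :=
      (congrFun h1 u).symm.trans ((congrArg (fun G => leafDiff G u) hpq).trans (congrFun h2 u))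
    exact smul_right_injective _ (by positivity : δ * 4 ^ u.ht ≠ 0) h3
  obtain ⟨l⟩ := nonempty_treeLeaf h
  have h1 := congrFun hpq l
  simp only [leafPoints, hw] at h1
  exact Prod.ext (add_right_cancel h1) (funext hw)

theorem norm_leafPoints_sub_le (hδ : 0 < δ)
    {z : Fin r ⊕ TreeNode h × Fin m → ℝ} (hz : ‖z‖ ≤ 1) (l : TreeLeaf h) :
    3 * ‖leafPoints δ (cubeConfig z) l - (cubeConfig z).1‖ ≤ δ * 4 ^ h := by
  rw [leafPoints, add_sub_cancel_left]
  refine (norm_leafSum_le δ _ (fun u => ?_) l).trans (by linarith)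
  rw [norm_smul, Real.norm_of_nonneg (by positivity)]
  exact mul_le_of_le_one_right (by positivity) (norm_capLift_le (norm_nodeCoord_le hz u))

theorem le_norm_leafPoints_sub (hδ : 0 < δ)
    {z : Fin r ⊕ TreeNode h × Fin m → ℝ} (hz : ‖z‖ ≤ 1) {l l' : TreeLeaf h} (hl : l ≠ l') :
    δ ≤ 3 * ‖leafPoints δ (cubeConfig z) l - leafPoints δ (cubeConfig z) l'‖ := by
  rw [leafPoints, leafPoints, add_sub_add_left_eq_sub]
  refine le_norm_leafSum_sub hδ.le _ (fun u => ?_) (fun u => ?_) hl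
  · rw [norm_smul, Real.norm_of_nonneg (by positivity)]
    exact mul_le_of_le_one_right (by positivity) (norm_capLift_le (norm_nodeCoord_le hz u))
  · rw [norm_smul, Real.norm_of_nonneg (by positivity)]
    have h1 : 1 / 2 ≤ ‖(cubeConfig z).2 u‖ := half_le_norm_capLift (norm_nodeCoord_le hz u)
    have h2 : 0 < δ * 4 ^ u.ht := by positivity
    nlinarith

/-- A close pair of configurations cannot be matched by a nontrivial symmetry. -/
theorem eq_of_leafPoints_eq_smul (hr : r ≤ m) (hδ : 0 < δ) (hδh : δ * 4 ^ h ≤ 1 / 2)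
    {a b : Fin r ⊕ TreeNode h × Fin m → ℝ} (ha : ‖a‖ ≤ 1) (hb : ‖b‖ ≤ 1)
    (hab : ∀ l,
      ‖leafPoints δ (cubeConfig a) l - leafPoints δ (cubeConfig b) l‖ < min (δ / 3) (1 / 8))
    {π : TreeLeaf h → TreeLeaf h} {σ : ℤˣ}
    (heq : ∀ l, leafPoints δ (cubeConfig a) l = σ • leafPoints δ (cubeConfig b) (π l)) :
    a = b ∧ π = id ∧ σ = 1 := by
  obtain rfl | rfl := Int.units_eq_one_or σ
  · have hπ : π = id := by
      funext l
      by_contra hl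
      have h1 := le_norm_leafPoints_sub hδ hb hl
      have h2 := (hab l).trans_le (min_le_left _ _)
      rw [heq l, one_smul] at h2
      simp only [id] at h1
      linarith
    subst hπ
    refine ⟨cubeConfig_injective hr (leafPoints_injective hδ (funext fun l => ?_)), rfl, rfl⟩
    simpa using heq l
  · exfalso
    obtain ⟨l⟩ := nonempty_treeLeaf h
    have h1 := norm_leafPoints_sub_le hδ ha l
    have h2 := norm_leafPoints_sub_le hδ hb l
    have h3 := norm_leafPoints_sub_le hδ hb (π l)
    have h4 := (hab l).trans_le (min_le_right _ _)
    have h5 : 1 / 2 ≤ ‖(cubeConfig a).1‖ := half_le_norm_capLift (norm_baseCoord_le ha)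
    have h6 := heq l
    rw [Units.neg_smul, one_smul] at h6
    set x := (cubeConfig a).1
    set x' := (cubeConfig b).1
    set y := leafPoints δ (cubeConfig a) l
    set y' := leafPoints δ (cubeConfig b) l
    set y'' := leafPoints δ (cubeConfig b) (π l)
    have h7 : (2 : ℝ) • x = -(y - x) - (y - x) + (y - y') + (y' - x') - (y'' - x') := by
      rw [h6]
      module
    have h8 : ‖(2 : ℝ) • x‖ ≤ ‖y - x‖ + ‖y - x‖ + ‖y - y'‖ + ‖y' - x'‖ + ‖y'' - x'‖ := by
      rw [h7]
      refine (norm_sub_le _ _).trans (add_le_add_left ((norm_add_le _ _).trans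
        (add_le_add_left ((norm_add_le _ _).trans (add_le_add_left
          ((norm_sub_le _ _).trans (by rw [norm_neg])) _)) _)) _)
    rw [norm_smul, Real.norm_ofNat] at h8
    linarith

/-- An even map to a space of not too large dimension takes equal values at the leaves of some
small configuration. -/
theorem exists_equal_values_of_even {ℓ c : ℕ} (hM : m + c = 2 ^ ℓ - 1)
    (hle : 2 ^ h * c ≤ 2 ^ ℓ - 1) (g : (Fin m → ℝ) × ℝ → Fin (2 ^ ℓ - 1) → ℝ) (hg : Continuous g)
    (hgeven : ∀ y, g (-y) = g y) (ε : ℝ) (hε : 0 < ε) :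
    ∃ (x : (Fin m → ℝ) × ℝ) (y : TreeLeaf h → (Fin m → ℝ) × ℝ), 1 / 2 ≤ ‖x‖ ∧ ‖x‖ ≤ 1 ∧
      Function.Injective y ∧ (∀ l, ‖y l - x‖ ≤ ε) ∧ ∀ l l', g (y l) = g (y l') := by
  classical
  have hr := (block_start_le hM hle le_rfl).1
  obtain ⟨δ, hδ, hδε, hδh⟩ : ∃ δ : ℝ, 0 < δ ∧ δ * 4 ^ h ≤ ε ∧ δ * 4 ^ h ≤ 1 / 2 := by
    have h4 : (0 : ℝ) < 4 ^ h := by positivity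
    refine ⟨min ε (1 / 2) / 4 ^ h, by positivity, ?_, ?_⟩ <;> rw [div_mul_cancel₀ _ h4.ne']
    · exact min_le_left _ _
    · exact min_le_right _ _
  let Y : (Fin ((2 ^ h - 1) * c) ⊕ TreeNode h × Fin m → ℝ) → TreeLeaf h → (Fin m → ℝ) × ℝ :=
    fun z => leafPoints δ (cubeConfig z)
  have hY : Continuous Y := (continuous_leafPoints δ).comp continuous_cubeConfig
  have hYT : ∀ i z, ‖z‖ ≤ 1 → |z i| = 1 → ∀ l, Y ((cubePerm (coordSym i)).act z) l =
      symSign (coordSym i) • Y z (leafSym (coordSym i) l) := fun i z hz hi l => by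
    simp only [Y]
    rw [cubeConfig_act hr i z hz hi, leafPoints_treeSym]
  have hgunit : ∀ (σ : ℤˣ) y, g (σ • y) = g y := fun σ y => by
    obtain rfl | rfl := Int.units_eq_one_or σ
    · rw [one_smul]
    · rw [Units.neg_smul, one_smul, hgeven]
  obtain ⟨μ, hμ, hclose⟩ : ∃ μ > 0, ∀ a b, ‖a‖ ≤ 1 → ‖b‖ ≤ 1 → ‖a - b‖ ≤ μ →
      ∀ l, ‖Y a l - Y b l‖ < min (δ / 3) (1 / 8) := by
    have huc := (isCompact_closedBall (0 : Fin ((2 ^ h - 1) * c) ⊕ TreeNode h × Fin m → ℝ)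
      1).uniformContinuousOn_of_continuous hY.continuousOn
    obtain ⟨μ, hμ, h1⟩ := Metric.uniformContinuousOn_iff.1 huc (min (δ / 3) (1 / 8)) (by positivity)
    refine ⟨μ / 2, by positivity, fun a b ha hb hab l => ?_⟩
    have h2 := h1 a (by simpa using ha) b (by simpa using hb) (by rw [dist_eq_norm]; linarith)
    rw [← dist_eq_norm]
    exact (dist_le_pi_dist _ _ l).trans_lt h2
  have hgood : ∀ A : Finset (Fin ((2 ^ h - 1) * c) ⊕ TreeNode h × Fin m → ℝ),
      (∀ a ∈ A, ‖a‖ ≤ 1) → (∀ a ∈ A, ∀ b ∈ A, ‖a - b‖ ≤ μ) →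
      ∀ val : (Fin ((2 ^ h - 1) * c) ⊕ TreeNode h × Fin m → ℝ) →
        TreeNode h → Fin (2 ^ ℓ - 1) → ℝ,
      ∃ F : (Fin ((2 ^ h - 1) * c) ⊕ TreeNode h × Fin m → ℝ) → TreeNode h → Fin (2 ^ ℓ - 1) → ℝ,
        (∀ i z, ‖z‖ ≤ 1 → |z i| = 1 →
          F ((cubePerm (coordSym i)).act z) = treeSym (coordSym i) (F z)) ∧
        ∀ a ∈ A, F a = val a := by
    intro A hA hAμ val
    let H : (Fin ((2 ^ h - 1) * c) ⊕ TreeNode h × Fin m → ℝ) → TreeLeaf h →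
        Fin (2 ^ ℓ - 1) → ℝ := fun z l => ∑ a ∈ A, ∑ q : Equiv.Perm (TreeLeaf h) × ℤˣ,
      if ∀ l', Y z l' = q.2 • Y a (q.1 l') then leafSum (val a) (q.1 l) else 0
    refine ⟨fun z => leafDiff (H z), fun i z hz hi => ?_, fun a ha => ?_⟩
    · have hH : H ((cubePerm (coordSym i)).act z) = fun l => H z (leafSym (coordSym i) l) := by
        funext l
        refine Finset.sum_congr rfl fun a _ => ?_
        have hinv : Function.Involutive (leafSym (coordSym i)) := leafSym_leafSym (coordSym i)
        refine Fintype.sum_equiv (Equiv.prodCongr (Equiv.mulRight (hinv.toPerm _))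
          (Equiv.mulLeft (symSign (coordSym i)))) _ _ fun q => ?_
        have hiff : (∀ l', Y ((cubePerm (coordSym i)).act z) l' = q.2 • Y a (q.1 l')) ↔
            ∀ l', Y z l' = (symSign (coordSym i) * q.2) • Y a (q.1 (leafSym (coordSym i) l')) := by
          constructor
          · intro hq l'
            rw [mul_smul, ← hq, hYT i z hz hi, hinv, smul_smul, symSign_mul_self, one_smul]
          · intro hq l'
            rw [hYT i z hz hi, hq, hinv, smul_smul, ← mul_assoc, symSign_mul_self, one_mul]
        simp only [hiff, Equiv.prodCongr_apply, Prod.map_fst, Prod.map_snd, Equiv.coe_mulRight,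
          Equiv.coe_mulLeft, Equiv.Perm.coe_mul, Function.comp_apply,
          Function.Involutive.coe_toPerm, hinv l]
      simp only [hH]
      exact leafDiff_leafSym _ _
    · have hH : H a = leafSum (val a) := by
        funext l
        have hsymm : ∀ b ∈ A, ∀ q : Equiv.Perm (TreeLeaf h) × ℤˣ,
            (∀ l', Y a l' = q.2 • Y b (q.1 l')) → a = b ∧ q = 1 := by
          intro b hb q hq
          obtain ⟨h1, h2, h3⟩ := eq_of_leafPoints_eq_smul hr hδ hδh (hA a ha) (hA b hb)
            (hclose a b (hA a ha) (hA b hb) (hAμ a ha b hb)) hq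
          exact ⟨h1, Prod.ext (Equiv.ext fun l => congrFun h2 l) h3⟩
        simp only [H]
        rw [Finset.sum_eq_single_of_mem a ha, Finset.sum_eq_single_of_mem 1 (Finset.mem_univ _)]
        · simp
        · intro q _ hq
          exact if_neg fun hcond => hq (hsymm a ha q hcond).2
        · intro b hb hba
          exact Finset.sum_eq_zero fun q _ => if_neg fun hcond => hba (hsymm b hb q hcond).1.symm
      simp only [hH]
      exact leafDiff_leafSum _
  obtain ⟨z, hz, hzero⟩ := exists_zero_of_equivariant hM hle
    (fun z => leafDiff fun l => g (Y z l))
    (continuous_leafDiff (continuous_pi fun l => hg.comp (continuous_pi_iff.1 hY l)))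
    (fun i z hz hi => by
      simp only [hYT i z hz hi, hgunit]
      exact leafDiff_leafSym _ fun l => g (Y z l)) μ hμ hgood
  refine ⟨(cubeConfig z).1, Y z, half_le_norm_capLift (norm_baseCoord_le hz),
    norm_capLift_le (norm_baseCoord_le hz), fun l l' hl => ?_, fun l => ?_,
    fun l l' => eq_of_leafDiff_eq_zero hzero l l'⟩
  · by_contra hne
    have := le_norm_leafPoints_sub hδ hz hne
    simp only [Y] at hl
    rw [hl, sub_self, norm_zero] at this
    linarith
  · have := norm_leafPoints_sub_le hδ hz l
    have h2 := norm_nonneg (leafPoints δ (cubeConfig z) l - (cubeConfig z).1)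
    change ‖leafPoints δ (cubeConfig z) l - (cubeConfig z).1‖ ≤ ε
    linarith

end LeafPoints

section ConeMap

variable {E F : Type*} [NormedAddCommGroup E] [NormedSpace ℝ E] [NormedAddCommGroup F]
  [NormedSpace ℝ F]

theorem continuous_projectivization_mk :
    Continuous fun v : {v : E // v ≠ 0} => Projectivization.mk ℝ v.1 v.2 :=
  continuous_quotient_mk'

open Classical in
/-- The positively homogeneous extension of a map from a projective space to a sphere. -/
noncomputable def coneMap (f : Projectivization ℝ E → Metric.sphere (0 : F) 1) (v : E) : F :=
  if hv : v = 0 then 0 else ‖v‖ • (f (Projectivization.mk ℝ v hv) : F)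

variable (f : Projectivization ℝ E → Metric.sphere (0 : F) 1)

theorem norm_coneMap (v : E) : ‖coneMap f v‖ = ‖v‖ := by
  unfold coneMap
  split_ifs with hv
  · simp [hv]
  · rw [norm_smul, norm_norm, norm_eq_of_mem_sphere, mul_one]

theorem coneMap_neg (v : E) : coneMap f (-v) = coneMap f v := by
  unfold coneMap
  by_cases hv : v = 0
  · simp [hv]
  · have hv' : -v ≠ 0 := neg_ne_zero.2 hv
    rw [dif_neg hv, dif_neg hv', norm_neg]
    congr 3
    exact (Projectivization.mk_eq_mk_iff' ℝ _ _ hv' hv).2 ⟨-1, by simp⟩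

variable {f}

theorem continuous_coneMap (hf : Continuous f) : Continuous (coneMap f) := by
  rw [continuous_iff_continuousAt]
  intro v
  by_cases hv : v = 0
  · subst hv
    have h0 : coneMap f 0 = 0 := by simp [coneMap]
    rw [ContinuousAt, h0, tendsto_zero_iff_norm_tendsto_zero]
    simp only [norm_coneMap]
    exact tendsto_norm_zero
  · have hopen : IsOpen {v : E | v ≠ 0} := isOpen_ne
    refine ContinuousOn.continuousAt (s := {v : E | v ≠ 0}) ?_ (hopen.mem_nhds hv)
    rw [continuousOn_iff_continuous_domRestrict]
    have h1 : Set.domRestrict {v : E | v ≠ 0} (coneMap f) =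
        fun v : {v : E // v ≠ 0} => ‖v.1‖ • (f (Projectivization.mk ℝ v.1 v.2) : F) := by
      funext v
      exact dif_neg v.2
    rw [h1]
    exact (continuous_subtype_val.norm).smul
      (continuous_subtype_val.comp (hf.comp continuous_projectivization_mk))

theorem eq_of_coneMap_eq {v w : E} (hv : v ≠ 0) (hw : w ≠ 0) (h : coneMap f v = coneMap f w) :
    f (Projectivization.mk ℝ v hv) = f (Projectivization.mk ℝ w hw) := by
  have hn : ‖v‖ = ‖w‖ := by rw [← norm_coneMap f, h, norm_coneMap]
  unfold coneMap at h
  rw [dif_neg hv, dif_neg hw, hn] at h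
  exact Subtype.ext (smul_right_injective F (norm_ne_zero_iff.2 hw) h)

theorem eq_or_eq_neg_of_mk_eq_mk {v w : E} (hv : v ≠ 0) (hw : w ≠ 0) (hn : ‖v‖ = ‖w‖)
    (h : Projectivization.mk ℝ v hv = Projectivization.mk ℝ w hw) : v = w ∨ v = -w := by
  obtain ⟨t, ht⟩ := (Projectivization.mk_eq_mk_iff' ℝ _ _ hv hw).1 h
  have h1 : |t| = 1 := by
    rw [← ht, norm_smul, Real.norm_eq_abs] at hn
    exact mul_right_cancel₀ (norm_ne_zero_iff.2 hw) (hn.trans (one_mul _).symm)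
  rcases eq_or_eq_neg_of_abs_eq h1 with rfl | rfl
  · exact Or.inl (by rw [← ht, one_smul])
  · exact Or.inr (by rw [← ht, neg_smul, one_smul])

end ConeMap

/-- A continuous map admits a local multiplicity as soon as its homogeneous extension has
arbitrarily concentrated sets of points with equal values in a compact annulus. -/
theorem admitsLocalMultiplicity_of_coneMap {ι V E F : Type*} [Fintype ι] [NormedAddCommGroup V]
    [NormedSpace ℝ V] [FiniteDimensional ℝ V] [NormedAddCommGroup E] [NormedSpace ℝ E]
    [NormedAddCommGroup F] [NormedSpace ℝ F] (e : V ≃L[ℝ] E)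
    (f : Projectivization ℝ E → Metric.sphere (0 : F) 1)
    (H : ∀ ε : ℝ, 0 < ε → ∃ (x : V) (y : ι → V), 1 / 2 ≤ ‖x‖ ∧ ‖x‖ ≤ 1 ∧ Function.Injective y ∧
      (∀ i, ‖y i - x‖ ≤ ε) ∧ ∀ i j, coneMap f (e (y i)) = coneMap f (e (y j))) :
    AdmitsLocalMultiplicity f (Fintype.card ι) := by
  have hε (n : ℕ) : (0 : ℝ) < 1 / ((n : ℝ) + 1) := by positivity
  choose x y hx1 hx2 hinj hclose heq using fun n : ℕ => H _ (hε n)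
  have hcompact : IsCompact (Metric.closedBall (0 : V) 1) := isCompact_closedBall 0 1
  obtain ⟨x₀, -, φ, hφ, hlim⟩ :=
    hcompact.tendsto_subseq (x := x) fun n => by simpa using hx2 n
  have hnorm : 1 / 2 ≤ ‖x₀‖ :=
    ge_of_tendsto (hlim.norm) (Eventually.of_forall fun n => hx1 (φ n))
  have hx₀ : x₀ ≠ 0 := by
    rintro rfl
    norm_num at hnorm
  have hε0 : Tendsto (fun n => 1 / ((φ n : ℝ) + 1)) atTop (𝓝 0) :=
    tendsto_one_div_add_atTop_nhds_zero_nat.comp hφ.tendsto_atTop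
  have hylim (i : ι) : Tendsto (fun n => y (φ n) i) atTop (𝓝 x₀) := by
    have h1 : Tendsto (fun n => y (φ n) i - x (φ n)) atTop (𝓝 0) :=
      squeeze_zero_norm (fun n => hclose (φ n) i) hε0
    simpa using h1.add hlim
  have he0 {v : V} (hv : v ≠ 0) : e v ≠ 0 := by simpa using hv
  refine ⟨Projectivization.mk ℝ (e x₀) (he0 hx₀), fun U hU => ?_⟩
  have hpre := continuous_projectivization_mk.continuousAt.preimage_mem_nhds
    (x := (⟨e x₀, he0 hx₀⟩ : {v : E // v ≠ 0})) hU
  obtain ⟨S, hS, hSU⟩ := mem_nhds_subtype _ _ _ |>.1 hpre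
  have hS' : ∀ i, ∀ᶠ n in atTop, e (y (φ n) i) ∈ S := fun i =>
    ((e.continuous.tendsto x₀).comp (hylim i)).eventually hS
  have hquarter : ∀ᶠ n in atTop, 1 / ((φ n : ℝ) + 1) < 1 / 4 :=
    hε0.eventually (gt_mem_nhds (by norm_num))
  obtain ⟨n, hn, hn4⟩ := ((eventually_all.2 hS').and hquarter).exists
  have hfar (i : ι) : ‖y (φ n) i - x (φ n)‖ < 1 / 4 := (hclose _ i).trans_lt hn4
  have hy0 (i : ι) : y (φ n) i ≠ 0 := by
    intro h0
    have h1 := hfar i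
    have h2 := hx1 (φ n)
    rw [h0, zero_sub, norm_neg] at h1
    linarith
  refine ⟨fun j => Projectivization.mk ℝ _ (he0 (hy0 ((Fintype.equivFin ι).symm j))), ?_, ?_, ?_⟩
  · intro j j' hj
    have h1 := eq_or_eq_neg_of_mk_eq_mk _ _ (by
      rw [← norm_coneMap f, heq _ _ ((Fintype.equivFin ι).symm j'), norm_coneMap]) hj
    apply (Fintype.equivFin ι).symm.injective
    rcases h1 with h1 | h1
    · exact hinj _ (e.injective h1)
    · exfalso
      rw [← map_neg] at h1
      have h2 := e.injective h1
      have h3 := hfar ((Fintype.equivFin ι).symm j)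
      have h4 := hfar ((Fintype.equivFin ι).symm j')
      rw [h2] at h3
      have h5 := norm_add_le (-y (φ n) ((Fintype.equivFin ι).symm j') - x (φ n))
        (y (φ n) ((Fintype.equivFin ι).symm j') - x (φ n))
      have h6 : -y (φ n) ((Fintype.equivFin ι).symm j') - x (φ n) +
          (y (φ n) ((Fintype.equivFin ι).symm j') - x (φ n)) = -((2 : ℝ) • x (φ n)) := by
        rw [two_smul]; abel
      rw [h6, norm_neg, norm_smul, Real.norm_two] at h5
      linarith [hx1 (φ n)]
  · intro j
    exact hSU (a := ⟨_, he0 (hy0 _)⟩) (hn _)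
  · intro j j'
    exact eq_of_coneMap_eq _ _ (heq _ _ _)

/-- Every continuous map `ℝP^{2^ℓ-2-a} → S^{2^ℓ-2}` admits a local `k`-multiplicity,
whenever `k ≥ 2` is a power of `2` and `k(a+1) ≤ 2^ℓ - 1`. -/
theorem localMultiplicity_of_continuous_projective_to_sphere
    (a ℓ k : ℕ) (ha : 1 ≤ a) (hℓ : 1 ≤ ℓ) (hk : 2 ≤ k) (hk2 : ∃ i : ℕ, k = 2 ^ i)
    (hka : k * (a + 1) ≤ 2 ^ ℓ - 1)
    (f : Projectivization ℝ (EuclideanSpace ℝ (Fin (2 ^ ℓ - 2 - a + 1))) →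
      Metric.sphere (0 : EuclideanSpace ℝ (Fin (2 ^ ℓ - 2 + 1))) 1)
    (hf : Continuous f) :
    AdmitsLocalMultiplicity f k := by
  obtain ⟨h, rfl⟩ := hk2
  have h2a : 2 * (a + 1) ≤ 2 ^ ℓ - 1 := (Nat.mul_le_mul_right _ hk).trans hka
  have hM : (2 ^ ℓ - 2 - a) + (a + 1) = 2 ^ ℓ - 1 := by omega
  have hn : 2 ^ ℓ - 1 = 2 ^ ℓ - 2 + 1 := by omega
  let e : ((Fin (2 ^ ℓ - 2 - a) → ℝ) × ℝ) ≃L[ℝ] EuclideanSpace ℝ (Fin (2 ^ ℓ - 2 - a + 1)) :=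
    ContinuousLinearEquiv.ofFinrankEq (by simp)
  have key := admitsLocalMultiplicity_of_coneMap (ι := TreeLeaf h) e f fun ε hε => by
    obtain ⟨x, y, h1, h2, h3, h4, h5⟩ := exists_equal_values_of_even hM hka
      (fun v i => coneMap f (e v) (Fin.cast hn i))
      (continuous_pi fun i => (EuclideanSpace.proj (𝕜 := ℝ) (Fin.cast hn i)).continuous.comp
        ((continuous_coneMap hf).comp e.continuous))
      (fun v => by simp only [map_neg, coneMap_neg]) ε hε
    refine ⟨x, y, h1, h2, h3, h4, fun i j => ?_⟩
    ext q
    exact congrFun (h5 i j) (Fin.cast hn.symm q)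
  rwa [TreeLeaf.card] at key
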